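/- Let (d_i, e_i)_{0 ≤ i ≤ 3} be a lexicographically ordered tuple of pairs of non-negative integers with d_i + d_j and e_i + e_j even for all i, j. Suppose that one of the following holds: (1) d₁ ≥ 1, d₃ ≥ 2, e₁ + e₂ ≥ 1 and e₃ ≥ 3; or (2) d₁ ≥ 1, d₃ ≥ 2, e₀ ≥ 1, e₁ + e₂ ≥ 1 and e₂ ≥ 2. Then a very general complex projective quadric surface bundle X over ℙ¹ × ℙ¹ of type (d_i, e_i)_{0 ≤ i ≤ 3} is not stably rational. -/

import Mathlib

/-!
Rationality, stable rationality and stable birationality, expressed via function fields: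
a variety `X` over `k` with function field `F` (a `k`-algebra via `c : k →+* F`) is rational
iff `F ≅ k(t₁,…,t_n)` over `k`, and stably rational iff `F(t₁,…,t_m) ≅ k(t₁,…,t_n)` over `k`
for some `m, n`. Two varieties are stably birational iff their function fields become
isomorphic after adjoining finitely many indeterminates.
-/

noncomputable section

/-- The rational function field `k(t₁, …, t_n)`. -/
def ratFuncField (k : Type) [Field k] (n : ℕ) : Type :=
  FractionRing (MvPolynomial (Fin n) k)

instance (k : Type) [Field k] (n : ℕ) : Field (ratFuncField k n) := by
  unfold ratFuncField; infer_instance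

/-- The canonical map `k → k(t₁, …, t_n)`. -/
def ratFuncFieldMap (k : Type) [Field k] (n : ℕ) : k →+* ratFuncField k n :=
  (algebraMap (MvPolynomial (Fin n) k) (FractionRing (MvPolynomial (Fin n) k))).comp
    (MvPolynomial.C)

/-- Given a function field `F` over `k` (via `c : k →+* F`), the canonical map
`k → Frac(F[t₁,…,t_m]) = F(t₁,…,t_m)`. -/
def adjoinIndetsMap {k F : Type} [CommRing k] [CommRing F] (c : k →+* F) (m : ℕ) :
    k →+* FractionRing (MvPolynomial (Fin m) F) :=
  (algebraMap (MvPolynomial (Fin m) F) (FractionRing (MvPolynomial (Fin m) F))).comp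
    ((MvPolynomial.C).comp c)

/-- A variety over `k` with function field `F` (via `c : k →+* F`) is rational iff
`F ≅ k(t₁,…,t_n)` as `k`-algebras for some `n`. -/
def IsRationalFunctionField {k F : Type} [Field k] [CommRing F] (c : k →+* F) : Prop :=
  ∃ (n : ℕ) (e : F ≃+* ratFuncField k n), (e : F →+* ratFuncField k n).comp c =
    ratFuncFieldMap k n

/-- A variety over `k` with function field `F` (via `c : k →+* F`) is stably rational iff
`F(t₁,…,t_m) ≅ k(t₁,…,t_n)` as `k`-algebras for some `m, n`. -/
def IsStablyRationalFunctionField {k F : Type} [Field k] [CommRing F] (c : k →+* F) : Prop :=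
  ∃ (m n : ℕ) (e : FractionRing (MvPolynomial (Fin m) F) ≃+* ratFuncField k n),
    (e : FractionRing (MvPolynomial (Fin m) F) →+* ratFuncField k n).comp
      (adjoinIndetsMap c m) = ratFuncFieldMap k n

/-- Two varieties over `K` with function fields `L₁, L₂` (via `i₁ : K →+* L₁`,
`i₂ : K →+* L₂`) are stably birational over `K` iff `L₁(t₁,…,t_a) ≅ L₂(t₁,…,t_b)`
as `K`-algebras for some `a, b`. -/
def StablyBirationalOver {K L₁ L₂ : Type} [Field K] [CommRing L₁] [CommRing L₂]
    (i₁ : K →+* L₁) (i₂ : K →+* L₂) : Prop :=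
  ∃ (a b : ℕ) (e : FractionRing (MvPolynomial (Fin a) L₁) ≃+*
      FractionRing (MvPolynomial (Fin b) L₂)),
    (e : FractionRing (MvPolynomial (Fin a) L₁) →+*
      FractionRing (MvPolynomial (Fin b) L₂)).comp (adjoinIndetsMap i₁ a) =
      adjoinIndetsMap i₂ b

end

/-!
Very general members of linear families, and quadric surface bundles over `ℙ²` given by
symmetric matrices of homogeneous forms, described via affine charts and function fields.
-/

noncomputable section

/-- A polynomial function on a `ℂ`-vector space `P`: a function factoring through finitely
many linear coordinates via a polynomial. -/
def IsPolynomialFun {P : Type} [AddCommGroup P] [Module ℂ P] (f : P → ℂ) : Prop :=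
  ∃ (N : ℕ) (l : Fin N → (P →ₗ[ℂ] ℂ)) (F : MvPolynomial (Fin N) ℂ),
    ∀ p : P, f p = MvPolynomial.eval (fun i => l i p) F

/-- A property `Q` holds for a very general member of the linear parameter space `P` if it
holds away from a countable union of proper algebraic hypersurfaces, i.e. if there are
countably many nonzero polynomial functions on `P` such that `Q p` holds whenever none of
them vanishes at `p`. -/
def VeryGeneral {P : Type} [AddCommGroup P] [Module ℂ P] (Q : P → Prop) : Prop :=
  ∃ 𝒞 : Set (P → ℂ), 𝒞.Countable ∧ (∀ f ∈ 𝒞, IsPolynomialFun f ∧ f ≠ 0) ∧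
    ∀ p : P, (∀ f ∈ 𝒞, f p ≠ 0) → Q p

/-- Dehomogenization `ℂ[x,y,z] → ℂ[x,y] ⊆ ℂ[x,y,z₁,z₂,z₃]` at the chart `z = 1` of `ℙ²`
(the first two variables of `Fin 5` are the base coordinates). -/
def dehomP2 : MvPolynomial (Fin 3) ℂ →+* MvPolynomial (Fin 5) ℂ :=
  (MvPolynomial.aeval ![MvPolynomial.X 0, MvPolynomial.X 1, 1]).toRingHom

/-- Dehomogenization `ℂ[x,y,z] → ℂ[x,y]` at the chart `z = 1`. -/
def dehomP2' : MvPolynomial (Fin 3) ℂ →+* MvPolynomial (Fin 2) ℂ :=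
  (MvPolynomial.aeval ![MvPolynomial.X 0, MvPolynomial.X 1, 1]).toRingHom

/-- The defining polynomial `∑_{i,j} a_{ij}(x,y,1) z_i z_j` (with `z₀ = 1`) of the affine
chart of the quadric surface bundle `X = {∑ a_{ij} z_i z_j = 0} ⊆ ℙ(E)` over `ℙ²`. -/
def quadricBundleChartPoly (A : Fin 4 → Fin 4 → MvPolynomial (Fin 3) ℂ) :
    MvPolynomial (Fin 5) ℂ :=
  ∑ i : Fin 4, ∑ j : Fin 4, dehomP2 (A i j) *
    (![1, MvPolynomial.X 2, MvPolynomial.X 3, MvPolynomial.X 4] i) *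
    (![1, MvPolynomial.X 2, MvPolynomial.X 3, MvPolynomial.X 4] j)

/-- The coordinate ring of the affine chart (`z = 1` on `ℙ²` and `z₀ = 1` on the fibre)
of the quadric surface bundle `X ⊆ ℙ(E)` over `ℙ²` determined by the symmetric matrix
`(a_{ij})`. -/
def quadricBundleChartRing (A : Fin 4 → Fin 4 → MvPolynomial (Fin 3) ℂ) : Type :=
  MvPolynomial (Fin 5) ℂ ⧸ Ideal.span {quadricBundleChartPoly A}

instance (A : Fin 4 → Fin 4 → MvPolynomial (Fin 3) ℂ) :
    CommRing (quadricBundleChartRing A) :=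
  Ideal.Quotient.commRing _

/-- The function field `ℂ(X)` of the quadric surface bundle `X` over `ℙ²` given by the
matrix `(a_{ij})`, as the fraction ring of the affine chart. -/
def quadricBundleFunctionField (A : Fin 4 → Fin 4 → MvPolynomial (Fin 3) ℂ) : Type :=
  FractionRing (quadricBundleChartRing A)

instance (A : Fin 4 → Fin 4 → MvPolynomial (Fin 3) ℂ) :
    CommRing (quadricBundleFunctionField A) := by
  unfold quadricBundleFunctionField; infer_instance

/-- The canonical map `ℂ → ℂ(X)`. -/
def quadricBundleFFMap (A : Fin 4 → Fin 4 → MvPolynomial (Fin 3) ℂ) :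
    ℂ →+* quadricBundleFunctionField A :=
  (algebraMap (quadricBundleChartRing A) (FractionRing (quadricBundleChartRing A))).comp
    ((Ideal.Quotient.mk _).comp (MvPolynomial.C))

/-- The conditions for the symmetric matrix `(a_{ij})` of forms to define a quadric surface
bundle over `ℙ²`: the quadratic form is generically nondegenerate, and nonzero on every
fibre (so that `X → ℙ²` is flat). Homogeneity of the `a_{ij}` of the correct degrees is
part of the choice of parameter space. -/
def IsQuadricBundleP2 (A : Fin 4 → Fin 4 → MvPolynomial (Fin 3) ℂ) : Prop :=
  Matrix.det (Matrix.of fun i j => A i j + A j i) ≠ 0 ∧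
  ∀ v : Fin 3 → ℂ, v ≠ 0 → ∃ i j, MvPolynomial.eval v (A i j + A j i) ≠ 0

/-- The quadric surface bundle over `ℙ²` given by `(a_{ij})` admits a rational section:
there are rational functions `σ₀, …, σ₃` on `ℙ²`, not all zero, with
`∑ a_{ij} σ_i σ_j = 0`. -/
def HasRationalSectionP2 (A : Fin 4 → Fin 4 → MvPolynomial (Fin 3) ℂ) : Prop :=
  ∃ σ : Fin 4 → FractionRing (MvPolynomial (Fin 2) ℂ), σ ≠ 0 ∧
    ∑ i : Fin 4, ∑ j : Fin 4,
      (algebraMap (MvPolynomial (Fin 2) ℂ) (FractionRing (MvPolynomial (Fin 2) ℂ)))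
        (dehomP2' (A i j)) * σ i * σ j = 0

end

/-!
Quadric surface bundles over `ℙ¹ × ℙ¹`, via the affine chart `x₀ = y₀ = 1` and the fibre
chart `z₀ = 1`. Base coordinates are `x₀, x₁, y₀, y₁` (the variables of `Fin 4`).
-/

noncomputable section

/-- The weight vector selecting the first `ℙ¹`-factor's variables. -/
def p1p1Weight1 : Fin 4 → ℕ := ![1, 1, 0, 0]

/-- The weight vector selecting the second `ℙ¹`-factor's variables. -/
def p1p1Weight2 : Fin 4 → ℕ := ![0, 0, 1, 1]

/-- Dehomogenization `ℂ[x₀,x₁,y₀,y₁] → ℂ[x,y] ⊆ ℂ[x,y,z₁,z₂,z₃]` at the chart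
`x₀ = y₀ = 1`. -/
def dehomP1P1 : MvPolynomial (Fin 4) ℂ →+* MvPolynomial (Fin 5) ℂ :=
  (MvPolynomial.aeval ![1, MvPolynomial.X 0, 1, MvPolynomial.X 1]).toRingHom

/-- The defining polynomial `∑_{i,j} a_{ij}(1,x,1,y) z_i z_j` (with `z₀ = 1`) of the
affine chart of the quadric surface bundle `X = {∑ a_{ij} z_i z_j = 0} ⊆ ℙ(E)` over
`ℙ¹ × ℙ¹`. -/
def p1p1BundleChartPoly (A : Fin 4 → Fin 4 → MvPolynomial (Fin 4) ℂ) :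
    MvPolynomial (Fin 5) ℂ :=
  ∑ i : Fin 4, ∑ j : Fin 4, dehomP1P1 (A i j) *
    (![1, MvPolynomial.X 2, MvPolynomial.X 3, MvPolynomial.X 4] i) *
    (![1, MvPolynomial.X 2, MvPolynomial.X 3, MvPolynomial.X 4] j)

/-- The coordinate ring of the affine chart of the quadric surface bundle over
`ℙ¹ × ℙ¹`. -/
def p1p1BundleChartRing (A : Fin 4 → Fin 4 → MvPolynomial (Fin 4) ℂ) : Type :=
  MvPolynomial (Fin 5) ℂ ⧸ Ideal.span {p1p1BundleChartPoly A}

instance (A : Fin 4 → Fin 4 → MvPolynomial (Fin 4) ℂ) :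
    CommRing (p1p1BundleChartRing A) :=
  Ideal.Quotient.commRing _

/-- The canonical map `ℂ → ℂ(X)` for the quadric surface bundle `X` over `ℙ¹ × ℙ¹`. -/
def p1p1BundleFFMap (A : Fin 4 → Fin 4 → MvPolynomial (Fin 4) ℂ) :
    ℂ →+* FractionRing (p1p1BundleChartRing A) :=
  (algebraMap (p1p1BundleChartRing A) (FractionRing (p1p1BundleChartRing A))).comp
    ((Ideal.Quotient.mk _).comp (MvPolynomial.C))

/-- The conditions for the matrix `(a_{ij})` of bihomogeneous forms to define a quadric
surface bundle over `ℙ¹ × ℙ¹`: generic nondegeneracy, and the quadratic form is nonzero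
on every fibre. -/
def IsQuadricBundleP1P1 (A : Fin 4 → Fin 4 → MvPolynomial (Fin 4) ℂ) : Prop :=
  Matrix.det (Matrix.of fun i j => A i j + A j i) ≠ 0 ∧
  ∀ v : Fin 4 → ℂ, (![v 0, v 1] : Fin 2 → ℂ) ≠ 0 → (![v 2, v 3] : Fin 2 → ℂ) ≠ 0 →
    ∃ i j, MvPolynomial.eval v (A i j + A j i) ≠ 0

/-- The type `(dᵢ, eᵢ)` is lexicographically ordered. -/
def LexOrderedType (d e : Fin 4 → ℕ) : Prop :=
  ∀ i : Fin 3, d i.castSucc < d i.succ ∨ (d i.castSucc = d i.succ ∧ e i.castSucc ≤ e i.succ)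

end

/-- The quaternion symbol `(a, b)` splits: `b` is a value of the norm form of `√a`. -/
def Spl {E : Type*} [Field E] (a b : E) : Prop := ∃ r s : E, b = r ^ 2 - a * s ^ 2

namespace Spl

variable {E : Type*} [Field E] {a b c : E}

theorem mul (hb : Spl a b) (hc : Spl a c) : Spl a (b * c) := by
  obtain ⟨r, s, rfl⟩ := hb
  obtain ⟨u, v, rfl⟩ := hc
  exact ⟨r * u + a * s * v, r * v + s * u, by ring⟩

theorem of_sq (a c : E) : Spl a (c ^ 2) := ⟨c, 0, by ring⟩

theorem mul_sq_iff (hc : c ≠ 0) : Spl a (b * c ^ 2) ↔ Spl a b := by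
  refine ⟨fun h => ?_, fun h => h.mul (of_sq a c)⟩
  have := h.mul (of_sq a c⁻¹)
  rwa [mul_assoc, ← mul_pow, mul_inv_cancel₀ hc, one_pow, mul_one] at this

theorem of_mul_left (hb0 : b ≠ 0) (hb : Spl a b) (h : Spl a (b * c)) : Spl a c := by
  have := hb.mul h
  rw [show b * (b * c) = c * b ^ 2 by ring] at this
  exact (mul_sq_iff hb0).1 this

theorem sq_mul_left_iff (hc : c ≠ 0) : Spl (a * c ^ 2) b ↔ Spl a b := by
  constructor
  · rintro ⟨r, s, rfl⟩
    exact ⟨r, c * s, by ring⟩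
  · rintro ⟨r, s, rfl⟩
    exact ⟨r, s / c, by field_simp⟩

theorem of_isSquare (h2 : (2 : E) ≠ 0) (hc : c ≠ 0) : Spl (c ^ 2) b :=
  ⟨(b + 1) / 2, (b - 1) / (2 * c), by field_simp; ring⟩

theorem symm (h2 : (2 : E) ≠ 0) (hb : b ≠ 0) (h : Spl a b) : Spl b a := by
  obtain ⟨r, s, h⟩ := h
  by_cases hs : s = 0
  · subst hs
    have hr : r ≠ 0 := by
      rintro rfl
      exact hb (by rw [h]; ring)
    rw [show b = r ^ 2 by rw [h]; ring]
    exact of_isSquare h2 hr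
  · refine ⟨r / s, 1 / s, ?_⟩
    rw [h]
    field_simp
    ring

theorem map {F : Type*} [Field F] (f : E →+* F) (h : Spl a b) : Spl (f a) (f b) := by
  obtain ⟨r, s, rfl⟩ := h
  exact ⟨f r, f s, by simp⟩

/-- The symbol splits as soon as the ternary form `⟨1, -a, -b⟩` is isotropic. -/
theorem of_isotropic (h2 : (2 : E) ≠ 0) (ha : a ≠ 0) {r s t : E} (h : r ^ 2 - a * s ^ 2 = b * t ^ 2)
    (hne : r ≠ 0 ∨ s ≠ 0 ∨ t ≠ 0) : Spl a b := by
  by_cases ht : t = 0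
  · subst ht
    have hs : s ≠ 0 := by
      rintro rfl
      have : r = 0 := by simpa using h
      simp_all
    have hr : r ≠ 0 := by
      rintro rfl
      have : a * s ^ 2 = 0 := by linear_combination -h
      simp_all
    have : a = (r / s) ^ 2 := by
      field_simp
      linear_combination -h
    rw [this]
    exact of_isSquare h2 (div_ne_zero hr hs)
  · refine ⟨r / t, s / t, ?_⟩
    field_simp
    linear_combination -h

end Spl

open Polynomial in
/-- An anisotropic diagonal form over `E` has no cancellation in top degree over `E[X]`. -/
theorem natDegree_le_of_diagonal_form {E : Type*} [Field E] {ι : Type*} [Fintype ι] (c : ι → E)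
    (hc : ∀ v : ι → E, ∑ i, c i * v i ^ 2 = 0 → v = 0) (v : ι → E[X]) (M : ℕ)
    (h : (∑ i, C (c i) * v i ^ 2).natDegree ≤ 2 * M) (i : ι) : (v i).natDegree ≤ M := by
  have key : ∀ N, (∀ i, (v i).natDegree ≤ M + N) → ∀ i, (v i).natDegree ≤ M := by
    intro N
    induction N with
    | zero => intro h; simpa using h
    | succ N ih =>
      intro hv
      apply ih
      have h0 : (∑ i, C (c i) * v i ^ 2).coeff ((M + (N + 1)) + (M + (N + 1))) = 0 :=
        coeff_eq_zero_of_natDegree_lt (by omega)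
      rw [finsetSum_coeff] at h0
      have h1 := hc (fun i => (v i).coeff (M + (N + 1))) (by
        rw [← h0]
        refine Finset.sum_congr rfl fun i _ => ?_
        rw [coeff_C_mul, pow_two (v i), coeff_mul_add_eq_of_natDegree_le (hv i) (hv i), pow_two])
      intro i
      have h2 : (v i).coeff (M + (N + 1)) = 0 := congrFun h1 i
      by_contra h3
      have h4 : (v i).natDegree = M + (N + 1) := by have := hv i; omega
      rw [← h4, coeff_natDegree, leadingCoeff_eq_zero] at h2
      rw [h2] at h4
      simp at h4
  exact key (∑ i, (v i).natDegree) (fun i => le_trans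
    (Finset.single_le_sum (f := fun i => (v i).natDegree) (fun _ _ => Nat.zero_le _)
      (Finset.mem_univ i)) (Nat.le_add_left _ _)) i

open Polynomial in
theorem eq_zero_of_diagonal_form {E : Type*} [Field E] {ι : Type*} [Fintype ι] (c : ι → E)
    (hc : ∀ v : ι → E, ∑ i, c i * v i ^ 2 = 0 → v = 0) (v : ι → E[X])
    (h : ∑ i, C (c i) * v i ^ 2 = 0) : v = 0 := by
  have h1 := natDegree_le_of_diagonal_form c hc v 0 (by simp [h])
  have h2 := hc (fun i => (v i).coeff 0) (by
    have := congrArg (fun p => eval 0 p) h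
    simpa [eval_finsetSum, coeff_zero_eq_eval_zero] using this)
  funext i
  rw [eq_C_of_natDegree_le_zero (h1 i)]
  have := congrFun h2 i
  simp only [Pi.zero_apply] at this
  simp [this]

open Polynomial in
/-- Cassels's descent: a polynomial represented over `E(X)` by an anisotropic diagonal form
is represented over `E[X]`. -/
theorem cassels_polynomial {E : Type*} [Field E] {ι : Type*} [Fintype ι] (c : ι → E)
    (hc : ∀ v : ι → E, ∑ i, c i * v i ^ 2 = 0 → v = 0) (f : E[X]) :
    ∀ (N : ℕ) (w : E[X]) (v : ι → E[X]), w.natDegree ≤ N → w ≠ 0 →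
      ∑ i, C (c i) * v i ^ 2 = f * w ^ 2 → ∃ u : ι → E[X], ∑ i, C (c i) * u i ^ 2 = f := by
  intro N
  induction N with
  | zero =>
    intro w v hw hw0 h
    rw [eq_C_of_natDegree_le_zero hw] at h hw0
    set t := w.coeff 0
    have ht : t ≠ 0 := by rintro h; simp [h] at hw0
    refine ⟨fun i => C t⁻¹ * v i, ?_⟩
    have : ∀ i, C (c i) * (C t⁻¹ * v i) ^ 2 = C (t⁻¹ ^ 2) * (C (c i) * v i ^ 2) := by
      intro i; simp only [map_pow]; ring
    simp only [this]
    rw [← Finset.mul_sum, h, mul_comm f, ← mul_assoc, ← C_pow, ← C_mul]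
    simp [ht]
  | succ N ih =>
    intro w v hw hw0 h
    set u : ι → E[X] := fun i => v i / w
    set r : ι → E[X] := fun i => v i % w
    have hv : ∀ i, v i = w * u i + r i := fun i => (EuclideanDomain.div_add_mod (v i) w).symm
    by_cases hr : r = 0
    · refine ⟨u, ?_⟩
      have hv' : ∀ i, v i = w * u i := fun i => by rw [hv i, hr]; simp
      have : (∑ i, C (c i) * u i ^ 2) * w ^ 2 = f * w ^ 2 := by
        rw [← h, Finset.sum_mul]
        exact Finset.sum_congr rfl fun i _ => by rw [hv' i]; ring
      exact mul_right_cancel₀ (pow_ne_zero 2 hw0) this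
    set ψu := ∑ i, C (c i) * u i ^ 2
    set B := ∑ i, C (c i) * (v i * u i)
    set a := ψu - f
    set b := 2 * (f * w - B)
    set w' := a * w + b
    have hww : w * w' = ∑ i, C (c i) * r i ^ 2 := by
      have : ∀ i, C (c i) * r i ^ 2 = C (c i) * v i ^ 2 + w ^ 2 * (C (c i) * u i ^ 2)
          - 2 * w * (C (c i) * (v i * u i)) := by
        intro i; rw [show r i = v i - w * u i by rw [hv i]; ring]; ring
      simp only [this, Finset.sum_add_distrib, Finset.sum_sub_distrib, ← Finset.mul_sum]
      rw [h]
      simp only [w', a, b, ψu, B]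
      ring
    have hne : w * w' ≠ 0 := by
      rw [hww]; exact fun h => hr (eq_zero_of_diagonal_form c hc r h)
    have hw'0 : w' ≠ 0 := right_ne_zero_of_mul hne
    have hr' : ∀ i, r i = 0 ∨ (r i).natDegree < w.natDegree := by
      intro i
      by_cases h : r i = 0
      · exact Or.inl h
      · exact Or.inr (natDegree_lt_natDegree h (EuclideanDomain.mod_lt (v i) hw0))
    have hwpos : 0 < w.natDegree := by
      by_contra h0
      apply hr
      funext i
      rcases hr' i with h | h
      · exact h
      · omega
    have hdeg : (w * w').natDegree ≤ 2 * (w.natDegree - 1) := by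
      rw [hww]
      refine natDegree_sum_le_of_forall_le _ _ fun i _ => ?_
      refine (natDegree_C_mul_le _ _).trans ?_
      refine natDegree_pow_le.trans ?_
      rcases hr' i with h | h
      · simp [h]
      · omega
    rw [natDegree_mul hw0 hw'0] at hdeg
    refine ih w' (fun i => a * v i + b * u i) (by omega) hw'0 ?_
    have : ∀ i, C (c i) * (a * v i + b * u i) ^ 2 = a ^ 2 * (C (c i) * v i ^ 2)
        + 2 * a * b * (C (c i) * (v i * u i)) + b ^ 2 * (C (c i) * u i ^ 2) := by
      intro i; ring
    simp only [this, Finset.sum_add_distrib, ← Finset.mul_sum]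
    rw [h]
    change a ^ 2 * (f * w ^ 2) + 2 * a * b * B + b ^ 2 * ψu = f * w' ^ 2
    rw [show ψu = a + f by simp [a], show w' = a * w + b from rfl]
    have hb : b = 2 * (f * w - B) := rfl
    clear_value b a B
    linear_combination (a * b) * hb

open Polynomial in
theorem cassels_quadratic {E : Type*} [Field E] (h2 : (2 : E) ≠ 0) {ι : Type*} [Fintype ι]
    (c : ι → E) (hc : ∀ v : ι → E, ∑ i, c i * v i ^ 2 = 0 → v = 0) (A B : E)
    (V : ι → RatFunc E)
    (hV : ∑ i, RatFunc.C (c i) * V i ^ 2 = RatFunc.C A * RatFunc.X ^ 2 + RatFunc.C B) :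
    ∃ v0 v1 : ι → E, ∑ i, c i * v1 i ^ 2 = A ∧ ∑ i, c i * v0 i ^ 2 = B ∧
      ∑ i, c i * (v0 i * v1 i) = 0 := by
  obtain ⟨w, hw⟩ := IsLocalization.exist_integer_multiples_of_finite (nonZeroDivisors E[X]) V
  choose v hv using hw
  have hinj := RatFunc.algebraMap_injective E
  have hw0 : (w : E[X]) ≠ 0 := nonZeroDivisors.coe_ne_zero w
  obtain ⟨u, hu⟩ := cassels_polynomial c hc (C A * X ^ 2 + C B) _ (w : E[X]) v le_rfl hw0 (by
    apply hinj
    simp only [map_sum, map_mul, map_pow, map_add, RatFunc.algebraMap_C, RatFunc.algebraMap_X,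
      ← hV, hv, Finset.sum_mul]
    refine Finset.sum_congr rfl fun i _ => ?_
    rw [Algebra.smul_def]
    ring)
  have hdeg := natDegree_le_of_diagonal_form c hc u 1 (by
    rw [hu]
    compute_degree)
  have hu' : ∀ i, u i = C ((u i).coeff 1) * X + C ((u i).coeff 0) := fun i =>
    eq_X_add_C_of_natDegree_le_one (hdeg i)
  have key : C (∑ i, c i * (u i).coeff 1 ^ 2) * X ^ 2
      + C (2 * ∑ i, c i * ((u i).coeff 0 * (u i).coeff 1)) * X
      + C (∑ i, c i * (u i).coeff 0 ^ 2) = C A * X ^ 2 + C 0 * X + C B := by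
    rw [map_zero, zero_mul, add_zero, ← hu]
    have : ∀ i, C (c i) * u i ^ 2 = C (c i * (u i).coeff 1 ^ 2) * X ^ 2
        + 2 * C (c i * ((u i).coeff 0 * (u i).coeff 1)) * X + C (c i * (u i).coeff 0 ^ 2) := by
      intro i
      conv_lhs => rw [hu' i]
      simp only [map_mul, map_pow]
      ring
    simp only [this, Finset.sum_add_distrib, ← Finset.sum_mul, ← Finset.mul_sum, map_sum, map_mul,
      map_ofNat]
  refine ⟨fun i => (u i).coeff 0, fun i => (u i).coeff 1, ?_, ?_, ?_⟩ <;>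
    generalize ∑ i, c i * (u i).coeff 1 ^ 2 = s at key ⊢ <;>
    generalize ∑ i, c i * (u i).coeff 0 ^ 2 = s' at key ⊢ <;>
    generalize ∑ i, c i * ((u i).coeff 0 * (u i).coeff 1) = t at key ⊢
  · have := congrArg (fun p => coeff p 2) key
    simp only [coeff_add, coeff_C_mul, coeff_X_pow, coeff_X, coeff_C] at this
    simpa using this
  · have := congrArg (fun p => coeff p 0) key
    simp only [coeff_add, coeff_C_mul, coeff_X_pow, coeff_X, coeff_C] at this
    simpa using this
  · have := congrArg (fun p => coeff p 1) key
    simp only [coeff_add, coeff_C_mul, coeff_X_pow, coeff_X, coeff_C] at this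
    simpa [h2] using this

/-- A place of the field `L` with values in the field `κ`; `R z c` says that `z` is finite with
value `c`. -/
structure FieldPlace (L κ : Type*) [Field L] [Field κ] where
  R : L → κ → Prop
  uniq : ∀ {z c d}, R z c → R z d → c = d
  one : R 1 1
  add : ∀ {z w c d}, R z c → R w d → R (z + w) (c + d)
  mul : ∀ {z w c d}, R z c → R w d → R (z * w) (c * d)
  neg : ∀ {z c}, R z c → R (-z) (-c)
  total : ∀ z, (∃ c, R z c) ∨ R z⁻¹ 0

namespace FieldPlace

variable {L κ : Type*} [Field L] [Field κ] (P : FieldPlace L κ)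

theorem zero : P.R 0 0 := by simpa using P.add P.one (P.neg P.one)

variable {P} {z w : L} {c d : κ}

theorem sub (h : P.R z c) (h' : P.R w d) : P.R (z - w) (c - d) := by
  simpa [sub_eq_add_neg] using P.add h (P.neg h')

theorem pow (h : P.R z c) (n : ℕ) : P.R (z ^ n) (c ^ n) := by
  induction n with
  | zero => simpa using P.one
  | succ n ih => simpa [pow_succ] using P.mul ih h

theorem ne_zero (h : P.R z c) (hc : c ≠ 0) : z ≠ 0 := by
  rintro rfl
  exact hc (P.uniq h P.zero)

theorem inv (h : P.R z c) (hc : c ≠ 0) : P.R z⁻¹ c⁻¹ := by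
  rcases P.total z⁻¹ with ⟨d, hd⟩ | h'
  · have h1 := P.mul h hd
    rw [mul_inv_cancel₀ (ne_zero h hc)] at h1
    rwa [← eq_inv_of_mul_eq_one_right (P.uniq h1 P.one)]
  · rw [inv_inv] at h'
    exact absurd (P.uniq h h') hc

theorem div (h : P.R z c) (h' : P.R w d) (hd : d ≠ 0) : P.R (z / w) (c / d) := by
  simpa [div_eq_mul_inv] using P.mul h (inv h' hd)

variable (P)

/-- The finite elements of a place form a valuation ring. -/
def vs : ValuationSubring L where
  carrier := {z | ∃ c, P.R z c}
  mul_mem' := by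
    rintro a b ⟨c, hc⟩ ⟨d, hd⟩
    exact ⟨_, P.mul hc hd⟩
  one_mem' := ⟨1, P.one⟩
  add_mem' := by
    rintro a b ⟨c, hc⟩ ⟨d, hd⟩
    exact ⟨_, P.add hc hd⟩
  zero_mem' := ⟨0, P.zero⟩
  neg_mem' := by
    rintro a ⟨c, hc⟩
    exact ⟨_, P.neg hc⟩
  mem_or_inv_mem' := fun z => (P.total z).imp id fun h => ⟨0, h⟩

/-- The residue map of a place. -/
noncomputable def res : P.vs →+* κ where
  toFun z := Classical.choose z.2
  map_one' := P.uniq (Classical.choose_spec (1 : P.vs).2) P.one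
  map_zero' := P.uniq (Classical.choose_spec (0 : P.vs).2) P.zero
  map_mul' a b := P.uniq (Classical.choose_spec (a * b).2)
    (P.mul (Classical.choose_spec a.2) (Classical.choose_spec b.2))
  map_add' a b := P.uniq (Classical.choose_spec (a + b).2)
    (P.add (Classical.choose_spec a.2) (Classical.choose_spec b.2))

theorem R_res (z : P.vs) : P.R z (P.res z) := Classical.choose_spec z.2

variable {P}

theorem res_eq {z : P.vs} (h : P.R z c) : P.res z = c := P.uniq (P.R_res z) h

theorem R_iff : P.R z c ↔ ∃ h : z ∈ P.vs, P.res ⟨z, h⟩ = c :=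
  ⟨fun h => ⟨⟨c, h⟩, res_eq (z := ⟨z, ⟨c, h⟩⟩) h⟩, fun ⟨h, h'⟩ => h' ▸ P.R_res ⟨z, h⟩⟩

variable (P)

theorem exists_content {ι : Type*} (s : Finset ι) (f : ι → L) (h : ∃ i ∈ s, f i ≠ 0) :
    ∃ i ∈ s, f i ≠ 0 ∧ ∀ k ∈ s, f k / f i ∈ P.vs := by
  obtain ⟨i, hi, hmax⟩ := s.exists_max_image (fun i => P.vs.valuation (f i)) (h.imp fun _ h => h.1)
  have hne : f i ≠ 0 := by
    rintro h0
    obtain ⟨k, hk, hk0⟩ := h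
    have := hmax k hk
    simp only [h0, map_zero, le_zero_iff] at this
    simp_all
  refine ⟨i, hi, hne, fun k hk => ?_⟩
  rw [← ValuationSubring.valuation_le_one_iff, map_div₀]
  exact div_le_one_of_le₀ (hmax k hk) zero_le

/-- Any place lies above a base; `IsGauss` says that the value group does not grow. -/
def SameValueGroup {K : Type*} [Field K] (ι : K →+* L) : Prop :=
  ∀ z : L, z ≠ 0 → ∃ c : K, c ≠ 0 ∧ ∃ u : L, z = ι c * u ∧ ∃ d : κ, d ≠ 0 ∧ P.R u d

variable {K k : Type*} [Field K] [Field k]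

/-- Extension of a place along an algebra of integral elements. -/
def extend (P : FieldPlace K k) {A : Type*} [CommRing A] (ι : K →+* L) (j : A →+* L)
    (ρ : A →+* κ) (h0 : ∀ a, j a = 0 → ρ a = 0)
    (hV : ∀ c ∈ P.vs, ∃ a, j a = ι c ∧ (P.R c 0 → ρ a = 0))
    (hU : ∀ z : L, z ≠ 0 → ∃ c : K, c ≠ 0 ∧ ∃ b s, ρ b ≠ 0 ∧ ρ s ≠ 0 ∧ z * j s = ι c * j b) :
    FieldPlace L κ where
  R z c := ∃ a b, ρ b ≠ 0 ∧ z * j b = j a ∧ c = ρ a / ρ b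
  uniq := by
    rintro z c d ⟨a, b, hb, h, rfl⟩ ⟨a', b', hb', h', rfl⟩
    have : ρ (a * b' - a' * b) = 0 := h0 _ (by simp only [map_sub, map_mul, ← h, ← h']; ring)
    rw [div_eq_div_iff hb hb']
    simpa [sub_eq_zero] using this
  one := ⟨1, 1, by simp, by simp, by simp⟩
  add := by
    rintro z w c d ⟨a, b, hb, h, rfl⟩ ⟨a', b', hb', h', rfl⟩
    refine ⟨a * b' + a' * b, b * b', by simp [hb, hb'], ?_, ?_⟩
    · simp only [map_add, map_mul, ← h, ← h']; ring
    · simp only [map_add, map_mul]; field_simp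
  mul := by
    rintro z w c d ⟨a, b, hb, h, rfl⟩ ⟨a', b', hb', h', rfl⟩
    refine ⟨a * a', b * b', by simp [hb, hb'], ?_, ?_⟩
    · simp only [map_mul, ← h, ← h']; ring
    · simp only [map_mul]; field_simp
  neg := by
    rintro z c ⟨a, b, hb, h, rfl⟩
    refine ⟨-a, b, hb, ?_, ?_⟩
    · simp only [map_neg, ← h]; ring
    · simp only [map_neg]; ring
  total := by
    intro z
    by_cases hz : z = 0
    · left
      exact ⟨0, 0, 1, by simp, by simp [hz], by simp⟩
    obtain ⟨c, hc, b, s, hb, hs, h⟩ := hU z hz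
    have hjb : j b ≠ 0 := fun h => hb (h0 _ h)
    have hιc : ι c ≠ 0 := (map_ne_zero ι).2 hc
    rcases P.total c with hfin | hinf
    · obtain ⟨a, ha, -⟩ := hV c hfin
      left
      exact ⟨_, a * b, s, hs, by rw [h, map_mul, ha], rfl⟩
    · obtain ⟨a, ha, ha0⟩ := hV c⁻¹ ⟨0, hinf⟩
      right
      refine ⟨a * s, b, hb, ?_, by simp [ha0 hinf]⟩
      rw [map_mul, ha, map_inv₀]
      field_simp
      linear_combination -h

theorem exists_extend (P : FieldPlace K k) {A : Type*} [CommRing A] (ι : K →+* L) (j : A →+* L)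
    (ρ : A →+* κ) (h0 : ∀ a, j a = 0 → ρ a = 0)
    (hV : ∀ c ∈ P.vs, ∃ a, j a = ι c ∧ (P.R c 0 → ρ a = 0))
    (hU : ∀ z : L, z ≠ 0 → ∃ c : K, c ≠ 0 ∧ ∃ b s, ρ b ≠ 0 ∧ ρ s ≠ 0 ∧ z * j s = ι c * j b) :
    ∃ Q : FieldPlace L κ, (∀ a, Q.R (j a) (ρ a)) ∧ Q.SameValueGroup ι := by
  have hR : ∀ a, (P.extend ι j ρ h0 hV hU).R (j a) (ρ a) := fun a =>
    ⟨a, 1, by simp, by simp, by simp⟩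
  refine ⟨P.extend ι j ρ h0 hV hU, hR, fun z hz => ?_⟩
  obtain ⟨c, hc, b, s, hb, hs, h⟩ := hU z hz
  have hjs : j s ≠ 0 := fun h => hs (h0 _ h)
  refine ⟨c, hc, j b / j s, ?_, ρ b / ρ s, div_ne_zero hb hs, div (hR b) (hR s) hs⟩
  rw [mul_div_assoc', ← h, mul_div_cancel_right₀ _ hjs]

theorem SameValueGroup.trans {K' : Type*} [Field K'] {P : FieldPlace K k} {Q : FieldPlace L κ}
    {ι : K →+* L} {ι' : K' →+* K} (hQ : Q.SameValueGroup ι) (hP : P.SameValueGroup ι')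
    (h : ∀ z c, P.R z c → c ≠ 0 → ∃ d ≠ 0, Q.R (ι z) d) : Q.SameValueGroup (ι.comp ι') := by
  intro z hz
  obtain ⟨f, hf, u, rfl, d, hd, hu⟩ := hQ z hz
  obtain ⟨c, hc, u', rfl, d', hd', hu'⟩ := hP f hf
  obtain ⟨d'', hd'', h''⟩ := h _ _ hu' hd'
  exact ⟨c, hc, ι u' * u, by simp [mul_assoc], d'' * d, mul_ne_zero hd'' hd, Q.mul h'' hu⟩

open Polynomial

/-- Every polynomial is a constant times a primitive integral polynomial. -/
theorem exists_primitive (P : FieldPlace K k) (p : K[X]) (hp : p ≠ 0) : ∃ c : K, c ≠ 0 ∧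
    ∃ b : P.vs[X], b.map P.res ≠ 0 ∧ p = C c * b.map P.vs.subtype := by
  obtain ⟨i, -, hi, h⟩ := P.exists_content p.support p.coeff
    ⟨p.natDegree, by simpa using hp, by simpa using hp⟩
  have : C (p.coeff i)⁻¹ * p ∈ lifts P.vs.subtype := by
    rw [lifts_iff_coeff_lifts]
    intro n
    rw [coeff_C_mul]
    by_cases hn : n ∈ p.support
    · exact ⟨⟨_, h n hn⟩, by simp [div_eq_inv_mul]⟩
    · rw [notMem_support_iff.1 hn]
      exact ⟨0, by simp⟩
  obtain ⟨b, hb⟩ := this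
  simp only [coe_mapRingHom] at hb
  refine ⟨_, hi, b, ?_, ?_⟩
  · intro h0
    have h1 : ((b.coeff i : P.vs) : K) = 1 := by
      have := congrArg (fun p => coeff p i) hb
      simpa [hi] using this
    have h2 := congrArg (fun p => coeff p i) h0
    have h3 : b.coeff i = 1 := Subtype.ext h1
    simp [h3] at h2
  · rw [hb, ← mul_assoc, ← C_mul, mul_inv_cancel₀ hi]; simp

theorem exists_primitive_mv (P : FieldPlace K k) {σ : Type*} (p : MvPolynomial σ K) (hp : p ≠ 0) :
    ∃ c : K, c ≠ 0 ∧ ∃ b : MvPolynomial σ P.vs, MvPolynomial.map P.res b ≠ 0 ∧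
      p = MvPolynomial.C c * MvPolynomial.map P.vs.subtype b := by
  obtain ⟨n, hn⟩ := MvPolynomial.ne_zero_iff.1 hp
  obtain ⟨i, -, hi, h⟩ := P.exists_content p.support p.coeff ⟨n, by simpa using hn, hn⟩
  have : MvPolynomial.C (p.coeff i)⁻¹ * p ∈ (MvPolynomial.map (σ := σ) P.vs.subtype).range := by
    rw [← SetLike.mem_coe, RingHom.coe_range, MvPolynomial.mem_range_map_iff_coeffs_subset]
    intro x hx
    rw [Finset.mem_coe, MvPolynomial.mem_coeffs_iff] at hx
    obtain ⟨n, hn, rfl⟩ := hx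
    rw [MvPolynomial.coeff_C_mul]
    by_cases hn : n ∈ p.support
    · exact ⟨⟨_, h n hn⟩, by simp [div_eq_inv_mul]⟩
    · rw [MvPolynomial.notMem_support_iff.1 hn]
      exact ⟨0, by simp⟩
  obtain ⟨b, hb⟩ := this
  refine ⟨_, hi, b, ?_, ?_⟩
  · intro h0
    have h1 : ((b.coeff i : P.vs) : K) = 1 := by
      have := congrArg (fun p => MvPolynomial.coeff i p) hb
      simpa [hi, MvPolynomial.coeff_map] using this
    have h2 := congrArg (fun p => MvPolynomial.coeff i p) h0
    have h3 : b.coeff i = 1 := Subtype.ext h1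
    simp [h3, MvPolynomial.coeff_map] at h2
  · rw [hb, ← mul_assoc, ← MvPolynomial.C_mul, mul_inv_cancel₀ hi]; simp

/-- The Gauss extension of a place to a fraction field, for an integral model `B` of the
domain `AK` all of whose elements have a content. -/
theorem exists_gauss (P : FieldPlace K k) {AK Ak B : Type*} [CommRing AK] [IsDomain AK]
    [CommRing Ak] [Algebra AK L] [IsFractionRing AK L] [Algebra Ak κ] [IsFractionRing Ak κ]
    [CommRing B] (CK : K →+* AK) (CB : P.vs →+* B) (f : B →+* AK) (ρ : B →+* Ak)
    (hf : Function.Injective f) (hC : ∀ c : P.vs, f (CB c) = CK c)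
    (hC0 : ∀ c : P.vs, P.res c = 0 → ρ (CB c) = 0)
    (hprim : ∀ p : AK, p ≠ 0 → ∃ c : K, c ≠ 0 ∧ ∃ b : B, ρ b ≠ 0 ∧ p = CK c * f b) :
    ∃ Q : FieldPlace L κ, (∀ b, Q.R (algebraMap AK L (f b)) (algebraMap Ak κ (ρ b))) ∧
      Q.SameValueGroup ((algebraMap AK L).comp CK) :=
  P.exists_extend ((algebraMap AK L).comp CK) ((algebraMap AK L).comp f) ((algebraMap Ak κ).comp ρ)
    (fun a ha => by
      have : f a = 0 := (IsFractionRing.injective AK L) (by simpa using ha)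
      simp [hf (this.trans f.map_zero.symm)])
    (fun c hc => ⟨CB ⟨c, hc⟩, by simp [hC], fun h => by
      simp [hC0 ⟨c, hc⟩ (res_eq (z := ⟨c, hc⟩) h)]⟩)
    (fun z hz => by
      obtain ⟨p, q, hq, rfl⟩ := IsFractionRing.div_surjective (A := AK) z
      have hq0 : q ≠ 0 := nonZeroDivisors.ne_zero hq
      have hp0 : p ≠ 0 := by rintro rfl; simp at hz
      obtain ⟨c, hc, b, hb, rfl⟩ := hprim p hp0
      obtain ⟨c', hc', b', hb', rfl⟩ := hprim q hq0
      have hinj := IsFractionRing.injective AK L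
      have hinj' := IsFractionRing.injective Ak κ
      have h1 : algebraMap AK L (CK c') ≠ 0 := fun h => hq0 (by
        rw [hinj (h.trans (map_zero _).symm), zero_mul])
      have h2 : algebraMap AK L (f b') ≠ 0 := fun h => hq0 (by
        rw [hinj (h.trans (map_zero _).symm), mul_zero])
      have h3 : ∀ x, ρ x ≠ 0 → algebraMap Ak κ (ρ x) ≠ 0 := fun x hx h =>
        hx (hinj' (h.trans (map_zero _).symm))
      refine ⟨c / c', div_ne_zero hc hc', b, b', h3 _ hb, h3 _ hb', ?_⟩
      simp only [map_mul, RingHom.comp_apply, map_div₀]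
      have h4 : algebraMap AK L (CK (c / c')) * algebraMap AK L (CK c')
        = algebraMap AK L (CK c) := by rw [← map_mul, ← map_mul, div_mul_cancel₀ _ hc']
      rw [← h4]
      field_simp)

theorem exists_gauss_ratFunc (P : FieldPlace K k) :
    ∃ Q : FieldPlace (RatFunc K) (RatFunc k), ∀ b : P.vs[X],
      Q.R (algebraMap K[X] _ (b.map P.vs.subtype)) (algebraMap k[X] _ (b.map P.res)) :=
  let ⟨Q, hQ, _⟩ := P.exists_gauss (AK := K[X]) (Ak := k[X]) (B := P.vs[X]) C C
    (mapRingHom P.vs.subtype) (mapRingHom P.res) (map_injective _ Subtype.val_injective) (by simp)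
    (fun c h => by simp [h]) (by simpa using P.exists_primitive)
  ⟨Q, hQ⟩

theorem exists_gauss_mv (P : FieldPlace K k) (m : ℕ) :
    ∃ Q : FieldPlace (FractionRing (MvPolynomial (Fin m) K))
      (FractionRing (MvPolynomial (Fin m) k)), (∀ z c, P.R z c →
        Q.R (algebraMap (MvPolynomial (Fin m) K) _ (MvPolynomial.C z))
          (algebraMap (MvPolynomial (Fin m) k) _ (MvPolynomial.C c))) ∧
      Q.SameValueGroup ((algebraMap (MvPolynomial (Fin m) K)
        (FractionRing (MvPolynomial (Fin m) K))).comp MvPolynomial.C) := by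
  obtain ⟨Q, hQ, hS⟩ := P.exists_gauss (AK := MvPolynomial (Fin m) K)
    (L := FractionRing (MvPolynomial (Fin m) K)) (κ := FractionRing (MvPolynomial (Fin m) k))
    (Ak := MvPolynomial (Fin m) k)
    (B := MvPolynomial (Fin m) P.vs) MvPolynomial.C MvPolynomial.C
    (MvPolynomial.map P.vs.subtype) (MvPolynomial.map P.res)
    (MvPolynomial.map_injective _ Subtype.val_injective) (by simp)
    (fun c h => by simp [h]) P.exists_primitive_mv
  refine ⟨Q, fun z c h => ?_, hS⟩
  obtain ⟨hz, rfl⟩ := R_iff.1 h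
  simpa using hQ (MvPolynomial.C ⟨z, hz⟩)

end FieldPlace

namespace FieldPlace

open HahnSeries LaurentSeries

variable {K : Type*} [Field K]

theorem exists_zpow_mul_powerSeries (z : LaurentSeries K) (hz : z ≠ 0) : ∃ (n : ℤ) (p : PowerSeries K),
    PowerSeries.constantCoeff p ≠ 0 ∧
      z = (single 1 1 : LaurentSeries K) ^ n * ofPowerSeries ℤ K p := by
  refine ⟨z.order, z.powerSeriesPart, ?_, ?_⟩
  · rw [← PowerSeries.coeff_zero_eq_constantCoeff_apply, LaurentSeries.powerSeriesPart_coeff]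
    simpa using coeff_order_eq_zero.not.2 hz
  · rw [← RatFunc.single_zpow, LaurentSeries.single_order_mul_powerSeriesPart]

/-- The `X`-adic place of the field of Laurent series. -/
noncomputable def laurent (K : Type*) [Field K] : FieldPlace (LaurentSeries K) K where
  R z c := ∃ p : PowerSeries K, ofPowerSeries ℤ K p = z ∧ PowerSeries.constantCoeff p = c
  uniq := by
    rintro z c d ⟨p, rfl, rfl⟩ ⟨q, h, rfl⟩
    rw [ofPowerSeries_injective h]
  one := ⟨1, by simp, by simp⟩
  add := by
    rintro z w c d ⟨p, rfl, rfl⟩ ⟨q, rfl, rfl⟩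
    exact ⟨p + q, by simp, by simp⟩
  mul := by
    rintro z w c d ⟨p, rfl, rfl⟩ ⟨q, rfl, rfl⟩
    exact ⟨p * q, by simp, by simp⟩
  neg := by
    rintro z c ⟨p, rfl, rfl⟩
    exact ⟨-p, by simp, by simp⟩
  total := by
    intro z
    by_cases hz : z = 0
    · exact Or.inl ⟨0, 0, by simp [hz], by simp⟩
    obtain ⟨n, p, hp, rfl⟩ := exists_zpow_mul_powerSeries z hz
    obtain ⟨n, rfl | rfl⟩ := n.eq_nat_or_neg
    · exact Or.inl ⟨_, PowerSeries.X ^ n * p, by simp, rfl⟩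
    · rcases Nat.eq_zero_or_pos n with rfl | hn
      · exact Or.inl ⟨_, p, by simp, rfl⟩
      refine Or.inr ⟨PowerSeries.X ^ n * p⁻¹, ?_, by simp [hn.ne']⟩
      have h1 : ofPowerSeries ℤ K p * ofPowerSeries ℤ K p⁻¹ = 1 := by
        rw [← map_mul, PowerSeries.mul_inv_cancel _ hp, map_one]
      rw [mul_inv, ← zpow_neg, neg_neg, map_mul, map_pow, ofPowerSeries_X, zpow_natCast,
        eq_inv_of_mul_eq_one_right h1]

theorem laurent_R (p : PowerSeries K) :
    (laurent K).R (ofPowerSeries ℤ K p) (PowerSeries.constantCoeff p) := ⟨p, rfl, rfl⟩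

theorem laurent_C (c : K) : (laurent K).R (HahnSeries.C c) c :=
  ⟨PowerSeries.C c, by simp, by simp⟩

theorem laurent_single : (laurent K).R (single 1 1) 0 := ⟨PowerSeries.X, by simp, by simp⟩

theorem laurent_normal_form (z : LaurentSeries K) (hz : z ≠ 0) : ∃ (n : ℤ) (u : LaurentSeries K)
    (d : K), d ≠ 0 ∧ (laurent K).R u d ∧ z = single 1 1 ^ n * u := by
  obtain ⟨n, p, hp, h⟩ := exists_zpow_mul_powerSeries z hz
  exact ⟨n, _, _, hp, laurent_R p, h⟩

/-- One-units are squares. -/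
def HasSqrt {L κ : Type*} [Field L] [Field κ] (P : FieldPlace L κ) : Prop :=
  ∀ z, P.R z 1 → ∃ w, z = w ^ 2

theorem laurent_hasSqrt (h2 : (2 : K) ≠ 0) : (laurent K).HasSqrt := by
  rintro z ⟨p, rfl, hp⟩
  have hens : HenselianRing (PowerSeries K) (.span {PowerSeries.X}) := inferInstance
  obtain ⟨s, hs, -⟩ := hens.is_henselian (Polynomial.X ^ 2 - Polynomial.C p)
    (Polynomial.monic_X_pow_sub_C p two_ne_zero) 1 (by
      rw [Ideal.mem_span_singleton, PowerSeries.X_dvd_iff]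
      simp [hp]) (by
      have : IsUnit (2 : PowerSeries K) := by
        rw [PowerSeries.isUnit_iff_constantCoeff, map_ofNat]
        exact h2.isUnit
      simpa [one_add_one_eq_two] using this.map (Ideal.Quotient.mk (.span {PowerSeries.X})))
  refine ⟨ofPowerSeries ℤ K s, ?_⟩
  rw [← map_pow]
  congr 1
  simpa [Polynomial.IsRoot, sub_eq_zero, eq_comm] using hs

section uniformizer

variable {L κ : Type*} [Field L] [Field κ] {P : FieldPlace L κ} {w u u' : L} {d d' : κ}

theorem zpow_eq_of_mul_eq (hw : P.R w 0) (hw0 : w ≠ 0) (hu : P.R u d) (hd : d ≠ 0)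
    (hu' : P.R u' d') (hd' : d' ≠ 0) {n m : ℤ} (h : w ^ n * u = w ^ m * u') : n = m := by
  wlog hnm : m < n generalizing n m u u' d d'
  · rcases lt_trichotomy n m with h1 | h1 | h1
    · exact (this hu' hd' hu hd h.symm h1).symm
    · exact h1
    · exact absurd h1 hnm
  exfalso
  have h1 : w ^ (n - m).toNat * u = u' := by
    rw [← zpow_natCast, Int.toNat_of_nonneg (by omega), zpow_sub₀ hw0, div_mul_eq_mul_div, h]
    field_simp
  have h2 := P.mul (pow hw (n - m).toNat) hu
  rw [h1, zero_pow (by omega), zero_mul] at h2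
  exact hd' (P.uniq hu' h2)

variable (P) in
/-- Elements of even value. -/
def EvenUnit (a : L) : Prop := ∃ s u : L, ∃ d : κ, s ≠ 0 ∧ d ≠ 0 ∧ P.R u d ∧ a = s ^ 2 * u

theorem EvenUnit.ne_zero {a : L} (h : P.EvenUnit a) : a ≠ 0 := by
  obtain ⟨s, u, d, hs, hd, hu, rfl⟩ := h
  exact mul_ne_zero (pow_ne_zero 2 hs) (FieldPlace.ne_zero hu hd)

theorem EvenUnit.of_unit (hu : P.R u d) (hd : d ≠ 0) : P.EvenUnit u :=
  ⟨1, u, d, one_ne_zero, hd, hu, by simp⟩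

theorem EvenUnit.mul {a b : L} (ha : P.EvenUnit a) (hb : P.EvenUnit b) : P.EvenUnit (a * b) := by
  obtain ⟨s, u, d, hs, hd, hu, rfl⟩ := ha
  obtain ⟨s', u', d', hs', hd', hu', rfl⟩ := hb
  exact ⟨s * s', u * u', d * d', mul_ne_zero hs hs', mul_ne_zero hd hd', P.mul hu hu', by ring⟩

theorem EvenUnit.inv {a : L} (ha : P.EvenUnit a) : P.EvenUnit a⁻¹ := by
  obtain ⟨s, u, d, hs, hd, hu, rfl⟩ := ha
  exact ⟨s⁻¹, u⁻¹, d⁻¹, inv_ne_zero hs, inv_ne_zero hd, FieldPlace.inv hu hd,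
    by rw [mul_inv, inv_pow]⟩

theorem EvenUnit.of_sq {a : L} (ha : a ≠ 0) : P.EvenUnit (a ^ 2) :=
  ⟨a, 1, 1, ha, one_ne_zero, P.one, by simp⟩

theorem EvenUnit.mul_iff {a b : L} (ha : P.EvenUnit a) : P.EvenUnit (a * b) ↔ P.EvenUnit b := by
  refine ⟨fun h => ?_, ha.mul⟩
  have := ha.inv.mul h
  rwa [← mul_assoc, inv_mul_cancel₀ ha.ne_zero, one_mul] at this

/-- The squares of a field with square roots of one-units are detected on residues. -/
theorem exists_sq_of_residue_sq (hP : P.HasSqrt) (hu : P.R u d) (hd : d ≠ 0) {v : L} {c : κ}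
    (hv : P.R v c) (h : d = c ^ 2) : ∃ s : L, s ≠ 0 ∧ u = s ^ 2 := by
  have hc : c ≠ 0 := by rintro rfl; simp [h] at hd
  have hv0 := FieldPlace.ne_zero hv hc
  have := FieldPlace.div hu (pow hv 2) (pow_ne_zero 2 hc)
  rw [h, div_self (pow_ne_zero 2 hc)] at this
  obtain ⟨s, hs⟩ := hP _ this
  have h1 : u = (s * v) ^ 2 := by
    rw [mul_pow, ← hs, div_mul_cancel₀ _ (pow_ne_zero 2 hv0)]
  refine ⟨s * v, ?_, h1⟩
  rintro h2
  exact FieldPlace.ne_zero hu hd (by rw [h1, h2]; simp)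

/-- A norm from the unramified extension given by a nonsquare `b` has even value. -/
theorem EvenUnit.of_spl (hP : P.HasSqrt) {a b : L} (hb : P.EvenUnit b) (ha : a ≠ 0)
    (h : Spl b a) (hlift : ∀ c : κ, ∃ v, P.R v c) : (∃ s, s ≠ 0 ∧ b = s ^ 2) ∨ P.EvenUnit a := by
  obtain ⟨t, u, d, ht, hd, hu, rfl⟩ := hb
  rw [mul_comm, Spl.sq_mul_left_iff ht] at h
  obtain ⟨r, s, rfl⟩ := h
  by_cases hsq : ∃ c, d = c ^ 2
  · obtain ⟨c, hc⟩ := hsq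
    obtain ⟨v, hv⟩ := hlift c
    obtain ⟨s', hs', rfl⟩ := exists_sq_of_residue_sq hP hu hd hv hc
    exact Or.inl ⟨t * s', mul_ne_zero ht hs', by ring⟩
  right
  by_cases hs : s = 0
  · subst hs
    have hr : r ≠ 0 := by rintro rfl; simp at ha
    simpa using EvenUnit.of_sq hr
  rcases P.total (r / s) with ⟨c, hc⟩ | hinf
  · refine ⟨s, (r / s) ^ 2 - u, c ^ 2 - d, hs, fun h0 => hsq ⟨c, ?_⟩, sub (pow hc 2) hu, ?_⟩
    · linear_combination -h0
    · field_simp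
  · by_cases hr : r = 0
    · subst hr
      refine ⟨s, -u, -d, hs, neg_ne_zero.2 hd, P.neg hu, by ring⟩
    · rw [inv_div] at hinf
      refine ⟨r, 1 - u * (s / r) ^ 2, 1, hr, one_ne_zero, ?_, ?_⟩
      · simpa using sub P.one (P.mul hu (pow hinf 2))
      · field_simp

/-- A uniformizer times a unit has odd value. -/
theorem not_evenUnit_of_uniformizer (hw : P.R w 0) (hw0 : w ≠ 0)
    (hnf : ∀ z : L, z ≠ 0 → ∃ (n : ℤ) (u : L) (d : κ), d ≠ 0 ∧ P.R u d ∧ z = w ^ n * u)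
    (hu : P.R u d) (hd : d ≠ 0) : ¬ P.EvenUnit (w * u) := by
  rintro ⟨s, v, e, hs, he, hv, h⟩
  obtain ⟨n, u', d', hd', hu', rfl⟩ := hnf s hs
  have : w ^ (1 : ℤ) * u = w ^ (2 * n) * (u' ^ 2 * v) := by
    rw [zpow_one, h, two_mul, zpow_add₀ hw0]; ring
  have := zpow_eq_of_mul_eq hw hw0 hu hd (P.mul (pow hu' 2) hv)
    (mul_ne_zero (pow_ne_zero 2 hd') he) this
  omega

/-- If a unit is a norm from a tamely ramified quadratic extension, its residue is a square. -/
theorem residue_sq_of_spl (hw : P.R w 0) (hw0 : w ≠ 0)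
    (hnf : ∀ z : L, z ≠ 0 → ∃ (n : ℤ) (u : L) (d : κ), d ≠ 0 ∧ P.R u d ∧ z = w ^ n * u)
    (hu : P.R u d) (hd : d ≠ 0) {b : L} {c : κ} (hb : P.R b c)
    (h : Spl (w * u) b) : ∃ e, c = e ^ 2 := by
  obtain ⟨r, s, h⟩ := h
  have fin_of_sq : ∀ z f, P.R (z ^ 2) f → ∃ e, f = e ^ 2 := by
    intro z f hf
    rcases P.total z with ⟨e, he⟩ | hinf
    · exact ⟨e, P.uniq hf (pow he 2)⟩
    · have h1 := P.mul hf (pow hinf 2)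
      by_cases hz : z = 0
      · subst hz
        exact ⟨0, P.uniq hf (by simpa using P.zero)⟩
      · rw [← mul_pow, mul_inv_cancel₀ hz, one_pow] at h1
        exact absurd (P.uniq P.one h1) (by simp)
  have hfin : (∃ f, P.R s f) → ∃ e, c = e ^ 2 := by
    rintro ⟨f, hf⟩
    have h1 := P.add hb (P.mul (P.mul hw hu) (pow hf 2))
    rw [h, show r ^ 2 - w * u * s ^ 2 + w * u * s ^ 2 = r ^ 2 by ring] at h1
    obtain ⟨e, he⟩ := fin_of_sq _ _ h1
    exact ⟨e, by rw [← he]; ring⟩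
  by_cases hs : s = 0
  · exact hfin ⟨0, hs ▸ P.zero⟩
  obtain ⟨n, v, f, hf, hv, rfl⟩ := hnf s hs
  by_cases hn : 0 ≤ n
  · obtain ⟨n, rfl⟩ := Int.eq_ofNat_of_zero_le hn
    exact hfin ⟨_, by rw [zpow_natCast]; exact P.mul (pow hw n) hv⟩
  · exfalso
    obtain ⟨m, rfl⟩ : ∃ m : ℕ, n = -(m + 1 : ℤ) := ⟨(-n - 1).toNat, by omega⟩
    have hv0 := FieldPlace.ne_zero hv hf
    have h1 := P.add hu (P.mul (P.mul hw (pow hw (2 * m))) (P.mul hb (pow (inv hv hf) 2)))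
    rw [zero_mul, zero_mul, add_zero] at h1
    refine not_evenUnit_of_uniformizer hw hw0 hnf h1 hd ?_
    have h2 : w * (u + w * w ^ (2 * m) * (b * v⁻¹ ^ 2)) = (r / (w ^ (-(m + 1 : ℤ)) * v)) ^ 2 := by
      rw [h, zpow_neg, ← Nat.cast_succ, zpow_natCast, Nat.succ_eq_add_one]
      field_simp
      ring
    rw [h2]
    apply EvenUnit.of_sq
    rintro h3
    rw [h3] at h2
    exact FieldPlace.ne_zero h1 hd (by simpa [hw0] using h2)

end uniformizer

end FieldPlace

section

open Polynomial HahnSeries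

namespace FieldPlace

/-- Splitting of a symbol of constants descends along a place with a section. -/
theorem spl_of_place {L κ : Type*} [Field L] [Field κ] (P : FieldPlace L κ) (h2 : (2 : κ) ≠ 0)
    {a b : L} {a' b' : κ} (ha : P.R a a') (hb : P.R b b') (ha' : a' ≠ 0)
    (h : Spl a b) : Spl a' b' := by
  obtain ⟨r, s, h⟩ := h
  obtain ⟨i, -, hi, hfin⟩ := P.exists_content Finset.univ ![r, s, 1] ⟨2, by simp, by simp⟩
  have h0 := hfin 0 (Finset.mem_univ _)
  have h1 := hfin 1 (Finset.mem_univ _)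
  have h3 := hfin 2 (Finset.mem_univ _)
  set q := ![r, s, 1] i
  obtain ⟨r', hr⟩ := h0
  obtain ⟨s', hs⟩ := h1
  obtain ⟨t', ht⟩ := h3
  simp only [Matrix.cons_val] at hr hs ht
  have e1 := sub (pow hr 2) (P.mul ha (pow hs 2))
  have e2 := P.mul hb (pow ht 2)
  have e3 : (r / q) ^ 2 - a * (s / q) ^ 2 = b * (1 / q) ^ 2 := by
    rw [h]; field_simp
  rw [e3] at e1
  refine Spl.of_isotropic h2 ha' (P.uniq e1 e2) ?_
  by_contra! hcon
  obtain ⟨rfl, rfl, rfl⟩ := hcon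
  have : ∃ k, ![r, s, 1] k / q = 1 := ⟨i, div_self hi⟩
  obtain ⟨k, hk⟩ := this
  fin_cases k
  · exact one_ne_zero (P.uniq P.one (hk ▸ hr))
  · exact one_ne_zero (P.uniq P.one (hk ▸ hs))
  · exact one_ne_zero (P.uniq P.one (hk ▸ ht))

variable {κ κ' : Type*} [Field κ] [Field κ']

/-- Expansion of polynomials at the point `θ`. -/
noncomputable def expand (τ : κ →+* κ') (θ : κ') : κ[X] →+* LaurentSeries κ' :=
  eval₂RingHom (HahnSeries.C.comp τ) (HahnSeries.C θ + single 1 1)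

theorem eval₂_R {L : Type*} [Field L] (P : FieldPlace L κ') (j : κ →+* L) (τ : κ →+* κ')
    (hj : ∀ c, P.R (j c) (τ c)) {z : L} {θ : κ'} (hz : P.R z θ) (f : κ[X]) :
    P.R (f.eval₂ j z) (f.eval₂ τ θ) := by
  induction f using Polynomial.induction_on' with
  | add p q hp hq => simpa using P.add hp hq
  | monomial n a => simpa [eval₂_monomial] using P.mul (hj a) (pow hz n)

theorem expand_R (τ : κ →+* κ') (θ : κ') (f : κ[X]) :
    (laurent κ').R (expand τ θ f) (f.eval₂ τ θ) := by
  refine eval₂_R _ _ τ (fun c => laurent_C _) ?_ f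
  simpa using (laurent κ').add (laurent_C θ) laurent_single

theorem single_ne_zero' : (single 1 1 : LaurentSeries κ') ≠ 0 := by simp

theorem expand_id_X_sub_C (θ : κ') :
    expand (RingHom.id κ') θ (Polynomial.X - Polynomial.C θ) = single 1 1 := by
  simp [expand, eval₂_C]

theorem expand_eq_map (τ : κ →+* κ') (θ : κ') (f : κ[X]) :
    expand τ θ f = expand (RingHom.id κ') θ (f.map τ) := by
  simp [expand, eval₂_map]

theorem expand_ne_zero (τ : κ →+* κ') (θ : κ') {f : κ[X]} (hf : f ≠ 0) : expand τ θ f ≠ 0 := by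
  have hf' : f.map τ ≠ 0 := (Polynomial.map_ne_zero_iff τ.injective).2 hf
  obtain ⟨q, hq, hnd⟩ := exists_eq_pow_rootMultiplicity_mul_and_not_dvd (f.map τ) hf' θ
  rw [expand_eq_map, hq, map_mul, map_pow, expand_id_X_sub_C]
  refine mul_ne_zero (pow_ne_zero _ single_ne_zero') (FieldPlace.ne_zero (expand_R _ _ _) ?_)
  rwa [dvd_iff_isRoot] at hnd

theorem expand_simple_root (τ : κ →+* κ') (θ : κ') {f : κ[X]} (h : f.eval₂ τ θ = 0) :
    ∃ u, expand τ θ f = single 1 1 * u ∧ (laurent κ').R u (f.derivative.eval₂ τ θ) := by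
  rw [← eval_map] at h
  obtain ⟨q, hq⟩ : (Polynomial.X - Polynomial.C θ) ∣ f.map τ := dvd_iff_isRoot.2 h
  refine ⟨expand (RingHom.id κ') θ q, ?_, ?_⟩
  · rw [expand_eq_map, hq, map_mul, expand_id_X_sub_C]
  · have := expand_R (RingHom.id κ') θ q
    convert this using 1
    rw [← eval_map, ← derivative_map, hq]
    simp [derivative_mul]

theorem two_ne_zero_laurent (h2 : (2 : κ') ≠ 0) : (2 : LaurentSeries κ') ≠ 0 := fun h =>
  h2 ((HahnSeries.C : κ' →+* LaurentSeries κ').injective (by rw [map_ofNat, map_zero, h]))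

/-- The local condition at a closed point of the affine line. -/
def LocCond (τ : κ →+* κ') (θ : κ') (a b : κ[X]) : Prop :=
  Spl (expand τ θ a) (expand τ θ b) ∨
    (laurent κ').EvenUnit (expand τ θ a) ∧ (laurent κ').EvenUnit (expand τ θ b)

theorem LocCond.symm {τ : κ →+* κ'} {θ : κ'} {a b : κ[X]} (h2 : (2 : κ') ≠ 0) (hb : b ≠ 0)
    (h : LocCond τ θ a b) : LocCond τ θ b a :=
  h.imp (fun h => h.symm (two_ne_zero_laurent h2) (expand_ne_zero τ θ hb)) (fun h => ⟨h.2, h.1⟩)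

theorem spl_descent {E : Type*} [Field E] (h2 : (2 : E) ≠ 0) {a a' b c : E} (ha : a ≠ 0)
    (ha' : a' ≠ 0) (hb : b ≠ 0) (hc : a * a' = c ^ 2 - b) (h : Spl a b) : Spl a' b := by
  have h1 : Spl b (a * a') := ⟨c, 1, by rw [hc]; ring⟩
  exact (Spl.of_mul_left ha (h.symm h2 hb) h1).symm h2 ha'

theorem LocCond.descent {τ : κ →+* κ'} {θ : κ'} {a a' b c : κ[X]} (h2 : (2 : κ') ≠ 0)
    (ha : a ≠ 0) (ha' : a' ≠ 0) (hb : b ≠ 0) (hc : a * a' = c ^ 2 - b) (h : LocCond τ θ a b) :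
    LocCond τ θ a' b := by
  have hc' : expand τ θ a * expand τ θ a' = expand τ θ c ^ 2 - expand τ θ b := by
    rw [← map_mul, hc]; simp
  rcases h with h | ⟨h, h'⟩
  · exact Or.inl (spl_descent (two_ne_zero_laurent h2) (expand_ne_zero τ θ ha)
      (expand_ne_zero τ θ ha') (expand_ne_zero τ θ hb) hc' h)
  · rcases EvenUnit.of_spl (laurent_hasSqrt h2) (a := expand τ θ a * expand τ θ a') h'
      (mul_ne_zero (expand_ne_zero τ θ ha) (expand_ne_zero τ θ ha'))
      ⟨expand τ θ c, 1, by rw [hc']; ring⟩ (fun c => ⟨_, laurent_C c⟩) with ⟨s, -, hs⟩ | h1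
    · exact Or.inl (hs ▸ Spl.of_sq _ _)
    · exact Or.inr ⟨h.mul_iff.1 h1, h'⟩

theorem LocCond.of_sq_mul {τ : κ →+* κ'} {θ : κ'} {a b g : κ[X]} (hg : g ≠ 0)
    (h : LocCond τ θ (g * g * a) b) : LocCond τ θ a b := by
  have hg' := expand_ne_zero τ θ hg
  have h1 : expand τ θ (g * g * a) = expand τ θ a * expand τ θ g ^ 2 := by
    rw [map_mul, map_mul]; ring
  rw [LocCond, h1] at h
  refine h.imp (Spl.sq_mul_left_iff hg').1 fun h => ⟨?_, h.2⟩
  rw [mul_comm] at h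
  exact (EvenUnit.of_sq hg').mul_iff.1 h.1

theorem exists_sq_mod_irreducible {κ : Type*} [Field κ] [CharZero κ] {a b p : κ[X]}
    (hsq : Squarefree a) (hp : Irreducible p) (hpa : p ∣ a)
    (h : ∀ [Fact (Irreducible p)], LocCond (AdjoinRoot.of p) (AdjoinRoot.root p) a b) :
    ∃ c, p ∣ c ^ 2 - b := by
  have : Fact (Irreducible p) := ⟨hp⟩
  have ha0 : a.eval₂ (AdjoinRoot.of p) (AdjoinRoot.root p) = 0 := by
    obtain ⟨q, rfl⟩ := hpa
    simp [eval₂_mul]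
  have hda : a.derivative.eval₂ (AdjoinRoot.of p) (AdjoinRoot.root p) ≠ 0 := by
    obtain ⟨u, v, huv⟩ := PerfectField.separable_iff_squarefree.2 hsq
    intro h0
    have := congrArg (eval₂ (AdjoinRoot.of p) (AdjoinRoot.root p)) huv
    simp [eval₂_mul, eval₂_add, ha0, h0] at this
  obtain ⟨u, hu, hR⟩ := expand_simple_root _ _ ha0
  rcases h with h | h
  · rw [hu] at h
    obtain ⟨e, he⟩ := residue_sq_of_spl laurent_single single_ne_zero' laurent_normal_form hR hda
      (expand_R _ _ b) h
    obtain ⟨c, rfl⟩ := AdjoinRoot.mk_surjective e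
    refine ⟨c, ?_⟩
    rw [← AdjoinRoot.mk_eq_zero, map_sub, map_pow, ← he, ← AdjoinRoot.aeval_eq, aeval_def,
      AdjoinRoot.algebraMap_eq, sub_self]
  · rw [hu] at h
    exact absurd h.1 (not_evenUnit_of_uniformizer laurent_single single_ne_zero'
      laurent_normal_form hR hda)

theorem exists_sq_mod {κ : Type*} [Field κ] {b : κ[X]} (f : κ[X]) (hf : Squarefree f)
    (h : ∀ p, Irreducible p → p ∣ f → ∃ c, p ∣ c ^ 2 - b) : ∃ c, f ∣ c ^ 2 - b := by
  induction f using UniqueFactorizationMonoid.induction_on_prime with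
  | h₁ => exact absurd hf not_squarefree_zero
  | h₂ x hx => exact ⟨0, hx.dvd⟩
  | h₃ f p hf0 hp ih =>
    obtain ⟨c1, h1⟩ := ih (hf.of_mul_right) fun q hq hqf => h q hq (hqf.mul_left p)
    obtain ⟨c2, h2⟩ := h p hp.irreducible (dvd_mul_right p f)
    have hcop : IsCoprime p f := by
      refine (hp.irreducible.coprime_iff_not_dvd).2 fun hd => ?_
      obtain ⟨g, rfl⟩ := hd
      exact hp.not_isUnit (hf p ⟨g, by ring⟩)
    obtain ⟨u, v, huv⟩ := hcop
    refine ⟨c1 * u * p + c2 * v * f, IsCoprime.mul_dvd ⟨u, v, huv⟩ ?_ ?_⟩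
    · have : (c1 * u * p + c2 * v * f) ^ 2 - b
          = (c2 ^ 2 - b) + p * ((c1 - c2) * u * (c1 * u * p + c2 * v * f + c2)) := by
        rw [show c1 * u * p + c2 * v * f = c2 + (c1 - c2) * u * p by linear_combination c2 * huv]
        ring
      rw [this]
      exact dvd_add h2 (dvd_mul_right _ _)
    · have : (c1 * u * p + c2 * v * f) ^ 2 - b
          = (c1 ^ 2 - b) + f * ((c2 - c1) * v * (c1 * u * p + c2 * v * f + c1)) := by
        rw [show c1 * u * p + c2 * v * f = c1 + (c2 - c1) * v * f by linear_combination c1 * huv]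
        ring
      rw [this]
      exact dvd_add h1 (dvd_mul_right _ _)

/-- A local-global principle for split symbols on the affine line. -/
theorem spl_ratFunc_of_local {κ : Type u} [Field κ] [CharZero κ] : ∀ (n : ℕ) (a b : κ[X]),
    a.natDegree + b.natDegree ≤ n → a ≠ 0 → b ≠ 0 →
    (∀ (κ' : Type u) [Field κ'] (τ : κ →+* κ') (θ : κ'), LocCond τ θ a b) →
    Spl (expand (RingHom.id κ) 0 a) (expand (RingHom.id κ) 0 b) →
    Spl (algebraMap κ[X] (RatFunc κ) a) (algebraMap κ[X] (RatFunc κ) b) := by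
  have h2κ : (2 : κ) ≠ 0 := two_ne_zero
  have h2R : (2 : RatFunc κ) ≠ 0 := by
    simp
  have hinj : ∀ f : κ[X], f ≠ 0 → algebraMap κ[X] (RatFunc κ) f ≠ 0 := fun f hf =>
    RatFunc.algebraMap_ne_zero hf
  have h2' : ∀ (κ' : Type u) [Field κ'], (κ →+* κ') → (2 : κ') ≠ 0 := fun κ' _ τ h =>
    h2κ (τ.injective (by rw [map_ofNat, map_zero, h]))
  intro n
  induction n using Nat.strong_induction_on with
  | _ n ih =>
  intro a b hn ha hb hloc h0
  wlog hab : b.natDegree ≤ a.natDegree generalizing a b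
  · exact (this b a (by omega) hb ha (fun κ' _ τ θ => (hloc κ' τ θ).symm (h2' κ' τ) hb)
      (h0.symm (two_ne_zero_laurent h2κ) (expand_ne_zero _ _ hb)) (by omega)).symm h2R (hinj _ ha)
  by_cases hdeg : a.natDegree = 0
  · obtain ⟨x, rfl⟩ := natDegree_eq_zero.1 hdeg
    obtain ⟨y, rfl⟩ := natDegree_eq_zero.1 (show b.natDegree = 0 by omega)
    have h1 := spl_of_place (laurent κ) h2κ (expand_R _ _ _) (expand_R _ _ _)
      (by simpa using ha) h0
    simp only [eval₂_C, RingHom.id_apply] at h1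
    simpa using h1.map (algebraMap κ (RatFunc κ))
  by_cases hsq : Squarefree a
  · obtain ⟨c', hc'⟩ := exists_sq_mod a hsq fun p hp hpa =>
      exists_sq_mod_irreducible hsq hp hpa (hloc _ _ _)
    obtain ⟨c, hc, hcd⟩ : ∃ c, a ∣ c ^ 2 - b ∧ c.natDegree < a.natDegree := by
      refine ⟨c' % a, ?_, natDegree_mod_lt _ hdeg⟩
      have : (c' % a) ^ 2 - b = (c' ^ 2 - b) - a * ((c' / a) * (c' + c' % a)) := by
        have := EuclideanDomain.div_add_mod c' a
        linear_combination (c' + c' % a) * this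
      rw [this]
      exact dvd_sub hc' (dvd_mul_right _ _)
    obtain ⟨a', ha'⟩ := hc
    by_cases ha'0 : a' = 0
    · rw [ha'0, mul_zero, sub_eq_zero] at ha'
      rw [← ha', map_pow]
      exact Spl.of_sq _ _
    have hlt : a'.natDegree < a.natDegree := by
      have h1 : (c ^ 2 - b).natDegree ≤ max (c ^ 2).natDegree b.natDegree := natDegree_sub_le _ _
      rw [ha', natDegree_mul ha ha'0, natDegree_pow] at h1
      rcases le_max_iff.1 h1 with h | h <;> omega
    have h1 := ih (a'.natDegree + b.natDegree) (by omega) a' b le_rfl ha'0 hb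
      (fun κ' _ τ θ => (hloc κ' τ θ).descent (h2' κ' τ) ha ha'0 hb ha'.symm)
      (spl_descent (c := expand (RingHom.id κ) 0 c) (two_ne_zero_laurent h2κ) (expand_ne_zero _ _ ha) (expand_ne_zero _ _ ha'0)
        (expand_ne_zero _ _ hb) (by rw [← map_mul, ← ha']; simp) h0)
    exact spl_descent (c := algebraMap κ[X] (RatFunc κ) c) h2R (hinj _ ha'0) (hinj _ ha) (hinj _ hb)
      (by rw [← map_mul, mul_comm, ← ha']; simp) h1
  · obtain ⟨g, ⟨a', rfl⟩, hg⟩ : ∃ g, g * g ∣ a ∧ ¬ IsUnit g := by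
      simpa [Squarefree] using hsq
    have hg0 : g ≠ 0 := by rintro rfl; simp at ha
    have ha'0 : a' ≠ 0 := by rintro rfl; simp at ha
    have hgd : 0 < g.natDegree := by
      by_contra h
      obtain ⟨x, rfl⟩ := natDegree_eq_zero.1 (show g.natDegree = 0 by omega)
      exact hg (by simpa using hg0)
    rw [natDegree_mul (mul_ne_zero hg0 hg0) ha'0, natDegree_mul hg0 hg0] at hn
    rw [show g * g * a' = a' * g ^ 2 by ring, map_mul, map_pow, Spl.sq_mul_left_iff
      (expand_ne_zero _ _ hg0)] at h0
    have := ih (a'.natDegree + b.natDegree) (by omega) a' b le_rfl ha'0 hb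
      (fun κ' _ τ θ => (hloc κ' τ θ).of_sq_mul hg0) h0
    rwa [show g * g * a' = a' * g ^ 2 by ring, map_mul, map_pow, Spl.sq_mul_left_iff (hinj _ hg0)]

end FieldPlace

end

section

open Polynomial

namespace FieldPlace

/-- The discriminant form of the pencil of norm forms. -/
def disc {E : Type*} [Field E] (x y : E) : E := x - (1 - x) * y ^ 2

/-- The quadratic form `⟨1, -x, -P, gP⟩` is isotropic, or `x = 1`. -/
def Iso {E : Type*} [Field E] (x y : E) : Prop :=
  x = 1 ∨ ∃ r s a b : E, r ^ 2 - x * s ^ 2 = disc x y * (a ^ 2 - (1 - x) * b ^ 2) ∧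
    (r ≠ 0 ∨ s ≠ 0 ∨ a ≠ 0 ∨ b ≠ 0)

theorem disc_map {E E' : Type*} [Field E] [Field E'] (f : E →+* E') (x y : E) :
    f (disc x y) = disc (f x) (f y) := by simp [disc]

theorem Iso.map {E E' : Type*} [Field E] [Field E'] (f : E →+* E') {x y : E} (h : Iso x y) :
    Iso (f x) (f y) := by
  rcases h with rfl | ⟨r, s, a, b, h, hne⟩
  · exact Or.inl (map_one f)
  · refine Or.inr ⟨f r, f s, f a, f b, ?_, ?_⟩
    · simpa [disc] using congrArg f h
    · simpa using hne

theorem spl_of_isSquare_of_eq {E : Type*} [Field E] (h2 : (2 : E) ≠ 0) {x b w : E} (hx : x ≠ 0)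
    (h : x = w ^ 2) : Spl x b := by
  subst h
  exact Spl.of_isSquare h2 (by rintro rfl; simp at hx)

theorem Iso.spl_of_sq {E : Type*} [Field E] (h2 : (2 : E) ≠ 0) {x y w : E} (hx : x ≠ 0)
    (h : Iso x y) (hw : x * (1 - x) = w ^ 2) : Spl x (disc x y) := by
  rcases h with rfl | ⟨r, s, a, b, h, hne⟩
  · exact spl_of_isSquare_of_eq h2 hx (one_pow 2).symm
  have key : ∀ r s : E, r ^ 2 - x * s ^ 2 = 0 → (r ≠ 0 ∨ s ≠ 0) → Spl x (disc x y) := by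
    intro r s h hne
    have hs : s ≠ 0 := by
      rintro rfl
      simp at h
      simp [h] at hne
    exact spl_of_isSquare_of_eq h2 hx (w := r / s) (by field_simp; linear_combination -h)
  have hg : 1 - x = x * (w / x) ^ 2 := by field_simp; exact hw
  have h' : a ^ 2 - (1 - x) * b ^ 2 = a ^ 2 - x * (w / x * b) ^ 2 := by
    rw [hg]; ring
  by_cases h0 : a ^ 2 - (1 - x) * b ^ 2 = 0
  · by_cases hrs : r ≠ 0 ∨ s ≠ 0
    · exact key r s (by rw [h, h0, mul_zero]) hrs
    · rw [not_or, not_not, not_not] at hrs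
      by_cases hb : b = 0
      · have ha : a = 0 := by simpa [hb] using h0
        simp [hrs, ha, hb] at hne
      · by_cases hw0 : w = 0
        · have : 1 - x = 0 := by rw [hg, hw0]; simp
          exact spl_of_isSquare_of_eq h2 hx (w := 1) (by linear_combination -this)
        · exact key a (w / x * b) (by rw [← h', h0]) (Or.inr (by simp [hw0, hx, hb]))
  · exact Spl.of_mul_left h0 ⟨a, _, h'⟩ ⟨r, s, by rw [h]; ring⟩

theorem iso_local {E κ : Type*} [Field E] [Field κ] (P : FieldPlace E κ) (hs : P.HasSqrt)
    (h2 : (2 : E) ≠ 0) {i x y : E} (hi : i ^ 2 = -1) (hx : x ≠ 0) (hd : disc x y ≠ 0)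
    (hiso : Iso x y) : Spl x (disc x y) ∨ ∃ x' y', P.R x x' ∧ P.R y y' ∧ x' ≠ 0 ∧
      P.R (disc x y) (disc x' y') ∧ disc x' y' ≠ 0 := by
  by_cases hx1 : x = 1
  · exact Or.inl (spl_of_isSquare_of_eq h2 hx (w := 1) (by simp [hx1]))
  have hg : 1 - x ≠ 0 := fun h => hx1 (by linear_combination -h)
  have hsq : ∀ {b : E}, P.R x 1 → Spl x b := fun h => by
    obtain ⟨w, hw⟩ := hs _ h
    exact spl_of_isSquare_of_eq h2 hx hw
  by_cases hy : ∃ y', P.R y y'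
  swap
  · left
    have hyi : P.R y⁻¹ 0 := (P.total y).resolve_left hy
    have hy0 : y ≠ 0 := by
      rintro rfl
      exact hy ⟨0, P.zero⟩
    have hz : P.R (x / ((1 - x) * y ^ 2)) 0 ∨ ∃ c, P.R (x / ((1 - x) * y ^ 2))⁻¹ c := by
      rcases P.total (x / ((1 - x) * y ^ 2)) with ⟨c, h⟩ | h
      · by_cases hc : c = 0
        · exact Or.inl (hc ▸ h)
        · exact Or.inr ⟨_, FieldPlace.inv h hc⟩
      · exact Or.inr ⟨0, h⟩
    rcases hz with hz | ⟨c, hc⟩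
    · obtain ⟨w, hw⟩ := hs (1 - x / ((1 - x) * y ^ 2)) (by simpa using FieldPlace.sub P.one hz)
      have e : disc x y = (1 - x) * (i * y * w) ^ 2 := by
        rw [mul_pow, mul_pow, ← hw, hi, disc]
        field_simp
        ring
      rw [e]
      exact Spl.mul ⟨1, 1, by ring⟩ (Spl.of_sq _ _)
    · have h1 := P.mul hc (pow hyi 2)
      have e : (x / ((1 - x) * y ^ 2))⁻¹ * y⁻¹ ^ 2 = x⁻¹ - 1 := by field_simp
      rw [e] at h1
      have h2' := P.add h1 P.one
      simp only [sub_add_cancel, ne_eq, OfNat.ofNat_ne_zero, not_false_eq_true, zero_pow, mul_zero,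
        zero_add] at h2'
      refine hsq (by simpa using FieldPlace.inv h2' one_ne_zero)
  obtain ⟨y', hy'⟩ := hy
  by_cases hxf : ∃ x', P.R x x'
  swap
  · left
    have hxi : P.R x⁻¹ 0 := (P.total x).resolve_left hxf
    obtain ⟨w, hw⟩ := hs (1 - x⁻¹) (by simpa using FieldPlace.sub P.one hxi)
    refine hiso.spl_of_sq h2 hx (w := i * x * w) ?_
    rw [mul_pow, mul_pow, ← hw, hi]
    field_simp
    ring
  obtain ⟨x', hx'⟩ := hxf
  have hg' := FieldPlace.sub P.one hx'
  by_cases hx0 : x' = 0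
  · left
    subst hx0
    obtain ⟨w, hw⟩ := hs (1 - x) (by simpa using hg')
    have hw0 : w ≠ 0 := by rintro rfl; simp [hw] at hg
    have h1 : Spl (x * w ^ 2) (disc x y * w ^ 2) := by
      refine ⟨i * (1 - x) * y, i, ?_⟩
      rw [← hw, mul_pow, mul_pow, hi, disc]
      ring
    rwa [Spl.sq_mul_left_iff hw0, Spl.mul_sq_iff hw0] at h1
  by_cases hx'1 : x' = 1
  · exact Or.inl (hsq (hx'1 ▸ hx'))
  have hg0 : 1 - x' ≠ 0 := fun h => hx'1 (by linear_combination -h)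
  have hd' : P.R (disc x y) (disc x' y') := FieldPlace.sub hx' (P.mul hg' (pow hy' 2))
  by_cases hd0 : disc x' y' = 0
  · left
    have hy0 : y' ≠ 0 := by
      rintro rfl
      simp [disc] at hd0
      exact hx0 hd0
    have hyne := FieldPlace.ne_zero hy' hy0
    have h1 := FieldPlace.div hd' (P.mul hg' (pow hy' 2)) (mul_ne_zero hg0 (pow_ne_zero 2 hy0))
    rw [hd0, zero_div] at h1
    obtain ⟨w, hw⟩ := hs (1 + disc x y / ((1 - x) * y ^ 2)) (by simpa using P.add P.one h1)
    refine hiso.spl_of_sq h2 hx (w := (1 - x) * y * w) ?_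
    rw [mul_pow, ← hw, disc]
    field_simp
    ring
  exact Or.inr ⟨x', y', hx', hy', hx0, hd', hd0⟩

end FieldPlace

end

section

open Polynomial

namespace FieldPlace

/-- The homogenisation of `x`. -/
def ah {R : Type*} [CommRing R] (V : Fin 3 → R) : R := V 0 * V 1

/-- The homogenisation of the discriminant form. -/
def bh {R : Type*} [CommRing R] (V : Fin 3 → R) : R :=
  V 0 * (V 1 * V 0 ^ 2 - (V 0 - V 1) * V 2 ^ 2)

/-- The symbol at a point of the plane is defined and not split. -/
def NonSplit {E : Type*} [Field E] (V : Fin 3 → E) : Prop :=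
  ah V ≠ 0 ∧ bh V ≠ 0 ∧ ¬ Spl (ah V) (bh V)

theorem map_ah {R S : Type*} [CommRing R] [CommRing S] (f : R →+* S) (V : Fin 3 → R) :
    f (ah V) = ah (fun k => f (V k)) := by simp [ah]

theorem map_bh {R S : Type*} [CommRing R] [CommRing S] (f : R →+* S) (V : Fin 3 → R) :
    f (bh V) = bh (fun k => f (V k)) := by simp [bh]

theorem ah_mul {R : Type*} [CommRing R] (c : R) (V : Fin 3 → R) :
    ah (fun k => c * V k) = ah V * c ^ 2 := by simp only [ah]; ring

theorem bh_mul {R : Type*} [CommRing R] (c : R) (V : Fin 3 → R) :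
    bh (fun k => c * V k) = bh V * (c ^ 2) ^ 2 := by simp only [bh]; ring

theorem ah_eq {E : Type*} [Field E] {V : Fin 3 → E} (h : V 0 ≠ 0) :
    ah V = V 1 / V 0 * V 0 ^ 2 := by simp only [ah]; field_simp

theorem bh_eq {E : Type*} [Field E] {V : Fin 3 → E} (h : V 0 ≠ 0) :
    bh V = disc (V 1 / V 0) (V 2 / V 0) * (V 0 ^ 2) ^ 2 := by
  simp only [bh, disc]; field_simp

theorem spl_mul_iff {E : Type*} [Field E] {c : E} (hc : c ≠ 0) (V : Fin 3 → E) :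
    Spl (ah (fun k => c * V k)) (bh (fun k => c * V k)) ↔ Spl (ah V) (bh V) := by
  rw [ah_mul, bh_mul, Spl.sq_mul_left_iff hc, Spl.mul_sq_iff (pow_ne_zero 2 hc)]

theorem nonSplit_mul_iff {E : Type*} [Field E] {c : E} (hc : c ≠ 0) (V : Fin 3 → E) :
    NonSplit (fun k => c * V k) ↔ NonSplit V := by
  rw [NonSplit, spl_mul_iff hc, ah_mul, bh_mul, NonSplit]
  simp [hc]

theorem spl_iff {E : Type*} [Field E] {V : Fin 3 → E} (h : V 0 ≠ 0) :
    Spl (ah V) (bh V) ↔ Spl (V 1 / V 0) (disc (V 1 / V 0) (V 2 / V 0)) := by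
  rw [ah_eq h, bh_eq h, Spl.sq_mul_left_iff h, Spl.mul_sq_iff (pow_ne_zero 2 h)]

theorem R_ah {L κ : Type*} [Field L] [Field κ] {P : FieldPlace L κ} {V : Fin 3 → L}
    {v : Fin 3 → κ} (h : ∀ k, P.R (V k) (v k)) : P.R (ah V) (ah v) := P.mul (h 0) (h 1)

theorem R_bh {L κ : Type*} [Field L] [Field κ] {P : FieldPlace L κ} {V : Fin 3 → L}
    {v : Fin 3 → κ} (h : ∀ k, P.R (V k) (v k)) : P.R (bh V) (bh v) :=
  P.mul (h 0) (sub (P.mul (h 1) (pow (h 0) 2)) (P.mul (sub (h 0) (h 1)) (pow (h 2) 2)))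

theorem iso_local_homog {E κ : Type*} [Field E] [Field κ] (P : FieldPlace E κ) (hs : P.HasSqrt)
    (h2 : (2 : E) ≠ 0) {i : E} (hi : i ^ 2 = -1) {V : Fin 3 → E} (ha : ah V ≠ 0) (hb : bh V ≠ 0)
    (hiso : Iso (V 1 / V 0) (V 2 / V 0)) : Spl (ah V) (bh V) ∨
      (P.EvenUnit (ah V) ∧ P.EvenUnit (bh V) ∧ ∃ v : Fin 3 → κ, (∀ k, P.R (V k / V 0) (v k)) ∧
        ah v ≠ 0 ∧ bh v ≠ 0) := by
  have h0 : V 0 ≠ 0 := left_ne_zero_of_mul ha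
  have h1 : V 1 ≠ 0 := right_ne_zero_of_mul ha
  have hd : disc (V 1 / V 0) (V 2 / V 0) ≠ 0 := by
    rw [bh_eq h0] at hb
    exact left_ne_zero_of_mul hb
  rcases iso_local P hs h2 hi (div_ne_zero h1 h0) hd hiso with h | ⟨x, y, hx, hy, hx0, hd', hd0⟩
  · exact Or.inl ((spl_iff h0).2 h)
  · refine Or.inr ⟨?_, ?_, ![1, x, y], ?_, ?_, ?_⟩
    · rw [ah_eq h0]
      exact (EvenUnit.of_unit hx hx0).mul (EvenUnit.of_sq h0)
    · rw [bh_eq h0]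
      exact (EvenUnit.of_unit hd' hd0).mul (EvenUnit.of_sq (pow_ne_zero 2 h0))
    · intro k
      fin_cases k
      · simpa [h0] using P.one
      · exact hx
      · exact hy
    · simpa [ah] using hx0
    · simpa [bh, disc] using hd0

section Infinity

variable {κ : Type*} [Field κ]

/-- Expansion of polynomials at infinity. -/
noncomputable def expandInf : κ[X] →+* LaurentSeries κ :=
  eval₂RingHom HahnSeries.C (HahnSeries.single 1 1)⁻¹

theorem expandInf_R {f : κ[X]} {N : ℕ} (hN : f.natDegree ≤ N) :
    (laurent κ).R (HahnSeries.single 1 1 ^ N * expandInf f) (f.coeff N) := by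
  have hw := single_ne_zero' (κ' := κ)
  have h1 := eval₂_R (laurent κ) HahnSeries.C (RingHom.id κ) laurent_C laurent_single (reflect N f)
  have h2 : (reflect N f).eval₂ (RingHom.id κ) 0 = f.coeff N := by
    rw [eval₂_id, ← coeff_zero_eq_eval_zero, coeff_reflect]
    simp
  rw [h2] at h1
  convert h1 using 1
  let _ : Invertible ((HahnSeries.single 1 1 : LaurentSeries κ)⁻¹) :=
    ⟨HahnSeries.single 1 1, mul_inv_cancel₀ hw, inv_mul_cancel₀ hw⟩
  have := eval₂_reflect_mul_pow (HahnSeries.C : κ →+* LaurentSeries κ)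
    (HahnSeries.single 1 1)⁻¹ N f hN
  rw [expandInf, coe_eval₂RingHom, ← this, mul_comm, mul_assoc, ← mul_pow, inv_mul_cancel₀ hw,
    one_pow, mul_one]
  rfl

theorem expandInf_injective : Function.Injective (expandInf (κ := κ)) := by
  rw [injective_iff_map_eq_zero]
  intro f hf
  by_contra h0
  have := FieldPlace.ne_zero (expandInf_R (le_refl f.natDegree)) (by simpa using h0)
  simp [hf] at this

end Infinity

theorem spl_of_spl_residue {κ : Type*} [Field κ] {W : Fin 3 → LaurentSeries κ} (h0 : W 0 ≠ 0)
    {v : Fin 3 → κ} (hv : ∀ k, (laurent κ).R (W k / W 0) (v k)) (h2 : (2 : κ) ≠ 0)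
    (ha : ah v ≠ 0) (hb : bh v ≠ 0) (hs : Spl (ah v) (bh v)) : Spl (ah W) (bh W) := by
  have key : ∀ (z : LaurentSeries κ) (c : κ), (laurent κ).R z c → c ≠ 0 →
      ∃ s, s ≠ 0 ∧ z = HahnSeries.C c * s ^ 2 := by
    intro z c hz hc
    have hC : (HahnSeries.C c : LaurentSeries κ) ≠ 0 := by simpa using hc
    have h1 := FieldPlace.div hz (laurent_C c) hc
    rw [div_self hc] at h1
    obtain ⟨s, hs⟩ := laurent_hasSqrt h2 _ h1
    refine ⟨s, ?_, ?_⟩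
    · rintro rfl
      refine FieldPlace.ne_zero h1 one_ne_zero ?_
      rw [hs]; simp
    · rw [← hs, mul_div_cancel₀ _ hC]
  have e : W = fun k => W 0 * (W k / W 0) := funext fun k => by rw [mul_div_cancel₀ _ h0]
  rw [e, spl_mul_iff h0]
  obtain ⟨s, hs0, h⟩ := key _ _ (R_ah hv) ha
  obtain ⟨t, ht0, h'⟩ := key _ _ (R_bh hv) hb
  rw [h, h', Spl.sq_mul_left_iff hs0, Spl.mul_sq_iff ht0]
  exact hs.map _

/-- Specialisation of the symbol along a rational curve on which the norm form is isotropic. -/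
theorem curve_step {κ : Type u} [Field κ] [CharZero κ] {i : κ} (hi : i ^ 2 = -1)
    (V : Fin 3 → κ[X]) (N : ℕ) (hN : ∀ k, (V k).natDegree ≤ N)
    (h0 : (fun k => (V k).coeff 0) ≠ 0)
    (hiso : Iso (algebraMap κ[X] (RatFunc κ) (V 1) / algebraMap κ[X] (RatFunc κ) (V 0))
      (algebraMap κ[X] (RatFunc κ) (V 2) / algebraMap κ[X] (RatFunc κ) (V 0)))
    (hT : NonSplit (fun k => (V k).coeff N)) : NonSplit (fun k => (V k).coeff 0) := by
  have h2κ : (2 : κ) ≠ 0 := two_ne_zero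
  have hw := single_ne_zero' (κ' := κ)
  have hinf : ∀ k, (laurent κ).R (HahnSeries.single 1 1 ^ N * expandInf (V k)) ((V k).coeff N) :=
    fun k => expandInf_R (hN k)
  have ha := R_ah hinf
  have hb := R_bh hinf
  have ha0 := FieldPlace.ne_zero ha hT.1
  have hb0 := FieldPlace.ne_zero hb hT.2.1
  have hsp : ¬ Spl (ah fun k => HahnSeries.single 1 1 ^ N * expandInf (V k))
      (bh fun k => HahnSeries.single 1 1 ^ N * expandInf (V k)) := fun h =>
    hT.2.2 (spl_of_place (laurent κ) h2κ ha hb hT.1 h)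
  rw [spl_mul_iff (pow_ne_zero N hw), ← map_ah, ← map_bh] at hsp
  rw [ah_mul, ← map_ah] at ha0
  rw [bh_mul, ← map_bh] at hb0
  have ha0' : ah V ≠ 0 := by
    intro h
    simp [h] at ha0
  have hb0' : bh V ≠ 0 := by
    intro h
    simp [h] at hb0
  have hnot : ¬ Spl (algebraMap κ[X] (RatFunc κ) (ah V)) (algebraMap κ[X] (RatFunc κ) (bh V)) := by
    intro h
    have := h.map (IsFractionRing.lift (K := RatFunc κ) (expandInf_injective (κ := κ)))
    rw [IsFractionRing.lift_algebraMap, IsFractionRing.lift_algebraMap] at this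
    exact hsp this
  have hloc : ∀ (κ' : Type u) [Field κ'] (τ : κ →+* κ') (θ : κ'),
      Spl (expand τ θ (ah V)) (expand τ θ (bh V)) ∨
      ((laurent κ').EvenUnit (expand τ θ (ah V)) ∧ (laurent κ').EvenUnit (expand τ θ (bh V)) ∧
        ∃ v : Fin 3 → κ', (∀ k, (laurent κ').R (expand τ θ (V k) / expand τ θ (V 0)) (v k)) ∧
        ah v ≠ 0 ∧ bh v ≠ 0) := by
    intro κ' _ τ θ
    have h2 : (2 : κ') ≠ 0 := fun h => h2κ (τ.injective (by rw [map_ofNat, map_zero, h]))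
    have hinj : Function.Injective (expand τ θ) := by
      rw [injective_iff_map_eq_zero]
      intro f hf
      by_contra h0
      exact expand_ne_zero τ θ h0 hf
    have hiso' := hiso.map (IsFractionRing.lift (K := RatFunc κ) hinj)
    simp only [map_div₀, IsFractionRing.lift_algebraMap] at hiso'
    rw [map_ah, map_bh]
    refine iso_local_homog (laurent κ') (laurent_hasSqrt h2) (two_ne_zero_laurent h2)
      (i := HahnSeries.C (τ i)) ?_
      ?_ ?_ hiso'
    · rw [← map_pow, ← map_pow, hi, map_neg, map_neg, map_one, map_one]
    · rw [← map_ah]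
      exact expand_ne_zero _ _ ha0'
    · rw [← map_bh]
      exact expand_ne_zero _ _ hb0'
  have h00 : ¬ Spl (expand (RingHom.id κ) 0 (ah V)) (expand (RingHom.id κ) 0 (bh V)) := fun h =>
    hnot (spl_ratFunc_of_local _ _ _ le_rfl ha0' hb0'
      (fun κ' _ τ θ => (hloc κ' τ θ).imp id fun h => ⟨h.1, h.2.1⟩) h)
  obtain ⟨-, -, v, hv, hav, hbv⟩ := (hloc κ (RingHom.id κ) 0).resolve_left h00
  have hR : ∀ f : κ[X], (laurent κ).R (expand (RingHom.id κ) 0 f) (f.coeff 0) := fun f => by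
    have := expand_R (RingHom.id κ) 0 f
    rwa [eval₂_id, ← coeff_zero_eq_eval_zero] at this
  have hV0 : expand (RingHom.id κ) 0 (V 0) ≠ 0 := by
    refine expand_ne_zero _ _ ?_
    intro h
    simp [ah, h] at ha0'
  have hvk : ∀ k, (V k).coeff 0 = (V 0).coeff 0 * v k := fun k => by
    have := (laurent κ).mul (hR (V 0)) (hv k)
    rw [mul_div_cancel₀ _ hV0] at this
    exact (laurent κ).uniq (hR (V k)) this
  have hc : (V 0).coeff 0 ≠ 0 := fun h => h0 (funext fun k => by simp [hvk k, h])
  rw [show (fun k => (V k).coeff 0) = fun k => (V 0).coeff 0 * v k from funext hvk,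
    nonSplit_mul_iff hc]
  refine ⟨hav, hbv, fun hs => h00 ?_⟩
  rw [map_ah, map_bh]
  exact spl_of_spl_residue hV0 hv h2κ hav hbv hs

end FieldPlace

end

section

open Polynomial

namespace FieldPlace

/-- The reduction of a vector, up to a scalar, is a point where the symbol is non-split. -/
def RedNonSplit {L κ : Type*} [Field L] [Field κ] (P : FieldPlace L κ) (V : Fin 3 → L) : Prop :=
  ∃ c ≠ 0, ∃ p : Fin 3 → κ, (∀ k, P.R (V k / c) (p k)) ∧ NonSplit p

theorem NonSplit.ne_zero {E : Type*} [Field E] {p : Fin 3 → E} (h : NonSplit p) : p ≠ 0 := by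
  rintro rfl
  exact h.1 (by simp [ah])

theorem RedNonSplit.of_eq {L κ : Type*} [Field L] [Field κ] {P : FieldPlace L κ} {V : Fin 3 → L}
    (h : RedNonSplit P V) {c : L} (hc : c ≠ 0) {p : Fin 3 → κ} (hp : ∀ k, P.R (V k / c) (p k))
    (hp0 : p ≠ 0) : NonSplit p := by
  obtain ⟨c', hc', p', hp', hns⟩ := h
  have key : ∀ {c c' : L} {p p' : Fin 3 → κ}, c ≠ 0 → c' ≠ 0 → (∀ k, P.R (V k / c) (p k)) →
      (∀ k, P.R (V k / c') (p' k)) → p ≠ 0 → ∃ d, P.R (c / c') d := by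
    intro c c' p p' hc hc' hp hp' h0
    obtain ⟨k, hk⟩ := Function.ne_iff.1 h0
    have h1 := FieldPlace.div (hp' k) (hp k) hk
    have hV : V k ≠ 0 := by
      intro h
      exact FieldPlace.ne_zero (hp k) hk (by simp [h])
    refine ⟨p' k / p k, ?_⟩
    convert h1 using 1
    field_simp
  obtain ⟨d, hd⟩ := key hc' hc hp' hp hns.ne_zero
  have hpe : p = fun k => d * p' k := funext fun k => by
    have h1 := P.mul hd (hp' k)
    rw [div_mul_div_cancel₀' hc'] at h1
    exact P.uniq (hp k) h1
  have hd0 : d ≠ 0 := by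
    rintro rfl
    exact hp0 (by rw [hpe]; simp; rfl)
  rw [hpe, nonSplit_mul_iff hd0]
  exact hns

/-- All reductions of the point `(x, y)` that come from constant-preserving substitutions
carry an isotropic form. -/
def IsoRed {L κ : Type*} [Field L] [Field κ] (P : FieldPlace L κ) (x y : RatFunc L) : Prop :=
  ∀ (φ : RatFunc L →+* RatFunc L) (Q : FieldPlace (RatFunc L) (RatFunc κ)),
    (∀ z, φ (RatFunc.C z) = RatFunc.C z) →
    (∀ z c, P.R z c → Q.R (RatFunc.C z) (RatFunc.C c)) →
    ∀ x' y', Q.R (φ x) x' → Q.R (φ y) y' → x' ≠ 0 → Iso x' y'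

/-- Substitution of a multiple of the variable. -/
noncomputable def scaleRat {L : Type*} [Field L] (ρ : L) (hρ : ρ ≠ 0) : RatFunc L →+* RatFunc L :=
  IsFractionRing.lift (K := RatFunc L)
    (g := (algebraMap L[X] (RatFunc L)).comp (compRingHom (C ρ * X))) (by
      rw [injective_iff_map_eq_zero]
      intro f hf
      rw [RingHom.comp_apply, map_eq_zero_iff _ (IsFractionRing.injective _ _)] at hf
      ext n
      have := congrArg (fun p : L[X] => p.coeff n) hf
      simpa [comp_C_mul_X_coeff, hρ] using this)

theorem scaleRat_algebraMap {L : Type*} [Field L] (ρ : L) (hρ : ρ ≠ 0) (f : L[X]) :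
    scaleRat ρ hρ (algebraMap _ _ f) = algebraMap _ _ (f.comp (C ρ * X)) := by
  rw [scaleRat, IsFractionRing.lift_algebraMap]
  rfl

theorem exists_lift_vs {L κ : Type*} [Field L] [Field κ] (P : FieldPlace L κ) {f : L[X]}
    (hf : ∀ n, f.coeff n ∈ P.vs) : ∃ B : P.vs[X], B.map P.vs.subtype = f ∧
      ∀ n, P.R (f.coeff n) ((B.map P.res).coeff n) := by
  obtain ⟨B, hB⟩ := (mem_lifts f).1 ((lifts_iff_coeff_lifts (f := P.vs.subtype) f).2
    fun n => ⟨⟨_, hf n⟩, rfl⟩)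
  refine ⟨B, hB, fun n => ?_⟩
  rw [← hB, coeff_map, coeff_map]
  exact P.R_res _

/-- Specialisation between the two ends of a face of the Newton polygon. -/
theorem face_step {L : Type*} {κ : Type u} [Field L] [Field κ] [CharZero κ] (P : FieldPlace L κ)
    {i : κ} (hi : i ^ 2 = -1) (W : Fin 3 → L[X])
    (hiso : IsoRed P (algebraMap L[X] (RatFunc L) (W 1) / algebraMap L[X] (RatFunc L) (W 0))
      (algebraMap L[X] (RatFunc L) (W 2) / algebraMap L[X] (RatFunc L) (W 0)))
    {a b : ℕ} (hab : a < b) {ρ m : L} (hρ : ρ ≠ 0) (hm : m ≠ 0)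
    (hfin : ∀ k n, (W k).coeff n * ρ ^ n / m ∈ P.vs)
    (hlt : ∀ k n, n < a → P.R ((W k).coeff n * ρ ^ n / m) 0)
    (hgt : ∀ k n, b < n → P.R ((W k).coeff n * ρ ^ n / m) 0)
    (hne : ∃ k, ¬ P.R ((W k).coeff a * ρ ^ a / m) 0)
    (hne' : ∃ k, ¬ P.R ((W k).coeff b * ρ ^ b / m) 0)
    (h : RedNonSplit P (fun k => (W k).coeff b)) : RedNonSplit P (fun k => (W k).coeff a) := by
  have hcoe : ∀ k n, (C m⁻¹ * (W k).comp (C ρ * X)).coeff n = (W k).coeff n * ρ ^ n / m := by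
    intro k n
    rw [coeff_C_mul, comp_C_mul_X_coeff]
    field_simp
  choose B hB hBR using fun k => P.exists_lift_vs (f := C m⁻¹ * (W k).comp (C ρ * X))
    fun n => by rw [hcoe]; exact hfin k n
  simp only [hcoe] at hBR
  have hz : ∀ k, ∃ V, (B k).map P.res = X ^ a * V := fun k => by
    refine X_pow_dvd_iff.2 fun n hn => P.uniq (hBR k n) (hlt k n hn)
  choose V hV using hz
  have hVc : ∀ k n, (V k).coeff n = ((B k).map P.res).coeff (n + a) := fun k n => by
    rw [hV, coeff_X_pow_mul]
  have hVR : ∀ k n, P.R ((W k).coeff (n + a) * ρ ^ (n + a) / m) ((V k).coeff n) := fun k n => by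
    rw [hVc]
    exact hBR k _
  have hdeg : ∀ k, (V k).natDegree ≤ b - a := fun k => by
    refine natDegree_le_iff_coeff_eq_zero.2 fun n hn => P.uniq (hVR k n) (hgt k _ (by omega))
  have hVa : ∀ k, P.R ((W k).coeff a / (m / ρ ^ a)) ((V k).coeff 0) := fun k => by
    convert hVR k 0 using 1
    rw [zero_add, div_div_eq_mul_div]
  have hVb : ∀ k, P.R ((W k).coeff b / (m / ρ ^ b)) ((V k).coeff (b - a)) := fun k => by
    convert hVR k (b - a) using 1
    rw [Nat.sub_add_cancel hab.le, div_div_eq_mul_div]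
  have hTb : NonSplit (fun k => (V k).coeff (b - a)) := by
    refine h.of_eq (div_ne_zero hm (pow_ne_zero b hρ)) hVb ?_
    intro h0
    obtain ⟨k, hk⟩ := hne'
    refine hk ?_
    have := hVb k
    rw [div_div_eq_mul_div, show (V k).coeff (b - a) = 0 from congrFun h0 k] at this
    exact this
  refine ⟨m / ρ ^ a, div_ne_zero hm (pow_ne_zero a hρ), _, hVa, ?_⟩
  refine curve_step hi V (b - a) hdeg ?_ ?_ hTb
  · intro h0
    obtain ⟨k, hk⟩ := hne
    refine hk ?_
    have := hVa k
    rw [div_div_eq_mul_div, show (V k).coeff 0 = 0 from congrFun h0 k] at this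
    exact this
  · obtain ⟨Q, hQ⟩ := P.exists_gauss_ratFunc
    have hV0 : V 0 ≠ 0 := by
      intro h0
      refine hTb.1 ?_
      simp [ah, h0]
    have hV1 : V 1 ≠ 0 := by
      intro h0
      refine hTb.1 ?_
      simp [ah, h0]
    have hV0' : algebraMap κ[X] (RatFunc κ) ((B 0).map P.res) ≠ 0 := by
      rw [hV]
      exact RatFunc.algebraMap_ne_zero (mul_ne_zero (pow_ne_zero _ X_ne_zero) hV0)
    have hX : algebraMap κ[X] (RatFunc κ) (X ^ a) ≠ 0 :=
      RatFunc.algebraMap_ne_zero (pow_ne_zero _ X_ne_zero)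
    have hC : algebraMap L[X] (RatFunc L) (C m⁻¹) ≠ 0 :=
      RatFunc.algebraMap_ne_zero (by simpa using hm)
    have key : ∀ k, Q.R (scaleRat ρ hρ (algebraMap L[X] (RatFunc L) (W k) /
        algebraMap L[X] (RatFunc L) (W 0)))
        (algebraMap κ[X] (RatFunc κ) (V k) / algebraMap κ[X] (RatFunc κ) (V 0)) := by
      intro k
      have := FieldPlace.div (hQ (B k)) (hQ (B 0)) hV0'
      rw [hV, hV, hB, hB, map_mul, map_mul, map_mul, map_mul, mul_div_mul_left _ _ hX,
        mul_div_mul_left _ _ hC] at this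
      rwa [map_div₀, scaleRat_algebraMap, scaleRat_algebraMap]
    refine hiso (scaleRat ρ hρ) Q (fun z => ?_) (fun z c hz => ?_) _ _ (key 1) (key 2)
      (div_ne_zero (RatFunc.algebraMap_ne_zero hV1) (RatFunc.algebraMap_ne_zero hV0))
    · rw [← RatFunc.algebraMap_C, scaleRat_algebraMap, C_comp]
    · have := hQ (C ⟨z, ⟨c, hz⟩⟩)
      rwa [map_C, map_C, RatFunc.algebraMap_C, RatFunc.algebraMap_C,
        res_eq (z := ⟨z, ⟨c, hz⟩⟩) hz] at this

end FieldPlace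

end

section

open Polynomial

namespace FieldPlace

/-- The coefficient of index `i` is a vertex of a Newton polygon. -/
def IsVertex {L Γ : Type*} [Field L] [LinearOrderedCommGroupWithZero Γ] (v : Valuation L Γ)
    (c : ℕ → L) (i : ℕ) : Prop :=
  c i ≠ 0 ∧ ∀ ρ ≠ 0, ∀ a b, a < i → i < b → v (c i * ρ ^ i) ≤ v (c a * ρ ^ a) →
    v (c b * ρ ^ b) < v (c i * ρ ^ i)

theorem isVertex_of_max {L Γ : Type*} [Field L] [LinearOrderedCommGroupWithZero Γ]
    (v : Valuation L Γ) (c : ℕ → L) {k : ℕ} {ρ : L} (hρ : ρ ≠ 0) (hk : c k ≠ 0)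
    (hlt : ∀ a < k, v (c a * ρ ^ a) < v (c k * ρ ^ k))
    (hle : ∀ b, k < b → v (c b * ρ ^ b) ≤ v (c k * ρ ^ k)) : IsVertex v c k := by
  refine ⟨hk, fun ρ' hρ' a b ha hb h => ?_⟩
  obtain ⟨t, ht, rfl⟩ : ∃ t, t ≠ 0 ∧ ρ' = ρ * t :=
    ⟨ρ' / ρ, div_ne_zero hρ' hρ, by field_simp⟩
  have e : ∀ n, v (c n * (ρ * t) ^ n) = v (c n * ρ ^ n) * v t ^ n := fun n => by
    rw [mul_pow, ← mul_assoc, map_mul, map_pow v t]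
  rw [e, e] at h ⊢
  have hvt : 0 < v t := zero_lt_iff.2 (by simpa using ht)
  have hvk : 0 < v (c k * ρ ^ k) := zero_lt_iff.2 (by simp [hk, hρ])
  have h1 : v t < 1 := by
    by_contra! hcon
    refine absurd h (not_le.2 ?_)
    calc v (c a * ρ ^ a) * v t ^ a < v (c k * ρ ^ k) * v t ^ a :=
          mul_lt_mul_of_pos_right (hlt a ha) (pow_pos hvt a)
      _ ≤ v (c k * ρ ^ k) * v t ^ k := by
          gcongr
  calc v (c b * ρ ^ b) * v t ^ b ≤ v (c k * ρ ^ k) * v t ^ b := by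
        gcongr
        exact hle b hb
    _ < v (c k * ρ ^ k) * v t ^ k :=
        mul_lt_mul_of_pos_left (pow_lt_pow_right_of_lt_one₀ hvt h1 hb) hvk

theorem newton_path {L : Type*} {κ : Type u} [Field L] [Field κ] [CharZero κ] (P : FieldPlace L κ)
    (hdiv : ∀ a : L, a ≠ 0 → ∀ n : ℕ, 0 < n → ∃ ρ, ρ ≠ 0 ∧
      P.vs.valuation ρ ^ n = P.vs.valuation a)
    {i : κ} (hi : i ^ 2 = -1) (W : Fin 3 → L[X])
    (hiso : IsoRed P (algebraMap L[X] (RatFunc L) (W 1) / algebraMap L[X] (RatFunc L) (W 0))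
      (algebraMap L[X] (RatFunc L) (W 2) / algebraMap L[X] (RatFunc L) (W 0)))
    (N : ℕ) (hN : ∀ k, (W k).natDegree ≤ N) (h0 : (fun k => (W k).coeff 0) ≠ 0)
    (hNN : (fun k => (W k).coeff N) ≠ 0)
    (h : RedNonSplit P (fun k => (W k).coeff N)) : RedNonSplit P (fun k => (W k).coeff 0) := by
  set v := P.vs.valuation with hv
  have hc : ∀ n, ∃ k, ∀ l, v ((W l).coeff n) ≤ v ((W k).coeff n) := fun n => by
    obtain ⟨k, hk⟩ := Finite.exists_max fun l => v ((W l).coeff n)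
    exact ⟨k, hk⟩
  choose k hk using hc
  set c : ℕ → L := fun n => (W (k n)).coeff n with hcdef
  have hcne : ∀ n, (fun l => (W l).coeff n) ≠ 0 → c n ≠ 0 := by
    intro n hn h0
    obtain ⟨l, hl⟩ := Function.ne_iff.1 hn
    have := hk n l
    rw [show (W (k n)).coeff n = 0 from h0, map_zero, le_zero_iff, map_eq_zero] at this
    exact hl this
  have hlt0 : ∀ z, v z < 1 → P.R z 0 := fun z hz => by
    by_cases hz0 : z = 0
    · exact hz0 ▸ P.zero
    have h1 : z⁻¹ ∉ P.vs := by
      rw [← P.vs.valuation_le_one_iff, map_inv₀, not_le]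
      exact (one_lt_inv₀ (zero_lt_iff.2 (by simpa using hz0))).2 hz
    simpa using (P.total z⁻¹).resolve_left h1
  have main : ∀ d a b, b - a = d → a < b → IsVertex v c a → IsVertex v c b →
      RedNonSplit P (fun l => (W l).coeff b) → RedNonSplit P (fun l => (W l).coeff a) := by
    intro d
    induction d using Nat.strong_induction_on with
    | _ d ih =>
    intro a b hd hab ha hb hT
    obtain ⟨ρ, hρ, hρv⟩ := hdiv (c a / c b) (div_ne_zero ha.1 hb.1) (b - a) (by omega)
    have hM : v (c b * ρ ^ b) = v (c a * ρ ^ a) := by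
      rw [← Nat.sub_add_cancel hab.le, pow_add, ← mul_assoc, Nat.sub_add_cancel hab.le, map_mul,
        map_mul, map_mul, map_pow, hρv, map_div₀, mul_div_cancel₀ _ (by simpa using hb.1)]
    have hout1 : ∀ n, n < a → v (c n * ρ ^ n) < v (c a * ρ ^ a) := fun n hn => by
      by_contra! hcon
      exact absurd hM (ha.2 ρ hρ n b hn hab hcon).ne
    have hout2 : ∀ n, b < n → v (c n * ρ ^ n) < v (c a * ρ ^ a) := fun n hn => by
      rw [← hM]
      exact hb.2 ρ hρ a n hab hn hM.le
    by_cases hin : ∀ n, a < n → n < b → v (c n * ρ ^ n) ≤ v (c a * ρ ^ a)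
    · have hma : c a * ρ ^ a ≠ 0 := mul_ne_zero ha.1 (pow_ne_zero _ hρ)
      have hva : 0 < v (c a * ρ ^ a) := zero_lt_iff.2 (by simpa using ⟨ha.1, fun h => absurd h hρ⟩)
      have hdivle : ∀ l n, v ((W l).coeff n * ρ ^ n / (c a * ρ ^ a)) ≤
          v (c n * ρ ^ n) / v (c a * ρ ^ a) := fun l n => by
        rw [map_div₀, map_mul, map_mul v (c n)]
        have := hk n l
        gcongr
      refine face_step P hi W hiso hab hρ hma ?_ ?_ ?_ ?_ ?_ hT
      · intro l n
        rw [← P.vs.valuation_le_one_iff]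
        refine (hdivle l n).trans ((div_le_one₀ hva).2 ?_)
        rcases lt_trichotomy n a with h | h | h
        · exact (hout1 n h).le
        · rw [h]
        · rcases lt_trichotomy n b with h' | h' | h'
          · exact hin n h h'
          · rw [h', hM]
          · exact (hout2 n h').le
      · intro l n hn
        exact hlt0 _ ((hdivle l n).trans_lt ((div_lt_one₀ hva).2 (hout1 n hn)))
      · intro l n hn
        exact hlt0 _ ((hdivle l n).trans_lt ((div_lt_one₀ hva).2 (hout2 n hn)))
      · refine ⟨k a, fun hR => ?_⟩
        rw [show (W (k a)).coeff a = c a from rfl, div_self hma] at hR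
        exact one_ne_zero (P.uniq P.one hR)
      · refine ⟨k b, fun hR => ?_⟩
        rw [show (W (k b)).coeff b = c b from rfl] at hR
        have hne : c b * ρ ^ b / (c a * ρ ^ a) ≠ 0 :=
          div_ne_zero (mul_ne_zero hb.1 (pow_ne_zero _ hρ)) hma
        have h1 : (c b * ρ ^ b / (c a * ρ ^ a))⁻¹ ∈ P.vs := by
          rw [← P.vs.valuation_le_one_iff, map_inv₀, map_div₀, hM, div_self hva.ne', inv_one]
        obtain ⟨e, he⟩ := h1
        have := P.mul he hR
        rw [inv_mul_cancel₀ hne, mul_zero] at this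
        exact one_ne_zero (P.uniq P.one this)
    · push Not at hin
      obtain ⟨n0, h1, h2, h3⟩ := hin
      obtain ⟨m, hm, hmax⟩ := Finset.exists_max_image (Finset.Ioo a b) (fun n => v (c n * ρ ^ n))
        ⟨n0, Finset.mem_Ioo.2 ⟨h1, h2⟩⟩
      have hex : ∃ n, n ∈ Finset.Ioo a b ∧ v (c n * ρ ^ n) = v (c m * ρ ^ m) := ⟨m, hm, rfl⟩
      classical
      obtain ⟨hk0, hk1⟩ := Nat.find_spec hex
      have hmin : ∀ n < Nat.find hex, _ := fun n hn => Nat.find_min hex hn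
      set k0 := Nat.find hex
      rw [Finset.mem_Ioo] at hk0
      have hM0 : v (c a * ρ ^ a) < v (c k0 * ρ ^ k0) := by
        rw [hk1]
        exact h3.trans_le (hmax n0 (Finset.mem_Ioo.2 ⟨h1, h2⟩))
      have hvert : IsVertex v c k0 := by
        refine isVertex_of_max v c hρ ?_ ?_ ?_
        · intro h
          simp [h] at hM0
        · intro n hn
          rcases lt_trichotomy n a with h | h | h
          · exact (hout1 n h).trans hM0
          · rwa [h]
          · have hmem : n ∈ Finset.Ioo a b := Finset.mem_Ioo.2 ⟨h, hn.trans hk0.2⟩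
            refine lt_of_le_of_ne (hk1 ▸ hmax n hmem) fun he => ?_
            exact hmin n hn ⟨hmem, he.trans hk1⟩
        · intro n hn
          rcases lt_trichotomy n b with h | h | h
          · exact hk1 ▸ hmax n (Finset.mem_Ioo.2 ⟨hk0.1.trans hn, h⟩)
          · rw [h, hM]
            exact hM0.le
          · exact ((hout2 n h).trans hM0).le
      exact ih (k0 - a) (by omega) a k0 rfl hk0.1 ha hvert
        (ih (b - k0) (by omega) k0 b rfl hk0.2 hvert hb hT)
  rcases Nat.eq_zero_or_pos N with rfl | hpos
  · exact h
  · refine main N 0 N (by omega) hpos ⟨hcne 0 h0, fun ρ _ a b ha => absurd ha (by omega)⟩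
      ⟨hcne N hNN, fun ρ hρ a b ha hb _ => ?_⟩ h
    have : c b = 0 := coeff_eq_zero_of_natDegree_lt ((hN _).trans_lt hb)
    rw [this, zero_mul, map_zero]
    exact zero_lt_iff.2 (by simpa using ⟨hcne N hNN, fun h => absurd h hρ⟩)

end FieldPlace

end

section

open Polynomial

namespace FieldPlace

theorem exists_clear_denominators {A : Type*} [CommRing A] [Algebra ℂ A] {ι : Type*}
    (D : A) (F : ι → A) (Q : MvPolynomial ι ℂ) : ∃ (N : ℕ) (G : A), ∀ (E : Type) [Field E]
      (φ : A →+* E), φ D ≠ 0 → φ G = φ D ^ N *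
        MvPolynomial.eval₂ (φ.comp (algebraMap ℂ A)) (fun l => φ (F l) / φ D) Q := by
  induction Q using MvPolynomial.induction_on with
  | C a => exact ⟨0, algebraMap ℂ A a, fun E _ φ _ => by simp⟩
  | add p q hp hq =>
    obtain ⟨N, G, h⟩ := hp
    obtain ⟨N', G', h'⟩ := hq
    refine ⟨N + N', D ^ N' * G + D ^ N * G', fun E _ φ hD => ?_⟩
    rw [map_add, map_mul, map_mul, map_pow, map_pow, h E φ hD, h' E φ hD, MvPolynomial.eval₂_add]
    ring
  | mul_X p l hp =>
    obtain ⟨N, G, h⟩ := hp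
    refine ⟨N + 1, G * F l, fun E _ φ hD => ?_⟩
    rw [map_mul, h E φ hD, MvPolynomial.eval₂_mul, MvPolynomial.eval₂_X]
    field_simp
    ring

/-- Homogenised restriction of a polynomial to the line through two points. -/
theorem exists_line {L : Type*} [Field L] (ι : ℂ →+* L) {n : ℕ} (σ : Fin n → L) (c : Fin n → ℂ)
    (f : MvPolynomial (Fin n) ℂ) : ∃ N₀ : ℕ, ∀ N ≥ N₀, ∃ H : L[X], H.natDegree ≤ N ∧
      algebraMap L[X] (RatFunc L) H = algebraMap L[X] (RatFunc L) (1 + X) ^ N *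
        MvPolynomial.eval₂ (RatFunc.C.comp ι) (fun j => algebraMap L[X] (RatFunc L)
          (C (ι (c j)) + X * C (σ j)) / algebraMap L[X] (RatFunc L) (1 + X)) f ∧
      H.coeff 0 = ι (MvPolynomial.eval c f) ∧ H.coeff N = MvPolynomial.eval₂ ι σ f := by
  have hdeg : (1 + X : L[X]).natDegree ≤ 1 := by
    compute_degree
  have hdegN : ∀ N, ((1 + X : L[X]) ^ N).natDegree ≤ N := fun N => by
    simpa using natDegree_pow_le_of_le N hdeg
  have hcoN : ∀ N, ((1 + X : L[X]) ^ N).coeff N = 1 := fun N => by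
    have := coeff_pow_of_natDegree_le (m := N) hdeg
    rw [mul_one] at this
    rw [this]
    simp [coeff_one]
  have h1X : algebraMap L[X] (RatFunc L) (1 + X) ≠ 0 := by
    refine RatFunc.algebraMap_ne_zero fun h => ?_
    simpa using congrArg (fun p : L[X] => p.coeff 0) h
  induction f using MvPolynomial.induction_on with
  | C a =>
    refine ⟨0, fun N _ => ⟨C (ι a) * (1 + X) ^ N, ?_, ?_, ?_, ?_⟩⟩
    · exact (natDegree_C_mul_le _ _).trans (hdegN N)
    · simp only [MvPolynomial.eval₂_C, map_mul, map_pow, RatFunc.algebraMap_C, RingHom.comp_apply]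
      ring
    · simp [coeff_zero_eq_eval_zero]
    · rw [coeff_C_mul, hcoN]
      simp
  | add p q hp hq =>
    obtain ⟨N₁, h₁⟩ := hp
    obtain ⟨N₂, h₂⟩ := hq
    refine ⟨max N₁ N₂, fun N hN => ?_⟩
    obtain ⟨H, hd, ha, h0, hN'⟩ := h₁ N ((le_max_left _ _).trans hN)
    obtain ⟨H', hd', ha', h0', hN''⟩ := h₂ N ((le_max_right _ _).trans hN)
    refine ⟨H + H', natDegree_add_le_of_degree_le hd hd', ?_, ?_, ?_⟩
    · rw [map_add, ha, ha', MvPolynomial.eval₂_add, mul_add]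
    · rw [coeff_add, h0, h0', map_add, map_add]
    · rw [coeff_add, hN', hN'', MvPolynomial.eval₂_add]
  | mul_X p j hp =>
    obtain ⟨N₁, h₁⟩ := hp
    refine ⟨N₁ + 1, fun N hN => ?_⟩
    obtain ⟨N, rfl⟩ : ∃ M, N = M + 1 := ⟨N - 1, by omega⟩
    obtain ⟨H, hd, ha, h0, hN'⟩ := h₁ N (by omega)
    have hl : (C (ι (c j)) + X * C (σ j)).natDegree ≤ 1 := by compute_degree
    refine ⟨H * (C (ι (c j)) + X * C (σ j)), natDegree_mul_le_of_le hd hl, ?_, ?_, ?_⟩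
    · rw [map_mul, ha, MvPolynomial.eval₂_mul, MvPolynomial.eval₂_X]
      field_simp
      ring
    · rw [mul_coeff_zero, h0]
      simp
    · rw [coeff_mul_add_eq_of_natDegree_le hd hl, hN', MvPolynomial.eval₂_mul, MvPolynomial.eval₂_X]
      simp

theorem no_rational_parametrisation {L κ : Type} [Field L] [Field κ] [CharZero κ]
    (P : FieldPlace L κ)
    (hdiv : ∀ a : L, a ≠ 0 → ∀ n : ℕ, 0 < n → ∃ ρ, ρ ≠ 0 ∧
      P.vs.valuation ρ ^ n = P.vs.valuation a)
    {i : κ} (hi : i ^ 2 = -1) (ι : ℂ →+* L) (n : ℕ)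
    (e : L ≃+* FractionRing (MvPolynomial (Fin n) ℂ))
    (he : ∀ c, e (ι c) = algebraMap (MvPolynomial (Fin n) ℂ) _ (MvPolynomial.C c))
    (m : Fin 5 → L) (Qp : MvPolynomial (Fin 5) ℂ) (hQ : MvPolynomial.eval₂ ι m Qp = 0)
    (hiso : ∀ m' : Fin 5 → RatFunc L, MvPolynomial.eval₂ (RatFunc.C.comp ι) m' Qp = 0 →
      IsoRed P (m' 0) (m' 1))
    (hconst : ∀ w : Fin 3 → ℂ, w ≠ 0 → ¬ RedNonSplit P (fun k => ι (w k)))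
    {x y : κ} (hx : P.R (m 0) x) (hy : P.R (m 1) y) (hns : NonSplit ![1, x, y]) : False := by
  obtain ⟨⟨D, hD⟩, hF⟩ := IsLocalization.exist_integer_multiples
    (nonZeroDivisors (MvPolynomial (Fin n) ℂ)) Finset.univ (fun l => e (m l))
  have hD0 : D ≠ 0 := nonZeroDivisors.ne_zero hD
  choose F hF using fun l => hF l (Finset.mem_univ l)
  simp only [Algebra.smul_def] at hF
  set σ : Fin n → L := fun j => e.symm (algebraMap (MvPolynomial (Fin n) ℂ) _ (MvPolynomial.X j))
  set Φ : MvPolynomial (Fin n) ℂ →+* L := (e.symm : FractionRing (MvPolynomial (Fin n) ℂ) →+* L).comp (algebraMap (MvPolynomial (Fin n) ℂ) _) with hΦ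
  have hΦC : ∀ c, Φ (MvPolynomial.C c) = ι c := fun c => by
    rw [hΦ, RingHom.comp_apply, ← he]
    simp
  have hΦσ : ∀ f, MvPolynomial.eval₂ ι σ f = Φ f := fun f => by
    induction f using MvPolynomial.induction_on with
    | C a => rw [MvPolynomial.eval₂_C, hΦC]
    | add p q hp hq => rw [MvPolynomial.eval₂_add, hp, hq, map_add]
    | mul_X p j hp => rw [MvPolynomial.eval₂_mul, hp, map_mul, MvPolynomial.eval₂_X]; rfl
  have hΦinj : Function.Injective Φ := e.symm.injective.comp (IsFractionRing.injective _ _)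
  have hΦD : Φ D ≠ 0 := (map_ne_zero_iff _ hΦinj).2 hD0
  have hΦF : ∀ l, Φ (F l) = Φ D * m l := fun l => by
    apply e.injective
    simp only [hΦ, RingHom.comp_apply, map_mul, RingHom.coe_coe, RingEquiv.apply_symm_apply]
    exact hF l
  obtain ⟨c, hc⟩ : ∃ c, MvPolynomial.eval c D ≠ 0 := by
    by_contra! h
    exact hD0 (MvPolynomial.funext fun c => by simp [h c])
  obtain ⟨N₁, h₁⟩ := exists_line ι σ c D
  obtain ⟨N₂, h₂⟩ := exists_line ι σ c (F 0)
  obtain ⟨N₃, h₃⟩ := exists_line ι σ c (F 1)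
  set N := max N₁ (max N₂ N₃)
  obtain ⟨H₁, hd₁, ha₁, h0₁, hN₁⟩ := h₁ N (by omega)
  obtain ⟨H₂, hd₂, ha₂, h0₂, hN₂⟩ := h₂ N (by omega)
  obtain ⟨H₃, hd₃, ha₃, h0₃, hN₃⟩ := h₃ N (by omega)
  set Ψ : MvPolynomial (Fin n) ℂ →+* RatFunc L := MvPolynomial.eval₂Hom (RatFunc.C.comp ι)
    (fun j => algebraMap L[X] (RatFunc L) (C (ι (c j)) + X * C (σ j)) /
      algebraMap L[X] (RatFunc L) (1 + X)) with hΨ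
  have hH1 : algebraMap L[X] (RatFunc L) H₁ ≠ 0 := by
    refine RatFunc.algebraMap_ne_zero fun h => ?_
    rw [h, coeff_zero, eq_comm, map_eq_zero] at h0₁
    exact hc h0₁
  have h1X : algebraMap L[X] (RatFunc L) (1 + X) ^ N ≠ 0 := by
    rw [ha₁] at hH1
    exact left_ne_zero_of_mul hH1
  have hΨD : Ψ D ≠ 0 := by
    rw [ha₁] at hH1
    exact right_ne_zero_of_mul hH1
  obtain ⟨M, G, hG⟩ := exists_clear_denominators D F Qp
  have hG0 : G = 0 := by
    apply hΦinj
    rw [map_zero, hG L Φ hΦD]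
    have e1 : (fun l => Φ (F l) / Φ D) = m := funext fun l => by
      rw [hΦF, mul_div_cancel_left₀ _ hΦD]
    have e2 : Φ.comp (algebraMap ℂ (MvPolynomial (Fin n) ℂ)) = ι := RingHom.ext hΦC
    rw [e1, e2, hQ, mul_zero]
  have hQ' : MvPolynomial.eval₂ (RatFunc.C.comp ι) (fun l => Ψ (F l) / Ψ D) Qp = 0 := by
    have := hG (RatFunc L) Ψ hΨD
    rw [hG0, map_zero, eq_comm] at this
    have e2 : Ψ.comp (algebraMap ℂ (MvPolynomial (Fin n) ℂ)) = RatFunc.C.comp ι :=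
      RingHom.ext fun c => by simp [hΨ, MvPolynomial.algebraMap_eq]
    rw [e2] at this
    exact (mul_eq_zero.1 this).resolve_left (pow_ne_zero _ hΨD)
  have hiso' := hiso _ hQ'
  have hpath := newton_path P hdiv hi ![H₁, H₂, H₃] ?_ N ?_ ?_ ?_ ?_
  · refine hconst ![MvPolynomial.eval c D, MvPolynomial.eval c (F 0), MvPolynomial.eval c (F 1)]
      (fun h => hc (congrFun h 0)) ?_
    convert hpath using 2 with k
    fin_cases k
    exacts [h0₁.symm, h0₂.symm, h0₃.symm]
  · convert hiso' using 1
    · exact (congrArg₂ _ ha₂ ha₁).trans (mul_div_mul_left _ _ h1X)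
    · exact (congrArg₂ _ ha₃ ha₁).trans (mul_div_mul_left _ _ h1X)
  · intro k
    fin_cases k
    exacts [hd₁, hd₂, hd₃]
  · intro h
    have : H₁.coeff 0 = 0 := congrFun h 0
    rw [h0₁, map_eq_zero] at this
    exact hc this
  · intro h
    have : H₁.coeff N = 0 := congrFun h 0
    rw [hN₁, hΦσ] at this
    exact hΦD this
  · refine ⟨Φ D, hΦD, _, ?_, hns⟩
    intro k
    fin_cases k
    · change P.R (H₁.coeff N / Φ D) 1
      rw [hN₁, hΦσ, div_self hΦD]
      exact P.one
    · change P.R (H₂.coeff N / Φ D) x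
      rwa [hN₂, hΦσ, hΦF, mul_div_cancel_left₀ _ hΦD]
    · change P.R (H₃.coeff N / Φ D) y
      rwa [hN₃, hΦσ, hΦF, mul_div_cancel_left₀ _ hΦD]

end FieldPlace

end

theorem Spl.of_ratFunc {K : Type*} [Field K] (h2 : (2 : K) ≠ 0) {a b : K} (ha : a ≠ 0)
    (h : Spl (RatFunc.C a) (RatFunc.C b)) : Spl a b := by
  by_cases hsq : ∃ c, a = c ^ 2
  · obtain ⟨c, rfl⟩ := hsq
    exact Spl.of_isSquare h2 (by rintro rfl; simp at ha)
  obtain ⟨r, s, h⟩ := h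
  obtain ⟨v0, v1, -, hv, -⟩ := cassels_quadratic h2 ![1, -a] (fun v hv => by
    simp only [Fin.sum_univ_two, Matrix.cons_val_zero, Matrix.cons_val_one] at hv
    have h1 : v 1 = 0 := by
      by_contra h1
      exact hsq ⟨v 0 / v 1, by field_simp; linear_combination -hv⟩
    have h0 : v 0 = 0 := by simpa [h1] using hv
    funext i; fin_cases i <;> simp [h0, h1]) 0 b ![r, s] (by
    simp [Fin.sum_univ_two, h]; ring)
  exact ⟨v0 0, v0 1, by rw [← hv]; simp [Fin.sum_univ_two]; ring⟩

/-- The pure part of the norm form of a division quaternion algebra is anisotropic. -/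
theorem pure_anisotropic {K : Type*} [Field K] (h2 : (2 : K) ≠ 0) {x p : K} (hx : x ≠ 0)
    (hns : ¬ Spl x p) (v : Fin 3 → K)
    (hv : ∑ i, ![x, p, -(x * p)] i * v i ^ 2 = 0) : v = 0 := by
  simp only [Fin.sum_univ_three, Matrix.cons_val] at hv
  have hsq : ∀ c, x ≠ c ^ 2 := by
    rintro c rfl
    exact hns (Spl.of_isSquare h2 (by rintro rfl; simp at hx))
  have hN : v 1 ^ 2 - x * v 2 ^ 2 = 0 := by
    by_contra hN
    refine hns (Spl.of_isotropic h2 hx (r := x * v 0 * v 2) (s := v 0 * v 1)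
      (t := v 1 ^ 2 - x * v 2 ^ 2) ?_ (Or.inr (Or.inr hN)))
    linear_combination -(v 1 ^ 2 - x * v 2 ^ 2) * hv
  have h0 : v 0 = 0 := by
    have : x * v 0 ^ 2 = 0 := by linear_combination hv - p * hN
    simpa [hx] using this
  have hv2 : v 2 = 0 := by
    by_contra hv2
    exact hsq (v 1 / v 2) (by field_simp; linear_combination -hN)
  have hv1 : v 1 = 0 := by simpa [hv2] using hN
  funext i; fin_cases i <;> simp [h0, hv1, hv2]

/-- The binary form that controls splitting over the quadratic extensions used below. -/
theorem not_binary_value {K : Type*} [Field K] (h2 : (2 : K) ≠ 0) {x p A B : K} (hx : x ≠ 0)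
    (hns : ¬ Spl x p) (hAB : ∀ t, A * B ≠ -(x ^ 2 * p * t ^ 2)) (f g : RatFunc K) :
    RatFunc.C A * RatFunc.X ^ 2 + RatFunc.C B
      ≠ RatFunc.C x * f ^ 2 - RatFunc.C x * RatFunc.C p * g ^ 2 := by
  intro h
  obtain ⟨v0, v1, hA, hB, hO⟩ := cassels_quadratic h2 ![x, -(x * p)] (fun v hv => by
    have := pure_anisotropic h2 hx hns ![v 0, 0, v 1] (by
      simpa [Fin.sum_univ_two, Fin.sum_univ_three] using hv)
    have h0 := congrFun this 0
    have h1 := congrFun this 2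
    simp only [Matrix.cons_val, Pi.zero_apply] at h0 h1
    funext i; fin_cases i <;> simp [h0, h1]) A B ![f, g] (by
    simp [Fin.sum_univ_two, h]; ring)
  simp only [Fin.sum_univ_two, Matrix.cons_val_zero, Matrix.cons_val_one] at hA hB hO
  refine hAB (v0 0 * v1 1 - v0 1 * v1 0) ?_
  rw [← hA, ← hB]
  linear_combination (x * (v0 0 * v1 0) + -(x * p) * (v0 1 * v1 1)) * hO

variable {K : Type*} [Field K] in
/-- The discriminant `p x² a² + (A b² + B)` over `K(b)(a)`. -/
noncomputable def bigDisc (x p A B : K) : RatFunc (RatFunc K) :=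
  RatFunc.C (RatFunc.C (p * x ^ 2)) * RatFunc.X ^ 2
    + RatFunc.C (RatFunc.C A * RatFunc.X ^ 2 + RatFunc.C B)

theorem two_ne_zero_ratFunc {K : Type*} [Field K] (h2 : (2 : K) ≠ 0) : (2 : RatFunc K) ≠ 0 := by
  have := (map_ne_zero (RatFunc.C : K →+* RatFunc K)).2 h2
  rwa [map_ofNat] at this

theorem bigDisc_not_sq {K : Type*} [Field K] (h2 : (2 : K) ≠ 0) {x p A B : K} (hx : x ≠ 0)
    (hp : p ≠ 0) (hns : ¬ Spl x p) (hAB : ∀ t, A * B ≠ -(x ^ 2 * p * t ^ 2))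
    (r : RatFunc (RatFunc K)) : r ^ 2 ≠ bigDisc x p A B := by
  intro h
  obtain ⟨v0, v1, hA, hB, hO⟩ := cassels_quadratic (two_ne_zero_ratFunc h2) ![(1 : RatFunc K)]
    (fun v hv => by funext i; fin_cases i; simpa using hv)
    (RatFunc.C (p * x ^ 2)) (RatFunc.C A * RatFunc.X ^ 2 + RatFunc.C B) ![r] (by
    simpa [bigDisc] using h)
  simp only [Finset.univ_unique, Fin.default_eq_zero, Matrix.cons_val_fin_one, one_mul,
    Finset.sum_singleton] at hA hB hO
  have h1 : v1 0 ≠ 0 := by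
    intro h1
    rw [h1] at hA
    have : p * x ^ 2 ≠ 0 := mul_ne_zero hp (pow_ne_zero 2 hx)
    exact (map_ne_zero (RatFunc.C : K →+* RatFunc K)).2 this (by rw [← hA]; simp)
  have h0 : v0 0 = 0 := by simpa [h1] using hO
  refine not_binary_value h2 hx hns hAB 0 0 ?_
  rw [← hB, h0]; simp

/-- A representation over the quadratic extension descends to a value of the pure norm form. -/
theorem exists_pure_value {E : Type*} [Field E] {x p D r0 r1 s0 s1 : E} (hns : ¬ Spl x p) (h1 : r0 * r1 = x * (s0 * s1))
    (h : r0 ^ 2 + D * r1 ^ 2 - x * (s0 ^ 2 + D * s1 ^ 2) = p) :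
    ∃ e a b : E, D = x * e ^ 2 + p * (a ^ 2 - x * b ^ 2) := by
  have hN : r1 ^ 2 - x * s1 ^ 2 ≠ 0 := by
    intro hN
    exact hns ⟨r0, s0, by linear_combination -h + D * hN⟩
  refine ⟨(r0 * s1 - s0 * r1) / (r1 ^ 2 - x * s1 ^ 2), r1 / (r1 ^ 2 - x * s1 ^ 2),
    s1 / (r1 ^ 2 - x * s1 ^ 2), ?_⟩
  field_simp
  linear_combination (r1 ^ 2 - x * s1 ^ 2) * h - (r0 * r1 - x * s0 * s1) * h1

theorem not_spl_bigDisc {K : Type*} [Field K] (h2 : (2 : K) ≠ 0) {x p A B : K} (hx : x ≠ 0)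
    (hp : p ≠ 0) (hns : ¬ Spl x p) (hAB : ∀ t, A * B ≠ -(x ^ 2 * p * t ^ 2))
    (e a b : RatFunc (RatFunc K)) : bigDisc x p A B ≠ RatFunc.C (RatFunc.C x) * e ^ 2
      + RatFunc.C (RatFunc.C p) * (a ^ 2 - RatFunc.C (RatFunc.C x) * b ^ 2) := by
  intro h
  have h2' := two_ne_zero_ratFunc h2
  have hx' : RatFunc.C x ≠ 0 := (map_ne_zero (RatFunc.C : K →+* RatFunc K)).2 hx
  have hp' : RatFunc.C p ≠ 0 := (map_ne_zero (RatFunc.C : K →+* RatFunc K)).2 hp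
  have hns' : ¬ Spl (RatFunc.C x) (RatFunc.C p) := fun h => hns (h.of_ratFunc h2 hx)
  obtain ⟨v0, v1, hA, hB, hO⟩ := cassels_quadratic h2'
    ![RatFunc.C x, RatFunc.C p, -(RatFunc.C x * RatFunc.C p)]
    (pure_anisotropic h2' hx' hns') _ _ ![e, a, b] (by
      rw [← bigDisc, h]; simp [Fin.sum_univ_three]; ring)
  simp only [Fin.sum_univ_three, Matrix.cons_val] at hA hB hO
  rw [map_mul, map_pow] at hA
  generalize hX : RatFunc.C x = X at *
  generalize hP : RatFunc.C p = p' at *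
  suffices ∃ f g : RatFunc K, RatFunc.C A * RatFunc.X ^ 2 + RatFunc.C B
      = X * f ^ 2 - X * p' * g ^ 2 by
    obtain ⟨f, g, hfg⟩ := this
    rw [← hX, ← hP] at hfg
    exact not_binary_value h2 hx hns hAB f g hfg
  rw [← hB]
  by_cases hu : v1 1 = X
  · have := pure_anisotropic h2' hx' hns' ![v1 0, 0, v1 2] (by
      simp only [Fin.sum_univ_three, Matrix.cons_val]
      rw [hu] at hA
      linear_combination hA)
    have h0 := congrFun this 0
    have h1 := congrFun this 2
    simp only [Matrix.cons_val, Pi.zero_apply] at h0 h1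
    rw [h0, h1, hu] at hO
    have : v0 1 = 0 := by
      have h3 : (p' * X) * v0 1 = 0 := by linear_combination hO
      simpa [hx', hp'] using h3
    exact ⟨v0 0, v0 2, by rw [this]; ring⟩
  · have hd : X - v1 1 ≠ 0 := sub_ne_zero.2 (Ne.symm hu)
    refine ⟨v0 0 + v0 1 / (X - v1 1) * v1 0, v0 2 + v0 1 / (X - v1 1) * v1 2, ?_⟩
    field_simp
    linear_combination (-(v0 1 ^ 2)) * hA - 2 * (v0 1) * (X - v1 1) * hO

theorem not_spl_quadraticAlgebra {K : Type*} [Field K] (h2 : (2 : K) ≠ 0) {x p A B : K}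
    (hx : x ≠ 0) (hp : p ≠ 0) (hns : ¬ Spl x p) (hAB : ∀ t, A * B ≠ -(x ^ 2 * p * t ^ 2))
    [Fact (∀ r : RatFunc (RatFunc K), r ^ 2 ≠ bigDisc x p A B + 0 * r)] :
    ¬ Spl (algebraMap (RatFunc (RatFunc K)) (QuadraticAlgebra _ (bigDisc x p A B) 0)
        (RatFunc.C (RatFunc.C x)))
      (algebraMap (RatFunc (RatFunc K)) (QuadraticAlgebra _ (bigDisc x p A B) 0)
        (RatFunc.C (RatFunc.C p))) := by
  rintro ⟨r, s, h⟩
  have hns' : ¬ Spl (RatFunc.C (RatFunc.C x)) (RatFunc.C (RatFunc.C p)) := fun h =>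
    hns ((h.of_ratFunc (two_ne_zero_ratFunc h2)
      ((map_ne_zero (RatFunc.C : K →+* RatFunc K)).2 hx)).of_ratFunc h2 hx)
  have h1 := congrArg QuadraticAlgebra.re h
  have h3 := congrArg QuadraticAlgebra.im h
  simp [pow_two, QuadraticAlgebra.re_mul, QuadraticAlgebra.im_mul] at h1 h3
  obtain ⟨e, a, b, h4⟩ := exists_pure_value (D := bigDisc x p A B) (r0 := r.re) (r1 := r.im)
    (s0 := s.re) (s1 := s.im) hns' (by
      have : (2 : RatFunc (RatFunc K)) ≠ 0 := two_ne_zero_ratFunc (two_ne_zero_ratFunc h2)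
      refine mul_left_cancel₀ this ?_
      linear_combination -h3) (by linear_combination -h1)
  exact not_spl_bigDisc h2 hx hp hns hAB e a b h4

section Base

open Polynomial

variable {k : Type*} [Field k]

theorem one_add_sq_not_sq (h2 : (2 : k) ≠ 0) (c : RatFunc k) :
    c ^ 2 ≠ 1 + RatFunc.X ^ 2 := by
  intro h
  obtain ⟨v0, v1, hA, hB, hO⟩ := cassels_quadratic h2 ![(1 : k)]
    (fun v hv => by funext i; fin_cases i; simpa using hv) 1 1 ![c] (by
    simp [h, add_comm])
  simp only [Finset.univ_unique, Fin.default_eq_zero, Matrix.cons_val_fin_one, one_mul,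
    Finset.sum_singleton] at hA hB hO
  rcases mul_eq_zero.1 hO with h | h <;> simp [h] at hA hB

theorem exists_expand_ratFunc (θ : k) : ∃ f : RatFunc k →+* LaurentSeries k,
    ∀ p : k[X], f (algebraMap _ _ p) = FieldPlace.expand (RingHom.id k) θ p := by
  refine ⟨IsFractionRing.lift (A := k[X]) (g := FieldPlace.expand (RingHom.id _) θ) ?_,
    fun p => IsFractionRing.lift_algebraMap _ _⟩
  rw [injective_iff_map_eq_zero]
  intro a ha
  by_contra h
  exact FieldPlace.expand_ne_zero _ _ h ha

theorem disc_generic_ne_zero :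
    FieldPlace.disc (RatFunc.X : RatFunc (RatFunc k)) (RatFunc.C RatFunc.X) ≠ 0 := by
  have e1 : (FieldPlace.disc RatFunc.X (RatFunc.C RatFunc.X) : RatFunc (RatFunc k))
      = algebraMap (RatFunc k)[X] _ (X - (1 - X) * C RatFunc.X ^ 2) := by
    simp [FieldPlace.disc]
  rw [e1]
  refine (map_ne_zero_iff _ (RatFunc.algebraMap_injective _)).2 fun h => ?_
  have := congrArg (eval 1) h
  simp at this

/-- The discriminant symbol does not split generically. -/
theorem not_spl_disc_generic (h2 : (2 : k) ≠ 0) :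
    ¬ Spl (RatFunc.X : RatFunc (RatFunc k))
      (FieldPlace.disc RatFunc.X (RatFunc.C RatFunc.X)) := by
  intro h
  generalize hY : (RatFunc.X : RatFunc k) = y at h
  have hy : 1 + y ^ 2 ≠ 0 := fun h => one_add_sq_not_sq h2 0 (by rw [hY, h]; ring)
  have hy0 : y ≠ 0 := hY ▸ RatFunc.X_ne_zero
  obtain ⟨f, hf⟩ := exists_expand_ratFunc (y ^ 2 / (1 + y ^ 2))
  have h3 := (h.symm (two_ne_zero_ratFunc (two_ne_zero_ratFunc h2)) (hY ▸ disc_generic_ne_zero)).map f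
  rw [← RatFunc.algebraMap_X, hf] at h3
  have e1 : (FieldPlace.disc (algebraMap (RatFunc k)[X] _ X) (RatFunc.C y) : RatFunc (RatFunc k))
    = algebraMap (RatFunc k)[X] _ (X - (1 - X) * C y ^ 2) := by
    simp [FieldPlace.disc]
  rw [e1, hf] at h3
  have e2 : (X - (1 - X) * C y ^ 2).eval₂ (RingHom.id _) (y ^ 2 / (1 + y ^ 2)) = 0 := by
    simp
    field_simp
    ring
  obtain ⟨u, hu, hur⟩ := FieldPlace.expand_simple_root _ _ e2
  rw [hu] at h3
  obtain ⟨e, he⟩ := FieldPlace.residue_sq_of_spl FieldPlace.laurent_single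
    FieldPlace.single_ne_zero' FieldPlace.laurent_normal_form hur (by
      simpa [derivative_pow, add_comm] using hy) (FieldPlace.expand_R (RingHom.id _) _ X) h3
  simp only [eval₂_X] at he
  have he0 : e ≠ 0 := by
    rintro rfl
    have : y ^ 2 / (1 + y ^ 2) ≠ 0 := div_ne_zero (pow_ne_zero 2 hy0) hy
    exact this (by rw [he]; ring)
  refine one_add_sq_not_sq h2 (y / e) ?_
  rw [hY]
  field_simp at he ⊢
  linear_combination he

theorem X_mul_one_sub_X_not_sq (c : RatFunc k) : RatFunc.X * (1 - RatFunc.X) ≠ c ^ 2 := by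
  intro h
  obtain ⟨f, hf⟩ := exists_expand_ratFunc (0 : k)
  have e1 : (RatFunc.X * (1 - RatFunc.X) : RatFunc k) = algebraMap k[X] _ (X * (1 - X)) := by simp
  have e2 := congrArg f h
  rw [e1, hf, map_mul] at e2
  obtain ⟨u, hu, hur⟩ := FieldPlace.expand_simple_root (RingHom.id k) 0 (f := X) (by simp)
  rw [hu, mul_assoc] at e2
  have h1 : (FieldPlace.laurent k).R (u * FieldPlace.expand (RingHom.id k) 0 (1 - X)) (1 * 1) := by
    refine FieldPlace.mul _ (by simpa using hur) ?_
    have := FieldPlace.expand_R (RingHom.id k) 0 (1 - X)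
    rwa [show (1 - X : k[X]).eval₂ (RingHom.id k) 0 = 1 by simp] at this
  rw [one_mul] at h1
  refine FieldPlace.not_evenUnit_of_uniformizer FieldPlace.laurent_single
    FieldPlace.single_ne_zero' FieldPlace.laurent_normal_form h1 one_ne_zero ?_
  rw [e2, map_pow]
  refine FieldPlace.EvenUnit.of_sq ?_
  intro h0
  have := mul_ne_zero FieldPlace.single_ne_zero' (FieldPlace.ne_zero h1 one_ne_zero)
  exact this (by rw [e2, map_pow, h0]; ring)

end Base

namespace FieldPlace

/-- The place of a valuation ring. -/
def ofValuationSubring {K : Type*} [Field K] (B : ValuationSubring K) :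
    FieldPlace K (IsLocalRing.ResidueField B) where
  R z c := ∃ h : z ∈ B, IsLocalRing.residue B ⟨z, h⟩ = c
  uniq := by
    rintro z c d ⟨h, rfl⟩ ⟨h', rfl⟩
    rfl
  one := ⟨B.one_mem, map_one _⟩
  add := by
    rintro z w c d ⟨h, rfl⟩ ⟨h', rfl⟩
    exact ⟨B.add_mem _ _ h h', by rw [← map_add]; rfl⟩
  mul := by
    rintro z w c d ⟨h, rfl⟩ ⟨h', rfl⟩
    exact ⟨B.mul_mem _ _ h h', by rw [← map_mul]; rfl⟩
  neg := by
    rintro z c ⟨h, rfl⟩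
    exact ⟨B.neg_mem _ h, by rw [← map_neg]; rfl⟩
  total z := by
    by_cases h : z ∈ B
    · exact Or.inl ⟨_, h, rfl⟩
    · have h' := (B.mem_or_inv_mem z).resolve_left h
      refine Or.inr ⟨h', ?_⟩
      rw [IsLocalRing.residue_eq_zero_iff, IsLocalRing.mem_maximalIdeal, mem_nonunits_iff]
      intro hu
      obtain ⟨w, hw⟩ := hu.exists_right_inv
      apply h
      have h1 : z⁻¹ * (w : K) = 1 := congrArg Subtype.val hw
      have h2 : (w : K) = z := by
        have hz : z ≠ 0 := by rintro rfl; simp at h1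
        field_simp at h1
        exact h1
      exact h2 ▸ w.2

/-- Specialisation of complex numbers: if every rational polynomial relation between the `c t`
holds between the `c₀ t`, then some place of `ℂ` maps every `c t` to `c₀ t`. -/
theorem exists_specialisation {σ : Type} (c : σ → ℂ) (c₀ : σ → ℤ)
    (h : ∀ G : MvPolynomial σ ℚ, MvPolynomial.aeval c G = 0 →
      MvPolynomial.aeval (fun t => (c₀ t : ℂ)) G = 0) :
    ∃ (k : Type) (_ : Field k) (_ : CharZero k) (P : FieldPlace ℂ k),
      (∀ t, P.R (c t) (c₀ t)) ∧ (∀ a : k, ∃ z, P.R z a) ∧ ∀ a : k, ∃ b, a = b ^ 2 := by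
  let φ : MvPolynomial σ ℚ →+* ℂ := (MvPolynomial.aeval c).toRingHom
  let φ₀ : MvPolynomial σ ℚ →+* ℂ := (MvPolynomial.aeval (fun t => (c₀ t : ℂ))).toRingHom
  let I : Ideal φ.range := (RingHom.ker φ₀).map φ.rangeRestrict
  have hI : I ≠ ⊤ := by
    rw [Ideal.ne_top_iff_one]
    intro h1
    obtain ⟨G, hG, hG1⟩ := (Ideal.mem_map_iff_of_surjective _
      φ.rangeRestrict_surjective).1 h1
    have h2 : φ (G - 1) = 0 := by
      have : φ G = 1 := congrArg Subtype.val hG1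
      rw [map_sub, this, map_one, sub_self]
    have h3 : φ₀ (G - 1) = 0 := h _ h2
    rw [map_sub, (RingHom.mem_ker).1 hG, map_one] at h3
    simp at h3
  obtain ⟨B, hB, hBI⟩ := Ideal.image_subset_nonunits_valuationSubring I hI
  have hrat : ∀ q : ℚ, (q : ℂ) ∈ B := fun q => hB ⟨MvPolynomial.C q, by simp [φ]⟩
  have hdiff : ∀ t, (ofValuationSubring B).R (c t - (c₀ t : ℂ)) 0 := by
    intro t
    have h1 : c t - (c₀ t : ℂ) ∈ B.nonunits := by
      apply hBI
      refine ⟨φ.rangeRestrict (MvPolynomial.X t - MvPolynomial.C (c₀ t : ℚ)),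
        Ideal.mem_map_of_mem _ ?_, ?_⟩
      · simp [RingHom.mem_ker, φ₀]
      · change φ (MvPolynomial.X t - MvPolynomial.C (c₀ t : ℚ)) = _
        simp [φ]
    obtain ⟨h2, h3⟩ := ValuationSubring.mem_nonunits_iff_exists_mem_maximalIdeal.1 h1
    exact ⟨h2, (IsLocalRing.residue_eq_zero_iff _).2 h3⟩
  have hchar : CharZero (IsLocalRing.ResidueField B) := by
    refine charZero_of_inj_zero fun n hn => ?_
    by_contra hn0
    have h1 : IsUnit (n : B) := by
      refine IsUnit.of_mul_eq_one ⟨((n : ℚ)⁻¹ : ℚ), hrat _⟩ ?_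
      apply Subtype.ext
      simp [hn0]
    have h2 := h1.map (IsLocalRing.residue B)
    rw [map_natCast, hn] at h2
    simp at h2
  have hlift : ∀ a : IsLocalRing.ResidueField B, ∃ z, (ofValuationSubring B).R z a := by
    intro a
    obtain ⟨z, rfl⟩ := IsLocalRing.residue_surjective a
    exact ⟨z, z.2, rfl⟩
  refine ⟨IsLocalRing.ResidueField B, inferInstance, hchar, ofValuationSubring B, fun t => ?_,
    hlift, fun a => ?_⟩
  · have h1 : (ofValuationSubring B).R (c₀ t : ℂ) (c₀ t) :=
      ⟨by simp, by rw [← map_intCast (IsLocalRing.residue B)]; rfl⟩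
    simpa using (ofValuationSubring B).add (hdiff t) h1
  · obtain ⟨z, hz⟩ := hlift a
    obtain ⟨w, rfl⟩ := IsAlgClosed.exists_pow_nat_eq z zero_lt_two
    rcases (ofValuationSubring B).total w with ⟨b, hb⟩ | hw
    · exact ⟨b, FieldPlace.uniq _ hz (pow hb 2)⟩
    · refine ⟨0, FieldPlace.uniq _ hz ?_⟩
      have h1 := (ofValuationSubring B).mul hz hw
      by_cases hw0 : w = 0
      · simpa [hw0] using (ofValuationSubring B).zero
      · have h2 := (ofValuationSubring B).mul h1 hw
        have h3 : w ^ 2 * w⁻¹ * w⁻¹ = 1 := by field_simp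
        rw [h3, mul_zero] at h2
        exact absurd (FieldPlace.uniq _ (ofValuationSubring B).one h2) one_ne_zero

end FieldPlace

namespace FieldPlace

open Polynomial

/-- Pseudo-division by a quadratic polynomial. -/
theorem exists_quadratic_remainder {W : Type*} [CommRing W] (α₀ α₁ α₂ : W) (g : W[X]) :
    ∃ (n : ℕ) (q : W[X]) (u v : W),
      C (α₂ ^ n) * g = (C α₂ * X ^ 2 + C α₁ * X + C α₀) * q + (C u + C v * X) := by
  induction g using Polynomial.induction_on with
  | C a => exact ⟨0, 0, a, 0, by simp⟩
  | add p q hp hq =>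
    obtain ⟨n, q, u, v, h⟩ := hp
    obtain ⟨n', q', u', v', h'⟩ := hq
    refine ⟨n + n', C (α₂ ^ n') * q + C (α₂ ^ n) * q', α₂ ^ n' * u + α₂ ^ n * u',
      α₂ ^ n' * v + α₂ ^ n * v', ?_⟩
    simp only [map_add, map_mul, map_pow] at h h' ⊢
    linear_combination C α₂ ^ n' * h + C α₂ ^ n * h'
  | monomial m a ih =>
    obtain ⟨n, q, u, v, h⟩ := ih
    refine ⟨n + 1, C α₂ * q * X + C v, -(v * α₀), α₂ * u - v * α₁, ?_⟩
    simp only [map_mul, map_pow, map_sub, map_neg] at h ⊢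
    linear_combination C α₂ * X * h

theorem eq_zero_of_quadratic_dvd {W : Type*} [CommRing W] [IsDomain W] {α₀ α₁ α₂ u v : W}
    (h2 : α₂ ≠ 0) (h : C α₂ * X ^ 2 + C α₁ * X + C α₀ ∣ C u + C v * X) : u = 0 ∧ v = 0 := by
  have h1 : C u + C v * X = 0 := by
    refine eq_zero_of_dvd_of_natDegree_lt h ?_
    rw [natDegree_quadratic h2]
    refine lt_of_le_of_lt ?_ one_lt_two
    compute_degree
  have e0 := congrArg (coeff · 0) h1
  have e1 := congrArg (coeff · 1) h1
  simp [coeff_X, coeff_C] at e0 e1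
  exact ⟨e0, e1⟩

variable {K k : Type*} [Field K] [Field k]

/-- A pair of polynomials with a nonzero member is a constant times a primitive pair. -/
theorem exists_primitive_pair (P : FieldPlace K k) {N : ℕ} (u v : MvPolynomial (Fin N) K)
    (h : u ≠ 0 ∨ v ≠ 0) : ∃ c : K, c ≠ 0 ∧ ∃ u' v' : MvPolynomial (Fin N) P.vs,
      u = MvPolynomial.C c * u'.map P.vs.subtype ∧ v = MvPolynomial.C c * v'.map P.vs.subtype ∧
      (u'.map P.res ≠ 0 ∨ v'.map P.res ≠ 0) := by
  by_cases hu : u = 0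
  · obtain ⟨c, hc, b, hb, hb'⟩ := P.exists_primitive_mv v (h.resolve_left (not_not.2 hu))
    exact ⟨c, hc, 0, b, by simp [hu], hb', Or.inr hb⟩
  by_cases hv : v = 0
  · obtain ⟨c, hc, b, hb, hb'⟩ := P.exists_primitive_mv u hu
    exact ⟨c, hc, b, 0, hb', by simp [hv], Or.inl hb⟩
  obtain ⟨c, hc, b, hb, hb'⟩ := P.exists_primitive_mv u hu
  obtain ⟨c', hc', b', hbb, hbb'⟩ := P.exists_primitive_mv v hv
  rcases P.vs.mem_or_inv_mem (c / c') with h | h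
  · refine ⟨c', hc', MvPolynomial.C ⟨_, h⟩ * b, b', ?_, hbb', Or.inr hbb⟩
    rw [hb', map_mul, MvPolynomial.map_C, ← mul_assoc, ← MvPolynomial.C_mul]
    congr 2
    change c = c' * (c / c')
    field_simp
  · refine ⟨c, hc, b, MvPolynomial.C ⟨_, h⟩ * b', hb', ?_, Or.inl hb⟩
    rw [hbb', map_mul, MvPolynomial.map_C, ← mul_assoc, ← MvPolynomial.C_mul]
    congr 2
    change c' = c * (c / c')⁻¹
    field_simp

/-- The place of the function field of a double cover of affine space that reduces to a
quadratic field extension. -/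
theorem exists_place_of_quadratic (P : FieldPlace K k) {F F₀ κ : Type*} [Field F] [Field F₀]
    [Field κ] {N : ℕ} (Φ : (MvPolynomial (Fin N) K)[X] →+* F)
    (α₀ α₁ α₂ : MvPolynomial (Fin N) P.vs)
    (hker : ∀ g, Φ g = 0 ↔ C (α₂.map P.vs.subtype) * X ^ 2 + C (α₁.map P.vs.subtype) * X
      + C (α₀.map P.vs.subtype) ∣ g)
    (hfrac : ∀ z, ∃ g h, Φ h ≠ 0 ∧ z * Φ h = Φ g)
    (ρ : MvPolynomial (Fin N) k →+* F₀) (hρ : Function.Injective ρ) (θ : F₀ →+* κ) (ζ : κ)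
    (hind : ∀ r s, θ r + θ s * ζ = 0 → r = 0 ∧ s = 0)
    (hroot : θ (ρ (α₂.map P.res)) * ζ ^ 2 + θ (ρ (α₁.map P.res)) * ζ + θ (ρ (α₀.map P.res)) = 0)
    (hα₂ : α₂.map P.res ≠ 0) :
    ∃ Q : FieldPlace F κ, (∀ z c, P.R z c →
        Q.R (Φ (C (MvPolynomial.C z))) (θ (ρ (MvPolynomial.C c)))) ∧
      (∀ i, Q.R (Φ (C (MvPolynomial.X i))) (θ (ρ (MvPolynomial.X i)))) ∧
      Q.SameValueGroup (Φ.comp (C.comp MvPolynomial.C)) := by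
  let inc : MvPolynomial (Fin N) P.vs →+* MvPolynomial (Fin N) K := MvPolynomial.map P.vs.subtype
  let red : MvPolynomial (Fin N) P.vs →+* F₀ := ρ.comp (MvPolynomial.map P.res)
  let j : (MvPolynomial (Fin N) P.vs)[X] →+* F := Φ.comp (mapRingHom inc)
  let ρ' : (MvPolynomial (Fin N) P.vs)[X] →+* κ := eval₂RingHom (θ.comp red) ζ
  have hinc : Function.Injective inc := MvPolynomial.map_injective _ Subtype.val_injective
  have hinc2 : inc α₂ ≠ 0 := by
    intro h
    rw [map_eq_zero_iff _ hinc] at h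
    exact hα₂ (by rw [h, map_zero])
  have hf : ρ' (C α₂ * X ^ 2 + C α₁ * X + C α₀) = 0 := by
    simpa [ρ', red] using hroot
  have hjf : j (C α₂ * X ^ 2 + C α₁ * X + C α₀) = 0 := by
    simp only [j, RingHom.comp_apply, hker]
    simp [inc]
  have hρ2 : ρ' (C α₂) ≠ 0 := by
    simp only [ρ', coe_eval₂RingHom, eval₂_C, RingHom.comp_apply, red]
    rw [_root_.map_ne_zero, map_ne_zero_iff _ hρ]
    exact hα₂
  have hlin : ∀ u v : MvPolynomial (Fin N) P.vs, Φ (C (inc u) + C (inc v) * X) = 0 → u = 0 ∧ v = 0 := by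
    intro u v h
    obtain ⟨h1, h2⟩ := eq_zero_of_quadratic_dvd hinc2 ((hker _).1 h)
    exact ⟨(map_eq_zero_iff _ hinc).1 h1, (map_eq_zero_iff _ hinc).1 h2⟩
  have hnum : ∀ g, Φ g ≠ 0 → ∃ c : K, c ≠ 0 ∧ ∃ b s, ρ' b ≠ 0 ∧ ρ' s ≠ 0 ∧
      Φ g * j s = Φ (C (MvPolynomial.C c)) * j b := by
    intro g hg
    obtain ⟨n, q, u, v, h⟩ := exists_quadratic_remainder (inc α₀) (inc α₁) (inc α₂) g
    have h1 : Φ (C (inc α₂ ^ n)) * Φ g = Φ (C u + C v * X) := by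
      rw [← map_mul, h, map_add, map_mul, (hker _).2 dvd_rfl]
      simp
    have hΦ2 : Φ (C (inc α₂ ^ n)) ≠ 0 := by
      rw [map_pow, map_pow]
      refine pow_ne_zero n fun h => ?_
      have := hlin α₂ 0 (by simpa using h)
      exact hα₂ (by rw [this.1, map_zero])
    obtain ⟨c, hc, u', v', hu, hv, huv⟩ := P.exists_primitive_pair u v (by
      by_contra! h0
      rw [h0.1, h0.2] at h1
      simp [hg] at h1
      exact hΦ2 (by simpa using h1))
    refine ⟨c, hc, C u' + C v' * X, C (α₂ ^ n), ?_, ?_, ?_⟩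
    · intro h0
      simp only [ρ', coe_eval₂RingHom, eval₂_C, eval₂_add, eval₂_mul, eval₂_X,
        RingHom.comp_apply] at h0
      obtain ⟨h3, h4⟩ := hind _ _ h0
      simp only [red, RingHom.comp_apply, map_eq_zero_iff _ hρ] at h3 h4
      tauto
    · rw [map_pow, map_pow]
      exact pow_ne_zero n hρ2
    · have : j (C (α₂ ^ n)) = Φ (C (inc α₂ ^ n)) := by simp [j]
      rw [this, mul_comm, h1, hu, hv]
      simp [j, inc]
      ring
  have h0 : ∀ a, j a = 0 → ρ' a = 0 := by
    intro a ha
    obtain ⟨n, q, u, v, h⟩ := exists_quadratic_remainder α₀ α₁ α₂ a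
    have h1 := congrArg j h
    rw [map_mul, ha, map_add, map_mul j, hjf, mul_zero, zero_mul, zero_add] at h1
    obtain ⟨rfl, rfl⟩ := hlin u v (by simpa [j, inc] using h1.symm)
    have h2 := congrArg ρ' h
    rw [map_mul, map_add, map_mul ρ', hf, map_pow, map_pow] at h2
    simpa [hρ2] using h2
  have hV : ∀ c ∈ P.vs, ∃ a, j a = (Φ.comp (C.comp MvPolynomial.C)) c ∧
      (P.R c 0 → ρ' a = 0) := by
    intro c hc
    refine ⟨C (MvPolynomial.C ⟨c, hc⟩), by simp [j, inc], fun h => ?_⟩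
    have : P.res ⟨c, hc⟩ = 0 := res_eq (z := ⟨c, hc⟩) h
    simp [ρ', red, this]
  have hU : ∀ z : F, z ≠ 0 → ∃ c : K, c ≠ 0 ∧ ∃ b s, ρ' b ≠ 0 ∧ ρ' s ≠ 0 ∧
      z * j s = (Φ.comp (C.comp MvPolynomial.C)) c * j b := by
    intro z hz
    obtain ⟨g, h, hh, hz'⟩ := hfrac z
    obtain ⟨c, hc, b, s, hb, hs, e⟩ := hnum h hh
    obtain ⟨c', hc', b', s', hb', hs', e'⟩ := hnum g (by rw [← hz']; exact mul_ne_zero hz hh)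
    have hcc : (Φ.comp (C.comp MvPolynomial.C)) c ≠ 0 := (_root_.map_ne_zero _).2 hc
    refine ⟨c' / c, div_ne_zero hc' hc, b' * s, b * s', by simp [hb', hs], by simp [hb, hs'], ?_⟩
    rw [map_div₀, map_mul, map_mul, div_mul_eq_mul_div, eq_div_iff hcc]
    simp only [RingHom.comp_apply]
    linear_combination z * j s' * e.symm + j s * e' + j s * j s' * hz'
  obtain ⟨Q, hQ, hS⟩ := P.exists_extend (L := F) (κ := κ) (A := (MvPolynomial (Fin N) P.vs)[X])
    (Φ.comp (C.comp MvPolynomial.C)) j ρ' h0 hV hU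
  refine ⟨Q, fun z c h => ?_, fun i => ?_, hS⟩
  · have h1 := hQ (C (MvPolynomial.C ⟨z, ⟨c, h⟩⟩))
    have h2 : P.res ⟨z, ⟨c, h⟩⟩ = c := res_eq (z := ⟨z, _⟩) h
    simpa [j, ρ', inc, red, h2] using h1
  · simpa [j, ρ', inc, red] using hQ (C (MvPolynomial.X i))

end FieldPlace

namespace FieldPlace

open MvPolynomial

variable {K k : Type*} [Field K] [Field k]

/-- A polynomial whose coefficients specialise to integers lifts to the valuation ring. -/
theorem exists_lift (P : FieldPlace K k) {τ : Type*} {p : MvPolynomial τ K} {p₀ : MvPolynomial τ ℤ}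
    (h : ∀ s, P.R (coeff s p) (coeff s p₀ : ℤ)) : ∃ q : MvPolynomial τ P.vs,
      q.map P.vs.subtype = p ∧ q.map P.res = p₀.map (Int.castRingHom k) := by
  have hp : p ∈ Set.range (map P.vs.subtype) := by
    rw [mem_range_map_iff_coeffs_subset]
    intro a ha
    obtain ⟨s, -, rfl⟩ := mem_coeffs_iff.1 ha
    exact ⟨⟨_, ⟨_, h s⟩⟩, rfl⟩
  obtain ⟨q, rfl⟩ := hp
  refine ⟨q, rfl, ?_⟩
  ext s
  have := h s
  rw [coeff_map] at this
  rw [coeff_map, coeff_map, res_eq this]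
  rfl

variable {L κ : Type*} [Field L] [Field κ]

theorem R_eval₂ {P : FieldPlace K k} {Q : FieldPlace L κ} {ι : K →+* L} {ι₀ : k →+* κ}
    (hι : ∀ z c, P.R z c → Q.R (ι z) (ι₀ c)) {τ : Type*} {p : MvPolynomial τ K}
    {p₀ : MvPolynomial τ ℤ} (h : ∀ s, P.R (coeff s p) (coeff s p₀ : ℤ)) {v : τ → L} {v' : τ → κ}
    (hv : ∀ i, Q.R (v i) (v' i)) : Q.R (eval₂ ι v p) (aeval v' p₀) := by
  obtain ⟨q, rfl, hq⟩ := P.exists_lift h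
  have h1 : aeval v' p₀ = eval₂ ι₀ v' (p₀.map (Int.castRingHom k)) := by
    rw [eval₂_map, RingHom.ext_int (ι₀.comp _) (algebraMap ℤ κ)]
    rfl
  rw [h1, ← hq, eval₂_map, eval₂_map]
  clear hq h h1
  induction q using MvPolynomial.induction_on with
  | C a => simpa using hι _ _ (P.R_res a)
  | add p q hp hq => simpa only [eval₂_add] using Q.add hp hq
  | mul_X p i hp => simpa only [eval₂_mul, eval₂_X] using Q.mul hp (hv i)

theorem R_sum {Q : FieldPlace L κ} {τ : Type*} (s : Finset τ) {f : τ → L} {g : τ → κ}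
    (h : ∀ i, Q.R (f i) (g i)) : Q.R (∑ i ∈ s, f i) (∑ i ∈ s, g i) := by
  classical
  induction s using Finset.induction_on with
  | empty => simpa using Q.zero
  | insert a s ha ih =>
    rw [Finset.sum_insert ha, Finset.sum_insert ha]
    exact Q.add (h a) ih

/-- A nontrivial zero of a quadratic form over `L` specialises to a nontrivial zero. -/
theorem exists_reduced_zero (Q : FieldPlace L κ) {n : ℕ} {B : Fin n → Fin n → L}
    {b : Fin n → Fin n → κ} (hB : ∀ i j, Q.R (B i j) (b i j)) (z : Fin n → L) (hz : z ≠ 0)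
    (h : ∑ i, ∑ j, B i j * z i * z j = 0) :
    ∃ w : Fin n → κ, w ≠ 0 ∧ ∑ i, ∑ j, b i j * w i * w j = 0 := by
  obtain ⟨i₀, hi₀⟩ := Function.ne_iff.1 hz
  obtain ⟨i, -, hi, hk⟩ := Q.exists_content Finset.univ z ⟨i₀, Finset.mem_univ _, hi₀⟩
  choose w hw using fun k => hk k (Finset.mem_univ k)
  refine ⟨w, fun h0 => ?_, ?_⟩
  · have h1 := hw i
    rw [div_self hi, h0] at h1
    exact one_ne_zero (Q.uniq Q.one h1)
  · refine (Q.uniq (R_sum _ fun a => R_sum _ fun c =>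
      Q.mul (Q.mul (hB a c) (hw a)) (hw c)) ?_)
    have : ∑ a, ∑ c, B a c * (z a / z i) * (z c / z i) = 0 := by
      rw [← mul_zero ((z i ^ 2)⁻¹), ← h, Finset.mul_sum]
      refine Finset.sum_congr rfl fun a _ => ?_
      rw [Finset.mul_sum]
      refine Finset.sum_congr rfl fun c _ => ?_
      field_simp
    rw [this]
    exact Q.zero

end FieldPlace

section SpecialForms

variable {R : Type*} [CommRing R]

/-- The first special quadratic form; `M i j m n` stands for `x ^ m * y ^ n` in the entry
`(i, j)`. -/
def specialFormOne (M : Fin 4 → Fin 4 → ℕ → ℕ → R) : Fin 4 → Fin 4 → R :=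
  ![![M 0 0 0 0, 0, 0, 0],
    ![0, M 1 1 1 0 - M 1 1 0 0, M 1 2 0 1 - M 1 2 1 1, 0],
    ![0, M 2 1 0 1 - M 2 1 1 1, -M 2 2 1 0, 0],
    ![0, 0, 0, M 3 3 2 0 - M 3 3 1 2 + M 3 3 2 2]]

/-- The second special quadratic form; `M i j m n` stands for `x ^ m * y ^ n` in the entry
`(i, j)`. -/
def specialFormTwo (M : Fin 4 → Fin 4 → ℕ → ℕ → R) : Fin 4 → Fin 4 → R :=
  ![![M 0 0 0 0, 0, M 0 2 0 1, M 0 3 0 1 - M 0 3 1 1],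
    ![0, M 1 1 1 0 - M 1 1 0 0, 0, 0],
    ![M 2 0 0 1, 0, M 2 2 1 0 + M 2 2 1 2, M 2 3 1 0],
    ![M 3 0 0 1 - M 3 0 1 1, 0, M 3 2 1 0, M 3 3 1 0 - M 3 3 2 0]]

theorem FieldPlace.iso_of_specialFormOne {E : Type*} [Field E] {x y : E} (hx : x ≠ 0)
    (w : Fin 4 → E) (hw : w ≠ 0)
    (h : ∑ i, ∑ j, specialFormOne (fun _ _ m n => x ^ m * y ^ n) i j * w i * w j = 0) :
    Iso x y := by
  refine Or.inr ⟨x * w 2 - (1 - x) * y * w 1, w 0, x * w 3, w 1, ?_, ?_⟩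
  · simp [Fin.sum_univ_four, specialFormOne] at h
    simp only [disc]
    linear_combination -x * h
  · by_contra! h0
    obtain ⟨h1, h2, h3, h4⟩ := h0
    rw [h4, mul_zero, sub_zero] at h1
    apply hw
    ext i
    fin_cases i <;> simp_all

theorem FieldPlace.iso_of_specialFormTwo {E : Type*} [Field E] {x y : E} (hx : x ≠ 0)
    (w : Fin 4 → E) (hw : w ≠ 0)
    (h : ∑ i, ∑ j, specialFormTwo (fun _ _ m n => x ^ m * y ^ n) i j * w i * w j = 0) :
    Iso x y := by
  by_cases hx1 : x = 1
  · exact Or.inl hx1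
  have hg : 1 - x ≠ 0 := sub_ne_zero.2 (Ne.symm hx1)
  refine Or.inr ⟨x * (1 - x) * w 3 + (1 - x) * y * w 0 + x * w 2, (1 - x) * w 1, x * w 2, w 0,
    ?_, ?_⟩
  · simp [Fin.sum_univ_four, specialFormTwo] at h
    simp only [disc]
    linear_combination x * (1 - x) * h
  · by_contra! h0
    obtain ⟨h1, h2, h3, h4⟩ := h0
    rw [h4, h3] at h1
    apply hw
    ext i
    fin_cases i <;> simp_all

/-- The bihomogeneous monomial of bidegree `(D, E)` that dehomogenises to `x ^ m * y ^ n`. -/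
noncomputable def biMonomial (D E m n : ℕ) : MvPolynomial (Fin 4) ℤ :=
  MvPolynomial.X 0 ^ (D - m) * MvPolynomial.X 1 ^ m * MvPolynomial.X 2 ^ (E - n) *
    MvPolynomial.X 3 ^ n

theorem aeval_biMonomial (x y : R) (D E m n : ℕ) :
    MvPolynomial.aeval ![1, x, 1, y] (biMonomial D E m n) = x ^ m * y ^ n := by
  simp [biMonomial]

theorem map_specialFormOne {S : Type*} [CommRing S] (f : R →+* S)
    (M : Fin 4 → Fin 4 → ℕ → ℕ → R) (i j : Fin 4) :
    f (specialFormOne M i j) = specialFormOne (fun i j m n => f (M i j m n)) i j := by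
  fin_cases i <;> fin_cases j <;> simp [specialFormOne]

theorem map_specialFormTwo {S : Type*} [CommRing S] (f : R →+* S)
    (M : Fin 4 → Fin 4 → ℕ → ℕ → R) (i j : Fin 4) :
    f (specialFormTwo M i j) = specialFormTwo (fun i j m n => f (M i j m n)) i j := by
  fin_cases i <;> fin_cases j <;> simp [specialFormTwo]

end SpecialForms

section QuadraticExpansion

variable {S : Type*} [CommRing S]

theorem quadratic_expand (B : Fin 4 → Fin 4 → S) (u : Fin 4 → S) (t : Fin 4) (z : S) :
    ∑ i, ∑ j, B i j * (u i + if i = t then z else 0) * (u j + if j = t then z else 0) =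
      B t t * z ^ 2 + (∑ i, (B i t + B t i) * u i) * z + ∑ i, ∑ j, B i j * u i * u j := by
  have h : ∀ i j, B i j * (u i + if i = t then z else 0) * (u j + if j = t then z else 0) =
      B i j * u i * u j + (if j = t then B i j * u i * z else 0) +
      (if i = t then B i j * u j * z else 0) +
      (if i = t then (if j = t then B i j * z ^ 2 else 0) else 0) := by
    intro i j
    split_ifs <;> ring
  simp only [h, Finset.sum_add_distrib, Finset.sum_ite_eq', Finset.sum_mul, add_mul,
    Finset.mem_univ, if_true]
  have h1 : ∑ i, ∑ j, (if i = t then B i j * u j * z else 0) = ∑ j, B t j * u j * z := by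
    rw [Finset.sum_comm]
    simp
  have h2 : ∑ i, ∑ j, (if i = t then (if j = t then B i j * z ^ 2 else 0) else 0) =
      B t t * z ^ 2 := by
    rw [Finset.sum_comm]
    simp
  rw [h1, h2]
  ring

end QuadraticExpansion

namespace FieldPlace

open MvPolynomial

/-- Dehomogenisation, keeping the last two of four variables as base coordinates. -/
noncomputable def dehom (R : Type*) [CommRing R] :
    MvPolynomial (Fin 4) R →+* MvPolynomial (Fin 4) R :=
  (aeval ![1, X 2, 1, X 3]).toRingHom

theorem map_dehom {R S : Type*} [CommRing R] [CommRing S] (f : R →+* S)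
    (p : MvPolynomial (Fin 4) R) : (dehom R p).map f = dehom S (p.map f) := by
  simp only [dehom]
  induction p using MvPolynomial.induction_on with
  | C a => simp
  | add p q hp hq => simp_all
  | mul_X p i hp =>
    simp_all only [map_mul, AlgHom.toRingHom_eq_coe, RingHom.coe_coe, aeval_X, map_X]
    congr 1
    fin_cases i <;> simp

theorem map_dehom_int {k κ : Type*} [Field k] [CommRing κ] (f : MvPolynomial (Fin 4) k →+* κ)
    (p : MvPolynomial (Fin 4) ℤ) :
    f (dehom k (p.map (Int.castRingHom k))) = aeval ![1, f (X 2), 1, f (X 3)] p := by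
  have h : f.comp ((dehom k).comp (map (Int.castRingHom k))) =
      (aeval (R := ℤ) ![1, f (X 2), 1, f (X 3)]).toRingHom := by
    refine ringHom_ext (fun n => by simp) fun i => ?_
    fin_cases i <;> simp [dehom]
  exact RingHom.congr_fun h p

theorem map_dehomP1P1
    (Ψ : MvPolynomial (Fin 5) ℂ →+* Polynomial (MvPolynomial (Fin 4) ℂ))
    (hC : ∀ c, Ψ (C c) = Polynomial.C (C c)) (h0 : Ψ (X 0) = Polynomial.C (X 2))
    (h1 : Ψ (X 1) = Polynomial.C (X 3)) (p : MvPolynomial (Fin 4) ℂ) :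
    Ψ (dehomP1P1 p) = Polynomial.C (dehom ℂ p) := by
  have h : Ψ.comp dehomP1P1 = Polynomial.C.comp (dehom ℂ) := by
    refine ringHom_ext (fun c => ?_) fun i => ?_
    · simp [dehom, dehomP1P1, hC]
    · fin_cases i <;> simp [dehom, dehomP1P1, h0, h1]
  exact RingHom.congr_fun h p

variable {k : Type*} [Field k]

/-- The quotient map onto the coordinate ring of the affine chart. -/
noncomputable def chartMk (A : Fin 4 → Fin 4 → MvPolynomial (Fin 4) ℂ) :
    MvPolynomial (Fin 5) ℂ →+* p1p1BundleChartRing A :=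
  Ideal.Quotient.mk _

theorem chartMk_surjective (A : Fin 4 → Fin 4 → MvPolynomial (Fin 4) ℂ) :
    Function.Surjective (chartMk A) :=
  Ideal.Quotient.mk_surjective

theorem chartMk_eq_zero {A : Fin 4 → Fin 4 → MvPolynomial (Fin 4) ℂ}
    {p : MvPolynomial (Fin 5) ℂ} : chartMk A p = 0 ↔ p1p1BundleChartPoly A ∣ p := by
  rw [← Ideal.mem_span_singleton]
  exact Ideal.Quotient.eq_zero_iff_mem

/-- The place of the function field of a quadric surface bundle induced by a place of the
constants for which the defining equation acquires a conic-bundle-like special fibre. -/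
theorem exists_place_functionField (P : FieldPlace ℂ k)
    {A : Fin 4 → Fin 4 → MvPolynomial (Fin 4) ℂ} {A₀ : Fin 4 → Fin 4 → MvPolynomial (Fin 4) ℤ}
    (hA : ∀ i j s, P.R (coeff s (A i j)) (coeff s (A₀ i j) : ℤ))
    [IsDomain (p1p1BundleChartRing A)] (π : Fin 5 ≃ Fin 5) (t : Fin 4)
    (u : Fin 4 → MvPolynomial (Fin 4) ℤ) (hπ0 : π 0 = Fin.succ 2) (hπ1 : π 1 = Fin.succ 3)
    (hu : ∀ i, finSuccEquiv ℂ 4 (rename π ((![1, X 2, X 3, X 4] : Fin 4 → _) i)) =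
      Polynomial.C ((u i).map (Int.castRingHom ℂ)) + if i = t then Polynomial.X else 0)
    {F₀ κ : Type*} [Field F₀] [Field κ] (ρ : MvPolynomial (Fin 4) k →+* F₀)
    (hρ : Function.Injective ρ) (θ : F₀ →+* κ) (ζ : κ)
    (hind : ∀ r s, θ r + θ s * ζ = 0 → r = 0 ∧ s = 0)
    (hroot : ∑ i, ∑ j, aeval ![1, θ (ρ (X 2)), 1, θ (ρ (X 3))] (A₀ i j) *
      (θ (ρ ((u i).map (Int.castRingHom k))) + if i = t then ζ else 0) *
      (θ (ρ ((u j).map (Int.castRingHom k))) + if j = t then ζ else 0) = 0)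
    (hlead : aeval ![1, θ (ρ (X 2)), 1, θ (ρ (X 3))] (A₀ t t) ≠ 0) :
    ∃ Q : FieldPlace (FractionRing (p1p1BundleChartRing A)) κ,
      (∀ z c, P.R z c → Q.R (p1p1BundleFFMap A z) (θ (ρ (C c)))) ∧
      Q.R (algebraMap (p1p1BundleChartRing A) _ (chartMk A (X 0))) (θ (ρ (X 2))) ∧
      Q.R (algebraMap (p1p1BundleChartRing A) _ (chartMk A (X 1))) (θ (ρ (X 3))) ∧
      Q.SameValueGroup (p1p1BundleFFMap A) := by
  choose A' hA' hA'' using fun i j => P.exists_lift (hA i j)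
  obtain ⟨Ψ, hΨ⟩ : ∃ Ψ : MvPolynomial (Fin 5) ℂ ≃+* Polynomial (MvPolynomial (Fin 4) ℂ),
      ∀ p, Ψ p = finSuccEquiv ℂ 4 (rename π p) :=
    ⟨((renameEquiv ℂ π).trans (finSuccEquiv ℂ 4)).toRingEquiv, fun p => rfl⟩
  have hΨC : ∀ c, Ψ (C c) = Polynomial.C (C c) := by
    intro c
    rw [hΨ, rename_C, finSuccEquiv_apply]
    simp
  have hΨ0 : Ψ (X 0) = Polynomial.C (X 2) := by rw [hΨ, rename_X, hπ0, finSuccEquiv_X_succ]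
  have hΨ1 : Ψ (X 1) = Polynomial.C (X 3) := by rw [hΨ, rename_X, hπ1, finSuccEquiv_X_succ]
  let B : Fin 4 → Fin 4 → MvPolynomial (Fin 4) P.vs := fun i j => dehom _ (A' i j)
  let v : Fin 4 → MvPolynomial (Fin 4) P.vs := fun i => (u i).map (Int.castRingHom _)
  have hvK : ∀ i, (v i).map P.vs.subtype = (u i).map (Int.castRingHom ℂ) := by
    intro i
    rw [map_map, RingHom.ext_int (P.vs.subtype.comp _) (Int.castRingHom ℂ)]
  have hvk : ∀ i, (v i).map P.res = (u i).map (Int.castRingHom k) := by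
    intro i
    rw [map_map, RingHom.ext_int (P.res.comp _) (Int.castRingHom k)]
  have hBk : ∀ i j, θ (ρ ((B i j).map P.res)) = aeval ![1, θ (ρ (X 2)), 1, θ (ρ (X 3))] (A₀ i j) := by
    intro i j
    rw [map_dehom, hA'']
    exact map_dehom_int (θ.comp ρ) _
  have hBK : ∀ i j, Ψ (dehomP1P1 (A i j)) = Polynomial.C ((B i j).map P.vs.subtype) := by
    intro i j
    rw [map_dehom, hA']
    exact map_dehomP1P1 (Ψ : _ →+* _) hΨC hΨ0 hΨ1 _
  have hΨA : Ψ (p1p1BundleChartPoly A) =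
      Polynomial.C ((B t t).map P.vs.subtype) * Polynomial.X ^ 2 +
      Polynomial.C ((∑ i, (B i t + B t i) * v i).map P.vs.subtype) * Polynomial.X +
      Polynomial.C ((∑ i, ∑ j, B i j * v i * v j).map P.vs.subtype) := by
    rw [p1p1BundleChartPoly]
    simp only [map_sum, map_mul, hBK]
    simp only [hΨ, hu]
    rw [quadratic_expand]
    simp only [map_add, hvK, B]
  obtain ⟨Φ, hΦΨ⟩ : ∃ Φ : Polynomial (MvPolynomial (Fin 4) ℂ) →+*
      FractionRing (p1p1BundleChartRing A), ∀ p, Φ (Ψ p) =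
        algebraMap (p1p1BundleChartRing A) _ (chartMk A p) :=
    ⟨(algebraMap (p1p1BundleChartRing A) _).comp
      ((chartMk A).comp (Ψ.symm : _ →+* _)),
      fun p => by simp⟩
  have hΦC : Φ.comp (Polynomial.C.comp C) = p1p1BundleFFMap A := by
    ext c
    rw [RingHom.comp_apply, RingHom.comp_apply, ← hΨC, hΦΨ]
    rfl
  have hker : ∀ g, Φ g = 0 ↔ Polynomial.C ((B t t).map P.vs.subtype) * Polynomial.X ^ 2 +
      Polynomial.C ((∑ i, (B i t + B t i) * v i).map P.vs.subtype) * Polynomial.X +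
      Polynomial.C ((∑ i, ∑ j, B i j * v i * v j).map P.vs.subtype) ∣ g := by
    intro g
    rw [← hΨA]
    obtain ⟨p, rfl⟩ := Ψ.surjective g
    rw [hΦΨ, map_eq_zero_iff _ (IsFractionRing.injective (p1p1BundleChartRing A) _), map_dvd_iff,
      chartMk_eq_zero]
  have hfrac : ∀ z, ∃ g h, Φ h ≠ 0 ∧ z * Φ h = Φ g := by
    intro z
    obtain ⟨a, b, hb, rfl⟩ := IsFractionRing.div_surjective (A := p1p1BundleChartRing A) z
    have hb' := IsFractionRing.to_map_ne_zero_of_mem_nonZeroDivisors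
      (K := FractionRing (p1p1BundleChartRing A)) hb
    obtain ⟨a, rfl⟩ := chartMk_surjective A a
    obtain ⟨b, rfl⟩ := chartMk_surjective A b
    refine ⟨Ψ a, Ψ b, ?_, ?_⟩
    · rwa [hΦΨ]
    · rw [hΦΨ, hΦΨ]
      exact div_mul_cancel₀ _ hb'
  have hroot' : θ (ρ ((B t t).map P.res)) * ζ ^ 2 +
      θ (ρ ((∑ i, (B i t + B t i) * v i).map P.res)) * ζ +
      θ (ρ ((∑ i, ∑ j, B i j * v i * v j).map P.res)) = 0 := by
    rw [← hroot, quadratic_expand]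
    simp only [map_sum, map_mul, map_add, hvk, hBk]
  have hlead' : (B t t).map P.res ≠ 0 := by
    intro h
    rw [← hBk, h] at hlead
    simp at hlead
  obtain ⟨Q, h1, h2, h3⟩ := P.exists_place_of_quadratic Φ (∑ i, ∑ j, B i j * v i * v j)
    (∑ i, (B i t + B t i) * v i) (B t t) hker hfrac ρ hρ θ ζ hind hroot' hlead'
  rw [hΦC] at h3
  refine ⟨Q, fun z c h => ?_, ?_, ?_, h3⟩
  · rw [← hΦC]
    exact h1 z c h
  · have := h2 2
    rw [← hΨ0, hΦΨ] at this
    exact this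
  · have := h2 3
    rw [← hΨ1, hΦΨ] at this
    exact this

end FieldPlace

namespace FieldPlace

open MvPolynomial

theorem exists_injective_ratFunc {k E : Type*} [Field k] [Field E] {n : ℕ}
    (f : MvPolynomial (Fin n) k →+* E) (hf : Function.Injective f) :
    ∃ g : MvPolynomial (Fin (n + 1)) k →+* RatFunc E, Function.Injective g ∧
      g (X 0) = RatFunc.X ∧ (∀ i : Fin n, g (X i.succ) = RatFunc.C (f (X i))) := by
  refine ⟨(algebraMap (Polynomial E) (RatFunc E)).comp ((Polynomial.mapRingHom f).comp
    (finSuccEquiv k n : _ →+* _)), ?_, ?_, ?_⟩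
  · exact (IsFractionRing.injective (Polynomial E) (RatFunc E)).comp
      ((Polynomial.map_injective f hf).comp (finSuccEquiv k n).injective)
  · simp [finSuccEquiv_X_zero]
  · intro i
    simp [finSuccEquiv_X_succ]

/-- Two independent transcendentals in an iterated rational function field. -/
theorem exists_injective_ratFunc_two {k E : Type*} [Field k] [Field E] {n : ℕ}
    (f : MvPolynomial (Fin n) k →+* E) (hf : Function.Injective f) :
    ∃ g : MvPolynomial (Fin (n + 2)) k →+* RatFunc (RatFunc E), Function.Injective g ∧
      g (X 0) = RatFunc.X ∧ g (X 1) = RatFunc.C (RatFunc.X : RatFunc E) ∧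
      ∀ i : Fin n, g (X i.succ.succ) = RatFunc.C (RatFunc.C (f (X i))) := by
  obtain ⟨g₁, hg₁, h₁, s₁⟩ := exists_injective_ratFunc f hf
  obtain ⟨g₂, hg₂, h₂, s₂⟩ := exists_injective_ratFunc g₁ hg₁
  refine ⟨g₂, hg₂, h₂, (s₂ 0).trans (by rw [h₁]), fun i => ?_⟩
  rw [s₂, s₁]

/-- A place of the function field onto a field over which the residue conic stays nonsplit. -/
def HasNonsplitPlace {k : Type} [Field k] (P : FieldPlace ℂ k)
    (A : Fin 4 → Fin 4 → MvPolynomial (Fin 4) ℂ) [IsDomain (p1p1BundleChartRing A)] : Prop :=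
  ∃ (κ : Type) (_ : Field κ) (_ : CharZero κ) (θ : k →+* κ)
    (Q : FieldPlace (FractionRing (p1p1BundleChartRing A)) κ) (x y : κ),
    (∀ z c, P.R z c → Q.R (p1p1BundleFFMap A z) (θ c)) ∧
    Q.R (algebraMap (p1p1BundleChartRing A) _ (chartMk A (X 0))) x ∧
    Q.R (algebraMap (p1p1BundleChartRing A) _ (chartMk A (X 1))) y ∧
    Q.SameValueGroup (p1p1BundleFFMap A) ∧ x ≠ 0 ∧ disc x y ≠ 0 ∧ ¬ Spl x (disc x y)

theorem hasNonsplitPlace_of_root {k K κ : Type} [Field k] [Field K] [Field κ]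
    (P : FieldPlace ℂ k)
    {A : Fin 4 → Fin 4 → MvPolynomial (Fin 4) ℂ} {A₀ : Fin 4 → Fin 4 → MvPolynomial (Fin 4) ℤ}
    (hA : ∀ i j s, P.R (coeff s (A i j)) (coeff s (A₀ i j) : ℤ))
    [IsDomain (p1p1BundleChartRing A)] (π : Fin 5 ≃ Fin 5) (t : Fin 4)
    (u : Fin 4 → MvPolynomial (Fin 4) ℤ) (hπ0 : π 0 = Fin.succ 2) (hπ1 : π 1 = Fin.succ 3)
    (hu : ∀ i, finSuccEquiv ℂ 4 (rename π ((![1, X 2, X 3, X 4] : Fin 4 → _) i)) =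
      Polynomial.C ((u i).map (Int.castRingHom ℂ)) + if i = t then Polynomial.X else 0)
    (f : MvPolynomial (Fin 2) k →+* K) (hf : Function.Injective f)
    (w₁ w₂ : RatFunc (RatFunc K)) (hw₂ : w₂ ≠ 0)
    (θ : RatFunc (RatFunc K) →+* κ) (s : κ) (hs : ∀ r r', θ r + θ r' * s = 0 → r = 0 ∧ r' = 0)
    {x y : κ} (hx : θ (RatFunc.C (RatFunc.C (f (X 0)))) = x)
    (hy : θ (RatFunc.C (RatFunc.C (f (X 1)))) = y)
    (hlead : aeval ![1, x, 1, y] (A₀ t t) ≠ 0)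
    (hroot : ∀ v : Fin 4 → κ, (∀ i, v i = aeval ![θ RatFunc.X, θ (RatFunc.C RatFunc.X), x, y]
          (u i) + if i = t then θ w₁ + θ w₂ * s else 0) →
      ∑ i, ∑ j, aeval ![1, x, 1, y] (A₀ i j) * v i * v j = 0) [CharZero κ]
    (hx0 : x ≠ 0) (hd : disc x y ≠ 0) (key : ¬ Spl x (disc x y)) :
    HasNonsplitPlace P A := by
  obtain ⟨ρ, hρ, h0, h1, h23⟩ := exists_injective_ratFunc_two f hf
  have h2 : θ (ρ (X 2)) = x := hx ▸ congrArg θ (h23 0)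
  have h3 : θ (ρ (X 3)) = y := hy ▸ congrArg θ (h23 1)
  have hu' : ∀ i, θ (ρ ((u i).map (Int.castRingHom k))) = aeval ![θ RatFunc.X,
      θ (RatFunc.C RatFunc.X), x, y] (u i) := by
    intro i
    have h : (θ.comp ρ).comp (map (Int.castRingHom k)) = (aeval (R := ℤ) ![θ RatFunc.X,
      θ (RatFunc.C RatFunc.X), x, y]).toRingHom := by
      refine ringHom_ext (fun n => by simp) fun i => ?_
      fin_cases i <;> simp [h0, h1, h2, h3]
    exact RingHom.congr_fun h (u i)
  obtain ⟨Q, hc, hQx, hQy, hQ⟩ := P.exists_place_functionField hA π t u hπ0 hπ1 hu ρ hρ θ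
    (θ w₁ + θ w₂ * s) (fun r r' h => by
      obtain ⟨ha, hb⟩ := hs (r + r' * w₁) (r' * w₂) (by rw [← h]; simp only [map_add, map_mul]; ring)
      have hr' := (mul_eq_zero.1 hb).resolve_right hw₂
      exact ⟨by simpa [hr'] using ha, hr'⟩) (by
      simp only [h2, h3, hu']
      exact hroot _ fun i => rfl) (by
      simp only [h2, h3]
      exact hlead)
  rw [h2] at hQx
  rw [h3] at hQy
  exact ⟨κ, inferInstance, inferInstance, (θ.comp ρ).comp C, Q, x, y, hc, hQx, hQy, hQ,
    hx0, hd, key⟩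

theorem hasNonsplitPlace_of_form {k K : Type} [Field k] [Field K] [CharZero K]
    (P : FieldPlace ℂ k)
    {A : Fin 4 → Fin 4 → MvPolynomial (Fin 4) ℂ} {A₀ : Fin 4 → Fin 4 → MvPolynomial (Fin 4) ℤ}
    (hA : ∀ i j s, P.R (coeff s (A i j)) (coeff s (A₀ i j) : ℤ))
    [IsDomain (p1p1BundleChartRing A)] (π : Fin 5 ≃ Fin 5) (t : Fin 4)
    (u : Fin 4 → MvPolynomial (Fin 4) ℤ) (hπ0 : π 0 = Fin.succ 2) (hπ1 : π 1 = Fin.succ 3)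
    (hu : ∀ i, finSuccEquiv ℂ 4 (rename π ((![1, X 2, X 3, X 4] : Fin 4 → _) i)) =
      Polynomial.C ((u i).map (Int.castRingHom ℂ)) + if i = t then Polynomial.X else 0)
    (f : MvPolynomial (Fin 2) k →+* K) (hf : Function.Injective f) {x y a b : K}
    (hfx : f (X 0) = x) (hfy : f (X 1) = y) (hx : x ≠ 0) (hp : disc x y ≠ 0)
    (hns : ¬ Spl x (disc x y)) (hab : ∀ r, a * b ≠ -(x ^ 2 * disc x y * r ^ 2))
    (w₁ w₂ : RatFunc (RatFunc K)) (hw₂ : w₂ ≠ 0)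
    (hlead : ∀ (E : Type) [Field E] (ψ : K →+* E), aeval ![1, ψ x, 1, ψ y] (A₀ t t) ≠ 0)
    (hroot : ∀ (E : Type) [Field E] (ψ : RatFunc (RatFunc K) →+* E) (s : E),
      s ^ 2 = ψ (bigDisc x (disc x y) a b) →
      ∀ v : Fin 4 → E, (∀ i, v i = aeval ![ψ RatFunc.X, ψ (RatFunc.C RatFunc.X),
          ψ (RatFunc.C (RatFunc.C x)), ψ (RatFunc.C (RatFunc.C y))]
          (u i) + if i = t then ψ w₁ + ψ w₂ * s else 0) →
      ∑ i, ∑ j, aeval ![1, ψ (RatFunc.C (RatFunc.C x)), 1, ψ (RatFunc.C (RatFunc.C y))] (A₀ i j) *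
        v i * v j = 0) :
    HasNonsplitPlace P A := by
  have : Fact (∀ r : RatFunc (RatFunc K), r ^ 2 ≠ bigDisc x (disc x y) a b + 0 * r) :=
    ⟨fun r => by
      rw [zero_mul, add_zero]
      exact bigDisc_not_sq two_ne_zero hx hp hns hab r⟩
  have key := not_spl_quadraticAlgebra (A := a) (B := b) two_ne_zero hx hp hns hab
  let θ := algebraMap (RatFunc (RatFunc K)) (QuadraticAlgebra _ (bigDisc x (disc x y) a b) 0)
  let s : QuadraticAlgebra (RatFunc (RatFunc K)) (bigDisc x (disc x y) a b) 0 := ⟨0, 1⟩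
  have hs : s ^ 2 = θ (bigDisc x (disc x y) a b) := by
    ext <;> simp [s, θ, sq]
  have : CharZero (QuadraticAlgebra (RatFunc (RatFunc K)) (bigDisc x (disc x y) a b) 0) :=
    charZero_of_injective_algebraMap θ.injective
  refine P.hasNonsplitPlace_of_root hA π t u hπ0 hπ1 hu f hf w₁ w₂ hw₂ θ s
    (fun r r' h => ?_) (by rw [hfx]; rfl) (by rw [hfy]; rfl)
    (hlead _ ((θ.comp RatFunc.C).comp RatFunc.C)) (hroot _ θ s hs) ?_ ?_ ?_
  · have hre := congrArg QuadraticAlgebra.re h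
    have him := congrArg QuadraticAlgebra.im h
    simp [θ, s] at hre him
    exact ⟨hre, him⟩
  · simpa using hx
  · rw [← disc_map]
    simpa using hp
  · rw [← disc_map]
    exact key

end FieldPlace

namespace FieldPlace

open MvPolynomial

theorem specialFormOne_root {E : Type*} [Field E] {x y a b s ζ : E} (hx : x ≠ 0)
    (hs : s ^ 2 = disc x y * x ^ 2 * a ^ 2 + (-(1 - x) * disc x y * b ^ 2 + x))
    (hζ : x * ζ = s + (1 - x) * y * b) (v : Fin 4 → E) (h0 : v 0 = 1) (h1 : v 1 = b)
    (h2 : v 2 = ζ) (h3 : v 3 = a) :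
    ∑ i, ∑ j, specialFormOne (fun _ _ m n => x ^ m * y ^ n) i j * v i * v j = 0 := by
  refine (mul_eq_zero.1 ?_).resolve_left hx
  simp only [disc] at hs
  have h : ∑ i, ∑ j, specialFormOne (fun _ _ m n => x ^ m * y ^ n) i j * v i * v j =
      1 + (x - 1) * b ^ 2 + 2 * (y - x * y) * b * ζ - x * ζ ^ 2 +
        (x ^ 2 - x * y ^ 2 + x ^ 2 * y ^ 2) * a ^ 2 := by
    simp [Fin.sum_univ_four, specialFormOne, h0, h1, h2, h3]
    ring
  rw [h]
  linear_combination (-x * ζ - s + (1 - x) * y * b) * hζ - hs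

theorem specialFormTwo_root {E : Type*} [Field E] {x y a b s ζ : E} (hx : x * (1 - x) ≠ 0)
    (hs : s ^ 2 = disc x y * x ^ 2 * a ^ 2 + (x * (1 - x) ^ 2 * b ^ 2 + -(1 - x) * disc x y))
    (hζ : x * (1 - x) * ζ = s - (1 - x) * y - x * a) (v : Fin 4 → E) (h0 : v 0 = 1) (h1 : v 1 = b)
    (h2 : v 2 = a) (h3 : v 3 = ζ) :
    ∑ i, ∑ j, specialFormTwo (fun _ _ m n => x ^ m * y ^ n) i j * v i * v j = 0 := by
  refine (mul_eq_zero.1 ?_).resolve_left hx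
  simp only [disc] at hs
  have h : ∑ i, ∑ j, specialFormTwo (fun _ _ m n => x ^ m * y ^ n) i j * v i * v j =
      1 + (x - 1) * b ^ 2 + 2 * y * a + 2 * (y - x * y) * ζ + (x + x * y ^ 2) * a ^ 2 +
        2 * x * a * ζ + (x - x ^ 2) * ζ ^ 2 := by
    simp [Fin.sum_univ_four, specialFormTwo, h0, h1, h2, h3]
    ring
  rw [h]
  linear_combination (x * (1 - x) * ζ + s + (1 - x) * y + x * a) * hζ + hs

/-- The first special form of bidegrees `(D i j, E i j)`. -/
noncomputable def biFormOne (D E : Fin 4 → Fin 4 → ℕ) :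
    Fin 4 → Fin 4 → MvPolynomial (Fin 4) ℤ :=
  specialFormOne fun i j m n => biMonomial (D i j) (E i j) m n

/-- The second special form of bidegrees `(D i j, E i j)`. -/
noncomputable def biFormTwo (D E : Fin 4 → Fin 4 → ℕ) :
    Fin 4 → Fin 4 → MvPolynomial (Fin 4) ℤ :=
  specialFormTwo fun i j m n => biMonomial (D i j) (E i j) m n

theorem aeval_biFormOne {R : Type*} [CommRing R] (x y : R) (D E : Fin 4 → Fin 4 → ℕ)
    (i j : Fin 4) : aeval ![1, x, 1, y] (biFormOne D E i j) =
      specialFormOne (fun _ _ m n => x ^ m * y ^ n) i j := by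
  have := map_specialFormOne (aeval (R := ℤ) ![1, x, 1, y]).toRingHom
    (fun i j m n => biMonomial (D i j) (E i j) m n) i j
  simpa only [AlgHom.toRingHom_eq_coe, RingHom.coe_coe, aeval_biMonomial, biFormOne, biFormTwo] using this

theorem aeval_biFormTwo {R : Type*} [CommRing R] (x y : R) (D E : Fin 4 → Fin 4 → ℕ)
    (i j : Fin 4) : aeval ![1, x, 1, y] (biFormTwo D E i j) =
      specialFormTwo (fun _ _ m n => x ^ m * y ^ n) i j := by
  have := map_specialFormTwo (aeval (R := ℤ) ![1, x, 1, y]).toRingHom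
    (fun i j m n => biMonomial (D i j) (E i j) m n) i j
  simpa only [AlgHom.toRingHom_eq_coe, RingHom.coe_coe, aeval_biMonomial, biFormOne, biFormTwo] using this

theorem exists_injective_ratFunc_ratFunc (k : Type*) [Field k] :
    ∃ f : MvPolynomial (Fin 2) k →+* RatFunc (RatFunc k), Function.Injective f ∧
      f (X 0) = RatFunc.X ∧ f (X 1) = RatFunc.C (RatFunc.X : RatFunc k) := by
  obtain ⟨g, hg, h0, h1, -⟩ := exists_injective_ratFunc_two
    (isEmptyRingEquiv k (Fin 0)).toRingHom (isEmptyRingEquiv k (Fin 0)).injective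
  exact ⟨g, hg, h0, h1⟩

variable {k K : Type} [Field k] [Field K] [CharZero K]

theorem hasNonsplitPlace_of_biFormOne_of_injective (P : FieldPlace ℂ k)
    {A : Fin 4 → Fin 4 → MvPolynomial (Fin 4) ℂ} {D E : Fin 4 → Fin 4 → ℕ}
    (hA : ∀ i j s, P.R (coeff s (A i j)) (coeff s (biFormOne D E i j) : ℤ))
    [IsDomain (p1p1BundleChartRing A)] (f : MvPolynomial (Fin 2) k →+* K)
    (hf : Function.Injective f) {x y : K} (hfx : f (X 0) = x) (hfy : f (X 1) = y) (hx : x ≠ 0)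
    (hp : disc x y ≠ 0) (hns : ¬ Spl x (disc x y)) (hnsq : ∀ c, x * (1 - x) ≠ c ^ 2) :
    HasNonsplitPlace P A := by
  let π : Fin 5 ≃ Fin 5 := ⟨![3, 4, 2, 0, 1], ![3, 4, 2, 0, 1], by decide, by decide⟩
  refine P.hasNonsplitPlace_of_form hA π 2 ![1, X 1, 0, X 0] rfl rfl (fun i => ?_) f hf hfx hfy
    hx hp hns (a := -(1 - x) * disc x y) (b := x) (fun r h => hnsq (x * r) ?_)
    (RatFunc.C (RatFunc.C ((1 - x) * y / x)) * RatFunc.C (RatFunc.X : RatFunc K))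
    (RatFunc.C (RatFunc.C (1 / x))) ?_ (fun F _ ψ => ?_) fun F _ ψ s hs v hv => ?_
  · fin_cases i
    · simp
    · simpa [π] using finSuccEquiv_X_succ (R := ℂ) (j := (1 : Fin 4))
    · simp [π, finSuccEquiv_X_zero]
    · simpa [π] using finSuccEquiv_X_succ (R := ℂ) (j := (0 : Fin 4))
  · refine mul_right_cancel₀ hp (mul_left_cancel₀ hx ?_)
    linear_combination -x * h
  · simpa using hx
  · rw [aeval_biFormOne]
    simpa [specialFormOne] using hx
  · simp only [aeval_biFormOne]
    have hx' : ψ (RatFunc.C (RatFunc.C x)) ≠ 0 := by simpa using hx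
    refine specialFormOne_root hx' (a := ψ RatFunc.X) (b := ψ (RatFunc.C RatFunc.X)) (s := s)
      (ζ := v 2) ?_ ?_ v ?_ ?_ rfl ?_
    · rw [hs, bigDisc]
      simp [disc]
    · rw [hv]
      simp
      field_simp
      ring
    · simp [hv]
    · simp [hv]
    · simp [hv]

theorem hasNonsplitPlace_of_biFormTwo_of_injective (P : FieldPlace ℂ k)
    {A : Fin 4 → Fin 4 → MvPolynomial (Fin 4) ℂ} {D E : Fin 4 → Fin 4 → ℕ}
    (hA : ∀ i j s, P.R (coeff s (A i j)) (coeff s (biFormTwo D E i j) : ℤ))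
    [IsDomain (p1p1BundleChartRing A)] (f : MvPolynomial (Fin 2) k →+* K)
    (hf : Function.Injective f) {x y : K} (hfx : f (X 0) = x) (hfy : f (X 1) = y) (hx : x ≠ 0)
    (hp : disc x y ≠ 0) (hns : ¬ Spl x (disc x y)) (hnsq : ∀ c, x * (1 - x) ≠ c ^ 2) :
    HasNonsplitPlace P A := by
  have hg : 1 - x ≠ 0 := fun h => hnsq 0 (by rw [h]; ring)
  let π : Fin 5 ≃ Fin 5 := ⟨![3, 4, 2, 1, 0], ![4, 3, 2, 0, 1], by decide, by decide⟩
  refine P.hasNonsplitPlace_of_form hA π 3 ![1, X 1, X 0, 0] rfl rfl (fun i => ?_) f hf hfx hfy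
    hx hp hns (a := x * (1 - x) ^ 2) (b := -(1 - x) * disc x y)
    (fun r h => hnsq (x * r / (1 - x)) (by rw [div_pow, eq_div_iff (pow_ne_zero 2 hg)]; refine mul_right_cancel₀ hp ?_; linear_combination -h))
    (RatFunc.C (RatFunc.C (-y / x)) + RatFunc.C (RatFunc.C (-1 / (1 - x))) * RatFunc.X)
    (RatFunc.C (RatFunc.C (1 / (x * (1 - x))))) ?_ (fun F _ ψ => ?_) fun F _ ψ s hs v hv => ?_
  · fin_cases i
    · simp
    · simpa [π] using finSuccEquiv_X_succ (R := ℂ) (j := (1 : Fin 4))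
    · simpa [π] using finSuccEquiv_X_succ (R := ℂ) (j := (0 : Fin 4))
    · simp [π, finSuccEquiv_X_zero]
  · simp only [ne_eq, map_eq_zero, one_div, inv_eq_zero, mul_eq_zero, not_or]
    exact ⟨hx, hg⟩
  · rw [aeval_biFormTwo]
    have : ψ (x * (1 - x)) ≠ 0 := (map_ne_zero ψ).2 (mul_ne_zero hx hg)
    rw [map_mul, map_sub, map_one] at this
    simpa [specialFormTwo, mul_sub, sq] using this
  · simp only [aeval_biFormTwo]
    have hx' : ψ (RatFunc.C (RatFunc.C x)) ≠ 0 := by simpa using hx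
    have hg' : 1 - ψ (RatFunc.C (RatFunc.C x)) ≠ 0 := by
      have := (map_ne_zero ((ψ.comp RatFunc.C).comp RatFunc.C)).2 hg
      simpa only [map_sub, map_one, RingHom.comp_apply] using this
    refine specialFormTwo_root (mul_ne_zero hx' hg') (a := ψ RatFunc.X)
      (b := ψ (RatFunc.C RatFunc.X)) (s := s) (ζ := v 3) ?_ ?_ v ?_ ?_ ?_ rfl
    · rw [hs, bigDisc]
      simp [disc]
    · rw [hv]
      simp
      field_simp
      ring
    · simp [hv]
    · simp [hv]
    · simp [hv]

theorem hasNonsplitPlace_of_biFormOne [CharZero k] (P : FieldPlace ℂ k)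
    {A : Fin 4 → Fin 4 → MvPolynomial (Fin 4) ℂ} {D E : Fin 4 → Fin 4 → ℕ}
    (hA : ∀ i j s, P.R (coeff s (A i j)) (coeff s (biFormOne D E i j) : ℤ))
    [IsDomain (p1p1BundleChartRing A)] : HasNonsplitPlace P A := by
  obtain ⟨f, hf, hfx, hfy⟩ := exists_injective_ratFunc_ratFunc k
  have : CharZero (RatFunc k) := charZero_of_injective_algebraMap (algebraMap k (RatFunc k)).injective
  have : CharZero (RatFunc (RatFunc k)) :=
    charZero_of_injective_algebraMap (algebraMap (RatFunc k) (RatFunc (RatFunc k))).injective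
  exact P.hasNonsplitPlace_of_biFormOne_of_injective hA f hf hfx hfy RatFunc.X_ne_zero
    disc_generic_ne_zero (not_spl_disc_generic two_ne_zero) X_mul_one_sub_X_not_sq

theorem hasNonsplitPlace_of_biFormTwo [CharZero k] (P : FieldPlace ℂ k)
    {A : Fin 4 → Fin 4 → MvPolynomial (Fin 4) ℂ} {D E : Fin 4 → Fin 4 → ℕ}
    (hA : ∀ i j s, P.R (coeff s (A i j)) (coeff s (biFormTwo D E i j) : ℤ))
    [IsDomain (p1p1BundleChartRing A)] : HasNonsplitPlace P A := by
  obtain ⟨f, hf, hfx, hfy⟩ := exists_injective_ratFunc_ratFunc k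
  have : CharZero (RatFunc k) := charZero_of_injective_algebraMap (algebraMap k (RatFunc k)).injective
  have : CharZero (RatFunc (RatFunc k)) :=
    charZero_of_injective_algebraMap (algebraMap (RatFunc k) (RatFunc (RatFunc k))).injective
  exact P.hasNonsplitPlace_of_biFormTwo_of_injective hA f hf hfx hfy RatFunc.X_ne_zero
    disc_generic_ne_zero (not_spl_disc_generic two_ne_zero) X_mul_one_sub_X_not_sq

end FieldPlace

theorem Spl.of_fractionRing {E : Type*} [Field E] [Infinite E] {m : ℕ} {a b : E}
    (h : Spl (algebraMap (MvPolynomial (Fin m) E) (FractionRing (MvPolynomial (Fin m) E))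
        (MvPolynomial.C a))
      (algebraMap (MvPolynomial (Fin m) E) (FractionRing (MvPolynomial (Fin m) E))
        (MvPolynomial.C b))) : Spl a b := by
  classical
  obtain ⟨r, s, h⟩ := h
  obtain ⟨T, hT⟩ := IsLocalization.exist_integer_multiples_of_finset
    (nonZeroDivisors (MvPolynomial (Fin m) E)) ({r, s} : Finset (FractionRing (MvPolynomial (Fin m) E)))
  obtain ⟨R, hR⟩ := hT r (by simp)
  obtain ⟨S, hS⟩ := hT s (by simp)
  have hT0 : (T : MvPolynomial (Fin m) E) ≠ 0 := nonZeroDivisors.ne_zero T.2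
  have h1 : MvPolynomial.C b * (T : MvPolynomial (Fin m) E) ^ 2 =
      R ^ 2 - MvPolynomial.C a * S ^ 2 := by
    apply IsFractionRing.injective (MvPolynomial (Fin m) E) (FractionRing (MvPolynomial (Fin m) E))
    simp only [map_mul, map_sub, map_pow]
    rw [hR, hS, h, Algebra.smul_def, Algebra.smul_def]
    ring
  obtain ⟨v, hv⟩ : ∃ v, MvPolynomial.eval v (T : MvPolynomial (Fin m) E) ≠ 0 := by
    by_contra! h0
    exact hT0 (MvPolynomial.funext fun v => by rw [h0 v, map_zero])
  have h2 := congrArg (MvPolynomial.eval v) h1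
  simp only [map_mul, map_sub, map_pow, MvPolynomial.eval_C] at h2
  refine ⟨MvPolynomial.eval v R / MvPolynomial.eval v T, MvPolynomial.eval v S /
    MvPolynomial.eval v T, ?_⟩
  field_simp
  linear_combination h2

namespace FieldPlace

open MvPolynomial

theorem SameValueGroup.exists_root {L κ : Type*} [Field L] [Field κ] {Q : FieldPlace L κ}
    {ι : ℂ →+* L} (hQ : Q.SameValueGroup ι) {a : L} (ha : a ≠ 0) {n : ℕ} (hn : 0 < n) :
    ∃ ρ, ρ ≠ 0 ∧ Q.vs.valuation ρ ^ n = Q.vs.valuation a := by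
  obtain ⟨c, hc, u, rfl, d, hd, hu⟩ := hQ a ha
  obtain ⟨z, rfl⟩ := IsAlgClosed.exists_pow_nat_eq c hn
  refine ⟨ι z, ?_, ?_⟩
  · rw [map_ne_zero]
    rintro rfl
    simp [hn.ne'] at hc
  · have hu1 : Q.vs.valuation u = 1 := by
      have h0 := Q.ne_zero hu hd
      refine le_antisymm ((ValuationSubring.valuation_le_one_iff _ _).2 ⟨d, hu⟩) ?_
      have := (ValuationSubring.valuation_le_one_iff Q.vs u⁻¹).2 ⟨d⁻¹, Q.inv hu hd⟩
      rw [map_inv₀] at this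
      exact (inv_le_one₀ (by simpa [zero_lt_iff] using h0)).1 this
    rw [map_mul, hu1, mul_one, map_pow, map_pow]

theorem not_redNonSplit_const {k L κ : Type*} [Field k] [Field L] [Field κ] (h2 : (2 : κ) ≠ 0)
    {P : FieldPlace ℂ k}
    (hsq : ∀ a : k, ∃ b, a = b ^ 2) {Q : FieldPlace L κ} {ι : ℂ →+* L} {θ : k →+* κ}
    (hc : ∀ z c, P.R z c → Q.R (ι z) (θ c)) (w : Fin 3 → ℂ) :
    ¬ RedNonSplit Q (fun k => ι (w k)) := by
  rintro ⟨c, hc0, p, hp, hns⟩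
  have hp0 : p 0 ≠ 0 := fun h => hns.1 (by simp [ah, h])
  have h1 : ∀ j, Q.R (ι (w j / w 0)) (p j / p 0) := fun j => by
    have := Q.div (hp j) (hp 0) hp0
    rwa [div_div_div_cancel_right₀ hc0, ← map_div₀] at this
  have h3 : ∀ j, ∃ v : k, θ v = p j / p 0 := by
    intro j
    rcases P.total (w j / w 0) with ⟨v, hv⟩ | hv
    · exact ⟨v, Q.uniq (hc _ _ hv) (h1 j)⟩
    · have h4 := Q.mul (h1 j) (hc _ _ hv)
      rw [map_zero, mul_zero, map_inv₀] at h4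
      by_cases h5 : ι (w j / w 0) = 0
      · refine ⟨0, ?_⟩
        have := h1 j
        rw [h5] at this
        rw [map_zero]
        exact Q.uniq Q.zero this
      · rw [mul_inv_cancel₀ h5] at h4
        exact absurd (Q.uniq Q.one h4) one_ne_zero
  choose v hv using h3
  obtain ⟨b, hb⟩ := hsq (v 0 * v 1)
  have hpv : p = fun j => p 0 * θ (v j) := by
    ext j
    rw [hv, mul_div_cancel₀ _ hp0]
  rw [hpv, nonSplit_mul_iff hp0] at hns
  have ha : ah (fun j => θ (v j)) = θ b ^ 2 := by
    rw [ah, ← map_mul, hb, map_pow]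
  obtain ⟨h4, -, h5⟩ := hns
  rw [ha] at h4 h5
  exact h5 (Spl.of_isSquare h2 fun h => h4 (by rw [h]; simp))

/-- A zero of the chart polynomial specialises to a zero of the special form. -/
theorem iso_of_eval₂_chartPoly {k L κ : Type*} [Field k] [Field L] [Field κ]
    {P : FieldPlace ℂ k} {A : Fin 4 → Fin 4 → MvPolynomial (Fin 4) ℂ}
    {A₀ : Fin 4 → Fin 4 → MvPolynomial (Fin 4) ℤ}
    (hA : ∀ i j s, P.R (coeff s (A i j)) (coeff s (A₀ i j) : ℤ))
    {Q : FieldPlace L κ} {ι : ℂ →+* L} {θ : k →+* κ}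
    (hc : ∀ z c, P.R z c → Q.R (ι z) (θ c)) {v : Fin 5 → L}
    (h : eval₂ ι v (p1p1BundleChartPoly A) = 0) {x y : κ} (hx : Q.R (v 0) x) (hy : Q.R (v 1) y)
    (hform : ∀ w : Fin 4 → κ, w ≠ 0 →
      ∑ i, ∑ j, aeval ![1, x, 1, y] (A₀ i j) * w i * w j = 0 → Iso x y) : Iso x y := by
  have hB : ∀ i j, eval₂ ι v (dehomP1P1 (A i j)) = eval₂ ι ![1, v 0, 1, v 1] (A i j) := by
    intro i j
    have : (eval₂Hom ι v).comp dehomP1P1 = eval₂Hom ι ![1, v 0, 1, v 1] := by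
      refine ringHom_ext (fun c => by simp [dehomP1P1]) fun i => ?_
      fin_cases i <;> simp [dehomP1P1]
    exact RingHom.congr_fun this (A i j)
  have hz : ∀ i, eval₂ ι v ((![1, X 2, X 3, X 4] : Fin 4 → MvPolynomial (Fin 5) ℂ) i) =
      ![1, v 2, v 3, v 4] i := by
    intro i
    fin_cases i <;> simp
  rw [p1p1BundleChartPoly] at h
  simp only [eval₂_sum, eval₂_mul, hB, hz] at h
  obtain ⟨w, hw, h0⟩ := Q.exists_reduced_zero (b := fun i j => aeval ![1, x, 1, y] (A₀ i j))
    (fun i j => R_eval₂ hc (hA i j) fun l => by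
      fin_cases l
      · exact Q.one
      · exact hx
      · exact Q.one
      · exact hy) ![1, v 2, v 3, v 4]
    (fun h => one_ne_zero (α := L) (congrFun h 0)) h
  exact hform w hw h0

theorem not_stablyRational_of_hasNonsplitPlace {k : Type} [Field k] {P : FieldPlace ℂ k}
    (hsq : ∀ a : k, ∃ b, a = b ^ 2) {A : Fin 4 → Fin 4 → MvPolynomial (Fin 4) ℂ}
    {A₀ : Fin 4 → Fin 4 → MvPolynomial (Fin 4) ℤ}
    (hA : ∀ i j s, P.R (coeff s (A i j)) (coeff s (A₀ i j) : ℤ))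
    (hplace : ∀ [IsDomain (p1p1BundleChartRing A)], HasNonsplitPlace P A)
    (hform : ∀ {E : Type} [Field E] {x y : E}, x ≠ 0 → ∀ w : Fin 4 → E, w ≠ 0 →
      ∑ i, ∑ j, aeval ![1, x, 1, y] (A₀ i j) * w i * w j = 0 → Iso x y) :
    ¬ IsStablyRationalFunctionField (p1p1BundleFFMap A) := by
  rintro ⟨m, n, e, he⟩
  have hdom : IsDomain (p1p1BundleChartRing A) := by
    have hinj : Function.Injective (e.toRingHom.comp ((algebraMap
        (MvPolynomial (Fin m) (FractionRing (p1p1BundleChartRing A))) (FractionRing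
        (MvPolynomial (Fin m) (FractionRing (p1p1BundleChartRing A))))).comp
        (C.comp (algebraMap (p1p1BundleChartRing A) (FractionRing (p1p1BundleChartRing A)))))) :=
      e.injective.comp ((IsFractionRing.injective (MvPolynomial (Fin m)
        (FractionRing (p1p1BundleChartRing A))) _).comp ((C_injective _ _).comp
        (IsFractionRing.injective (p1p1BundleChartRing A) _)))
    exact hinj.isDomain _
  obtain ⟨κ, _, _, θ, Q, x, y, hc, hx, hy, hQ, hx0, hd0, hns⟩ := hplace
  obtain ⟨Q', hc', hQ'⟩ := Q.exists_gauss_mv m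
  have hinj : Function.Injective ((algebraMap (MvPolynomial (Fin m) κ)
      (FractionRing (MvPolynomial (Fin m) κ))).comp C) := RingHom.injective _
  have hSV := hQ'.trans hQ fun z c h hc0 => ⟨_, (map_ne_zero_iff _ hinj).2 hc0, hc' z c h⟩
  have : CharZero (FractionRing (MvPolynomial (Fin m) κ)) := charZero_of_injective_algebraMap
    (algebraMap κ (FractionRing (MvPolynomial (Fin m) κ))).injective
  have hcc : ∀ z c, P.R z c → Q'.R (adjoinIndetsMap (p1p1BundleFFMap A) m z)
      ((((algebraMap (MvPolynomial (Fin m) κ)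
      (FractionRing (MvPolynomial (Fin m) κ))).comp C).comp θ) c) := fun z c h =>
    hc' _ _ (hc _ _ h)
  obtain ⟨i₀, hi₀⟩ := hsq (-1)
  let Φ : MvPolynomial (Fin 5) ℂ →+* FractionRing (MvPolynomial (Fin m)
      (FractionRing (p1p1BundleChartRing A))) := (algebraMap
        (MvPolynomial (Fin m) (FractionRing (p1p1BundleChartRing A))) _).comp
        (C.comp ((algebraMap (p1p1BundleChartRing A) _).comp (chartMk A)))
  have hΦ : eval₂Hom (adjoinIndetsMap (p1p1BundleFFMap A) m) (fun i => Φ (X i)) = Φ := by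
    refine ringHom_ext (fun c => ?_) fun i => ?_
    · rw [eval₂Hom_C]; rfl
    · rw [eval₂Hom_X']
  refine no_rational_parametrisation Q' (fun a ha n hn => hSV.exists_root ha hn)
    (i := ((algebraMap (MvPolynomial (Fin m) κ)
      (FractionRing (MvPolynomial (Fin m) κ))).comp C).comp θ i₀) ?_
    (adjoinIndetsMap (p1p1BundleFFMap A) m) n e (fun c => RingHom.congr_fun he c)
    (fun i => Φ (X i)) (p1p1BundleChartPoly A) ?_ ?_ (fun w _ =>
      not_redNonSplit_const two_ne_zero hsq hcc w) (hc' _ _ hx) (hc' _ _ hy) ?_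
  · rw [← map_pow, ← hi₀, map_neg, map_one]
  · have h1 : Φ (p1p1BundleChartPoly A) = 0 := by
      have : chartMk A (p1p1BundleChartPoly A) = 0 := chartMk_eq_zero.2 dvd_rfl
      simp only [Φ, RingHom.comp_apply, this, map_zero]
    exact (RingHom.congr_fun hΦ _).trans h1
  · intro m' hm' φ Q'' hφ hQ'' x' y' hx' hy' hx'0
    refine iso_of_eval₂_chartPoly (ι := (φ.comp RatFunc.C).comp
      (adjoinIndetsMap (p1p1BundleFFMap A) m)) (θ := RatFunc.C.comp (((algebraMap
      (MvPolynomial (Fin m) κ) (FractionRing (MvPolynomial (Fin m) κ))).comp C).comp θ))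
      (v := fun i => φ (m' i)) hA (fun z c h => ?_) ?_ hx' hy' (hform hx'0)
    · have := hQ'' _ _ (hcc _ _ h)
      rw [← hφ] at this
      exact this
    · have := congrArg φ hm'
      rw [map_zero, hom_eval₂] at this
      exact this
  · have ha : ∀ x y : FractionRing (MvPolynomial (Fin m) κ), ah ![1, x, y] = x := fun x y => by
      simp [ah]
    have hb : ∀ x y : FractionRing (MvPolynomial (Fin m) κ), bh ![1, x, y] = disc x y :=
      fun x y => by simp [bh, disc]
    rw [NonSplit, ha, hb]
    have hd := disc_map ((algebraMap (MvPolynomial (Fin m) κ)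
      (FractionRing (MvPolynomial (Fin m) κ))).comp C) x y
    rw [RingHom.comp_apply, RingHom.comp_apply, RingHom.comp_apply] at hd
    rw [← hd]
    exact ⟨(map_ne_zero_iff _ hinj).2 hx0, (map_ne_zero_iff _ hinj).2 hd0,
      fun h => hns h.of_fractionRing⟩

end FieldPlace

namespace FieldPlace

open MvPolynomial

/-- The bihomogeneous forms of bidegree `(D, E)`. -/
noncomputable abbrev biForms (D E : ℕ) : Submodule ℂ (MvPolynomial (Fin 4) ℂ) :=
  weightedHomogeneousSubmodule ℂ p1p1Weight1 D ⊓ weightedHomogeneousSubmodule ℂ p1p1Weight2 E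

theorem map_biMonomial_mem {D E m n : ℕ} (hm : m ≤ D) (hn : n ≤ E) :
    (biMonomial D E m n).map (Int.castRingHom ℂ) ∈ biForms D E := by
  have h : ∀ w : Fin 4 → ℕ, IsWeightedHomogeneous w
      ((biMonomial D E m n).map (Int.castRingHom ℂ))
      ((D - m) * w 0 + m * w 1 + (E - n) * w 2 + n * w 3) := by
    intro w
    simp only [biMonomial, map_mul, map_pow, map_X]
    have hX := isWeightedHomogeneous_X ℂ w
    exact ((((hX 0).pow _).mul ((hX 1).pow _)).mul ((hX 2).pow _)).mul ((hX 3).pow _)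
  refine ⟨?_, ?_⟩
  · have := h p1p1Weight1
    rwa [show (D - m) * p1p1Weight1 0 + m * p1p1Weight1 1 + (E - n) * p1p1Weight1 2 +
      n * p1p1Weight1 3 = D by simp [p1p1Weight1, hm]] at this
  · have := h p1p1Weight2
    rwa [show (D - m) * p1p1Weight2 0 + m * p1p1Weight2 1 + (E - n) * p1p1Weight2 2 +
      n * p1p1Weight2 3 = E by simp [p1p1Weight2, hn]] at this

theorem specialFormOne_mem {V : Type*} [CommRing V] [Module ℂ V] {D E : Fin 4 → Fin 4 → ℕ}
    (h11 : 1 ≤ D 1 1) (h12 : 1 ≤ D 1 2) (h12' : 1 ≤ E 1 2) (h21 : 1 ≤ D 2 1)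
    (h21' : 1 ≤ E 2 1) (h22 : 1 ≤ D 2 2) (h33 : 2 ≤ D 3 3) (h33' : 2 ≤ E 3 3)
    (W : Fin 4 → Fin 4 → Submodule ℂ V) (M : Fin 4 → Fin 4 → ℕ → ℕ → V)
    (hM : ∀ i j m n, m ≤ D i j → n ≤ E i j → M i j m n ∈ W i j) (i j : Fin 4) :
    specialFormOne M i j ∈ W i j := by
  have z : ∀ i j, (0 : V) ∈ W i j := fun i j => zero_mem _
  fin_cases i <;> fin_cases j
  · exact hM 0 0 0 0 (by omega) (by omega)
  · exact z 0 1
  · exact z 0 2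
  · exact z 0 3
  · exact z 1 0
  · exact sub_mem (hM 1 1 1 0 (by omega) (by omega)) (hM 1 1 0 0 (by omega) (by omega))
  · exact sub_mem (hM 1 2 0 1 (by omega) (by omega)) (hM 1 2 1 1 (by omega) (by omega))
  · exact z 1 3
  · exact z 2 0
  · exact sub_mem (hM 2 1 0 1 (by omega) (by omega)) (hM 2 1 1 1 (by omega) (by omega))
  · exact neg_mem (hM 2 2 1 0 (by omega) (by omega))
  · exact z 2 3
  · exact z 3 0
  · exact z 3 1
  · exact z 3 2
  · exact add_mem (sub_mem (hM 3 3 2 0 (by omega) (by omega)) (hM 3 3 1 2 (by omega) (by omega)))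
      (hM 3 3 2 2 (by omega) (by omega))

theorem specialFormTwo_mem {V : Type*} [CommRing V] [Module ℂ V] {D E : Fin 4 → Fin 4 → ℕ}
    (h02 : 1 ≤ E 0 2) (h20 : 1 ≤ E 2 0) (h03 : 1 ≤ D 0 3) (h03' : 1 ≤ E 0 3)
    (h30 : 1 ≤ D 3 0) (h30' : 1 ≤ E 3 0) (h11 : 1 ≤ D 1 1) (h22 : 1 ≤ D 2 2)
    (h22' : 2 ≤ E 2 2) (h23 : 1 ≤ D 2 3) (h32 : 1 ≤ D 3 2) (h33 : 2 ≤ D 3 3)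
    (W : Fin 4 → Fin 4 → Submodule ℂ V) (M : Fin 4 → Fin 4 → ℕ → ℕ → V)
    (hM : ∀ i j m n, m ≤ D i j → n ≤ E i j → M i j m n ∈ W i j) (i j : Fin 4) :
    specialFormTwo M i j ∈ W i j := by
  have z : ∀ i j, (0 : V) ∈ W i j := fun i j => zero_mem _
  fin_cases i <;> fin_cases j
  · exact hM 0 0 0 0 (by omega) (by omega)
  · exact z 0 1
  · exact hM 0 2 0 1 (by omega) (by omega)
  · exact sub_mem (hM 0 3 0 1 (by omega) (by omega)) (hM 0 3 1 1 (by omega) (by omega))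
  · exact z 1 0
  · exact sub_mem (hM 1 1 1 0 (by omega) (by omega)) (hM 1 1 0 0 (by omega) (by omega))
  · exact z 1 2
  · exact z 1 3
  · exact hM 2 0 0 1 (by omega) (by omega)
  · exact z 2 1
  · exact add_mem (hM 2 2 1 0 (by omega) (by omega)) (hM 2 2 1 2 (by omega) (by omega))
  · exact hM 2 3 1 0 (by omega) (by omega)
  · exact sub_mem (hM 3 0 0 1 (by omega) (by omega)) (hM 3 0 1 1 (by omega) (by omega))
  · exact z 3 1
  · exact hM 3 2 1 0 (by omega) (by omega)
  · exact sub_mem (hM 3 3 1 0 (by omega) (by omega)) (hM 3 3 2 0 (by omega) (by omega))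

theorem map_biFormOne_mem {D E : Fin 4 → Fin 4 → ℕ} (h11 : 1 ≤ D 1 1) (h12 : 1 ≤ D 1 2)
    (h12' : 1 ≤ E 1 2) (h21 : 1 ≤ D 2 1) (h21' : 1 ≤ E 2 1) (h22 : 1 ≤ D 2 2)
    (h33 : 2 ≤ D 3 3) (h33' : 2 ≤ E 3 3) (i j : Fin 4) :
    (biFormOne D E i j).map (Int.castRingHom ℂ) ∈ biForms (D i j) (E i j) := by
  rw [biFormOne, map_specialFormOne]
  exact specialFormOne_mem h11 h12 h12' h21 h21' h22 h33 h33' (fun i j => biForms (D i j) (E i j)) _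
    (fun i j m n h h' => map_biMonomial_mem h h') i j

theorem map_biFormTwo_mem {D E : Fin 4 → Fin 4 → ℕ} (h02 : 1 ≤ E 0 2) (h20 : 1 ≤ E 2 0)
    (h03 : 1 ≤ D 0 3) (h03' : 1 ≤ E 0 3) (h30 : 1 ≤ D 3 0) (h30' : 1 ≤ E 3 0)
    (h11 : 1 ≤ D 1 1) (h22 : 1 ≤ D 2 2) (h22' : 2 ≤ E 2 2) (h23 : 1 ≤ D 2 3) (h32 : 1 ≤ D 3 2)
    (h33 : 2 ≤ D 3 3) (i j : Fin 4) :
    (biFormTwo D E i j).map (Int.castRingHom ℂ) ∈ biForms (D i j) (E i j) := by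
  rw [biFormTwo, map_specialFormTwo]
  exact specialFormTwo_mem h02 h20 h03 h03' h30 h30' h11 h22 h22' h23 h32 h33 (fun i j => biForms (D i j) (E i j)) _
    (fun i j m n h h' => map_biMonomial_mem h h') i j

theorem isPolynomialFun_aeval {V : Type} [AddCommGroup V] [Module ℂ V] {σ : Type}
    (l : σ → V →ₗ[ℂ] ℂ) (G : MvPolynomial σ ℚ) :
    IsPolynomialFun fun p => aeval (fun t => l t p) G := by
  obtain ⟨n, g, -, q, rfl⟩ := exists_fin_rename G
  refine ⟨n, fun i => l (g i), q.map (algebraMap ℚ ℂ), fun p => ?_⟩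
  change aeval _ _ = _
  rw [aeval_rename, eval_map, aeval_def]
  rfl

theorem veryGeneral_of_specialisation {V : Type} [AddCommGroup V] [Module ℂ V] {σ : Type}
    [Countable σ] (l : σ → V →ₗ[ℂ] ℂ) (v₀ : V) {Q : V → Prop}
    (h : ∀ v, (∀ G : MvPolynomial σ ℚ, aeval (fun t => l t v) G = 0 →
      aeval (fun t => l t v₀) G = 0) → Q v) : VeryGeneral Q := by
  have : Countable (MvPolynomial σ ℚ) := by
    rw [← Cardinal.mk_le_aleph0_iff]
    refine cardinalMk_le_max.trans (max_le (max_le ?_ ?_) le_rfl) <;>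
      exact Cardinal.mk_le_aleph0
  refine ⟨Set.range (fun (G : MvPolynomial σ ℚ) v => aeval (fun t => l t v) G) \ {0},
    (Set.countable_range _).mono Set.sdiff_subset, ?_, fun v hv => h v fun G hG => ?_⟩
  · rintro _ ⟨⟨G, rfl⟩, h0⟩
    exact ⟨isPolynomialFun_aeval l G, h0⟩
  · by_contra h0
    exact hv _ ⟨⟨G, rfl⟩, fun h1 => h0 (congrFun h1 v₀)⟩ hG

theorem veryGeneral_of_integral_form {D E : Fin 4 → Fin 4 → ℕ}
    {A₀ : Fin 4 → Fin 4 → MvPolynomial (Fin 4) ℤ}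
    (hA₀ : ∀ i j, (A₀ i j).map (Int.castRingHom ℂ) ∈ biForms (D i j) (E i j))
    (hplace : ∀ {k : Type} [Field k] [CharZero k] (P : FieldPlace ℂ k)
      {A : Fin 4 → Fin 4 → MvPolynomial (Fin 4) ℂ},
      (∀ i j s, P.R (coeff s (A i j)) (coeff s (A₀ i j) : ℤ)) →
      ∀ [IsDomain (p1p1BundleChartRing A)], HasNonsplitPlace P A)
    (hform : ∀ {E : Type} [Field E] {x y : E}, x ≠ 0 → ∀ w : Fin 4 → E, w ≠ 0 →
      ∑ i, ∑ j, aeval ![1, x, 1, y] (A₀ i j) * w i * w j = 0 → Iso x y) :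
    VeryGeneral (P := Π i : Fin 4, Π j : Fin 4, biForms (D i j) (E i j))
      (fun p => IsQuadricBundleP1P1 (fun i j => (p i j : MvPolynomial (Fin 4) ℂ)) →
        ¬ IsStablyRationalFunctionField
          (p1p1BundleFFMap (fun i j => (p i j : MvPolynomial (Fin 4) ℂ)))) := by
  refine veryGeneral_of_specialisation (σ := Fin 4 × Fin 4 × (Fin 4 →₀ ℕ))
    (fun t => ⟨⟨fun p => coeff t.2.2 (p t.1 t.2.1 : MvPolynomial (Fin 4) ℂ),
      fun p q => coeff_add _ _ _⟩, fun c p => coeff_smul _ _ _⟩)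
    (fun i j => ⟨_, hA₀ i j⟩) fun p hp _ => ?_
  obtain ⟨k, _, _, P, hP, -, hsq⟩ := exists_specialisation
    (fun t : Fin 4 × Fin 4 × (Fin 4 →₀ ℕ) => coeff t.2.2 (p t.1 t.2.1 : MvPolynomial (Fin 4) ℂ))
    (fun t => coeff t.2.2 (A₀ t.1 t.2.1)) fun G hG => by
      have := hp G hG
      simpa [coeff_map] using this
  have hA : ∀ i j s, P.R (coeff s (p i j : MvPolynomial (Fin 4) ℂ)) (coeff s (A₀ i j) : ℤ) :=
    fun i j s => hP (i, j, s)
  exact not_stablyRational_of_hasNonsplitPlace hsq hA (hplace P hA) hform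

end FieldPlace

/-!
STATEMENT 14 (Corollary 5.3): Let `(dᵢ, eᵢ)` be a lexicographically ordered tuple of pairs
of non-negative integers with `dᵢ + d_j` and `eᵢ + e_j` even for all `i, j`. If
(1) `d₁ ≥ 1`, `d₃ ≥ 2`, `e₁ + e₂ ≥ 1` and `e₃ ≥ 3`, or
(2) `d₁ ≥ 1`, `d₃ ≥ 2`, `e₀ ≥ 1`, `e₁ + e₂ ≥ 1` and `e₂ ≥ 2`,
then a very general complex projective quadric surface bundle `X` over `ℙ¹ × ℙ¹` of type
`(dᵢ, eᵢ)` is not stably rational.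
-/

theorem very_general_quadric_bundle_P1P1_not_stably_rational
    (d e : Fin 4 → ℕ) (hlex : LexOrderedType d e)
    (hpard : ∀ i j, Even (d i + d j)) (hpare : ∀ i j, Even (e i + e j))
    (hcase : (1 ≤ d 1 ∧ 2 ≤ d 3 ∧ 1 ≤ e 1 + e 2 ∧ 3 ≤ e 3) ∨
      (1 ≤ d 1 ∧ 2 ≤ d 3 ∧ 1 ≤ e 0 ∧ 1 ≤ e 1 + e 2 ∧ 2 ≤ e 2)) :
    VeryGeneral
      (P := Π i : Fin 4, Π j : Fin 4,
        ((MvPolynomial.weightedHomogeneousSubmodule ℂ p1p1Weight1 ((d i + d j) / 2) ⊓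
          MvPolynomial.weightedHomogeneousSubmodule ℂ p1p1Weight2 ((e i + e j) / 2) :
          Submodule ℂ (MvPolynomial (Fin 4) ℂ))))
      (fun p =>
        IsQuadricBundleP1P1 (fun i j => (p i j : MvPolynomial (Fin 4) ℂ)) →
          ¬ IsStablyRationalFunctionField
            (p1p1BundleFFMap (fun i j => (p i j : MvPolynomial (Fin 4) ℂ)))) := by
  have h12 : d 1 ≤ d 2 := by
    rcases hlex 1 with h | h
    · exact h.le
    · exact h.1.le
  obtain ⟨r, hr⟩ := hpare 1 2
  rcases hcase with ⟨h1, h3, he, he3⟩ | ⟨h1, h3, he0, he, he2⟩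
  · refine FieldPlace.veryGeneral_of_integral_form
      (FieldPlace.map_biFormOne_mem (D := fun i j => (d i + d j) / 2)
        (E := fun i j => (e i + e j) / 2) ?_ ?_ ?_ ?_ ?_ ?_ ?_ ?_)
      (fun P _ hA _ => P.hasNonsplitPlace_of_biFormOne hA) fun hx w hw h => ?_
    any_goals omega
    simp only [FieldPlace.aeval_biFormOne] at h
    exact FieldPlace.iso_of_specialFormOne hx w hw h
  · obtain ⟨s, hs⟩ := hpare 0 2
    obtain ⟨t, ht⟩ := hpare 0 3
    refine FieldPlace.veryGeneral_of_integral_form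
      (FieldPlace.map_biFormTwo_mem (D := fun i j => (d i + d j) / 2)
        (E := fun i j => (e i + e j) / 2) ?_ ?_ ?_ ?_ ?_ ?_ ?_ ?_ ?_ ?_ ?_ ?_)
      (fun P _ hA _ => P.hasNonsplitPlace_of_biFormTwo hA) fun hx w hw h => ?_
    any_goals omega
    simp only [FieldPlace.aeval_biFormTwo] at h
    exact FieldPlace.iso_of_specialFormTwo hx w hw h
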